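/- arXiv:1803.08905 — 2 statements merged into one kernel-verified Lean document; each statement's English description precedes it below -/
import Mathlib

section
/- There exists a constant C > 0 with the following property. Let s and D be positive integers with s odd, s ≥ 3D, and s/(D·log D) ≥ C. Let n range over positive integers with Dn even, and for j ∈ {1, …, D} set r_{n,j} = Σ_{m=1}^{∞} R_n(m + j/D). Then for all j, j' ∈ {1, …, D}, the ratio r_{n,j'}/r_{n,j} tends to 1 as n → ∞ (along n with Dn even). -/
/-- The rational function `R_n(t)` of Fischler–Sprang–Zudilin (depending on `s` and `D`). -/
noncomputable def R (s D n : ℕ) (t : ℝ) : ℝ :=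
  (D : ℝ) ^ (3 * D * n) * (n.factorial : ℝ) ^ (s + 1 - 3 * D) *
    (∏ j ∈ Finset.range (3 * D * n + 1), (t - n + (j : ℝ) / D)) /
    (∏ j ∈ Finset.range (n + 1), (t + j)) ^ (s + 1)

open Finset

/-- Total variation of an almost unimodal sequence. -/
theorem sum_abs_sub_le_of_almost_unimodal {a : ℕ → ℝ} (ha : ∀ N, 0 < a N) (hs : Summable a)
    {ε : ℝ} (hε : 0 ≤ ε) {N₁ N₂ : ℕ} (h12 : N₁ < N₂)
    (hinc : ∀ N < N₁, a N ≤ a (N + 1))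
    (hmid : ∀ N, N₁ ≤ N → N < N₂ → |a (N + 1) - a N| ≤ ε * a N)
    (hdec : ∀ N, N₂ ≤ N → a (N + 1) ≤ a N) (M : ℕ) :
    ∑ N ∈ range M, |a (N + 1) - a N| ≤ (3 * ε + 2 / ((N₂ : ℝ) - N₁)) * ∑' N, a N := by
  set S := ∑' N, a N with hS
  have hfin : ∀ u : Finset ℕ, ∑ N ∈ u, a N ≤ S := fun u =>
    hs.sum_le_tsum u (fun i _ => (ha i).le)
  have hmidsum : ∀ u : Finset ℕ, u ⊆ Ico N₁ N₂ → ∑ N ∈ u, |a (N + 1) - a N| ≤ ε * S := by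
    intro u hu
    calc ∑ N ∈ u, |a (N + 1) - a N| ≤ ∑ N ∈ u, ε * a N := by
          refine sum_le_sum fun N hN => ?_
          have := mem_Ico.1 (hu hN)
          exact hmid N this.1 this.2
      _ = ε * ∑ N ∈ u, a N := by rw [mul_sum]
      _ ≤ ε * S := mul_le_mul_of_nonneg_left (hfin u) hε
  have hdiff : ∀ p q, N₁ ≤ p → p ≤ q → q ≤ N₂ → |a q - a p| ≤ ε * S := by
    intro p q h1 h2 h3
    rw [← sum_Ico_sub a h2]
    refine (abs_sum_le_sum_abs _ _).trans (hmidsum _ ?_)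
    exact Ico_subset_Ico h1 h3
  have hW : (0 : ℝ) < (N₂ : ℝ) - N₁ := by
    have : (N₁ : ℝ) < N₂ := by exact_mod_cast h12
    linarith
  have hend : ∀ b : ℝ, (∀ N ∈ Ico N₁ N₂, b ≤ a N + ε * S) → b ≤ ε * S + S / ((N₂ : ℝ) - N₁) := by
    intro b hb
    have h1 := sum_le_sum hb
    rw [sum_const, sum_add_distrib, sum_const, Nat.card_Ico, nsmul_eq_mul, nsmul_eq_mul,
      Nat.cast_sub h12.le] at h1
    have h2 := hfin (Ico N₁ N₂)
    have h3 : b - ε * S ≤ S / ((N₂ : ℝ) - N₁) := by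
      rw [le_div_iff₀ hW]
      nlinarith
    linarith
  have hN₁ : a N₁ ≤ ε * S + S / ((N₂ : ℝ) - N₁) := by
    refine hend _ fun N hN => ?_
    have := mem_Ico.1 hN
    have := abs_le.1 (hdiff N₁ N le_rfl this.1 this.2.le)
    linarith
  have hN₂ : a N₂ ≤ ε * S + S / ((N₂ : ℝ) - N₁) := by
    refine hend _ fun N hN => ?_
    have := mem_Ico.1 hN
    have := abs_le.1 (hdiff N N₂ this.1 this.2.le le_rfl)
    linarith
  have hmono : ∑ N ∈ range M, |a (N + 1) - a N| ≤ ∑ N ∈ range (N₂ + M), |a (N + 1) - a N| :=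
    sum_le_sum_of_subset_of_nonneg (range_mono (by omega)) fun _ _ _ => abs_nonneg _
  have hleft : ∑ N ∈ range N₁, |a (N + 1) - a N| ≤ a N₁ := by
    rw [sum_congr rfl fun N hN => abs_of_nonneg (sub_nonneg.2 (hinc N (mem_range.1 hN))),
      sum_range_sub]
    linarith [ha 0]
  have hright : ∑ N ∈ Ico N₂ (N₂ + M), |a (N + 1) - a N| ≤ a N₂ := by
    have : ∀ N ∈ Ico N₂ (N₂ + M), |a (N + 1) - a N| = -(a (N + 1) - a N) := fun N hN =>
      abs_of_nonpos (sub_nonpos.2 (hdec N (mem_Ico.1 hN).1))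
    rw [sum_congr rfl this, sum_neg_distrib, sum_Ico_sub a (by omega)]
    linarith [ha (N₂ + M)]
  have hsplit : ∑ N ∈ range (N₂ + M), |a (N + 1) - a N| =
      ∑ N ∈ range N₁, |a (N + 1) - a N| + ∑ N ∈ Ico N₁ N₂, |a (N + 1) - a N| +
        ∑ N ∈ Ico N₂ (N₂ + M), |a (N + 1) - a N| := by
    rw [sum_range_add_sum_Ico _ h12.le, sum_range_add_sum_Ico _ (by omega)]
  have hm := hmidsum _ (subset_refl (Ico N₁ N₂))
  have : (3 * ε + 2 / ((N₂ : ℝ) - N₁)) * S = 3 * (ε * S) + 2 * (S / ((N₂ : ℝ) - N₁)) := by ring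
  linarith

/-- Residue-class sums of a sequence of small variation are close to each other. -/
theorem abs_tsum_residue_div_sub_one_le {a : ℕ → ℝ} (ha : ∀ N, 0 < a N) (hs : Summable a)
    {D : ℕ} (hD : 0 < D) {ε : ℝ} (hε : 2 * (D : ℝ) ^ 2 * ε ≤ 1)
    (htv : ∀ M, ∑ N ∈ range M, |a (N + 1) - a N| ≤ ε * ∑' N, a N)
    {i i' : ℕ} (hi : i < D) (hi' : i' < D) :
    |(∑' k, a (i' + D * k)) / (∑' k, a (i + D * k)) - 1| ≤ 2 * (D : ℝ) ^ 2 * ε := by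
  set S := ∑' N, a N with hS
  set r : ℕ → ℝ := fun i => ∑' k, a (i + D * k) with hr
  have hinj : ∀ i, Function.Injective fun k => i + D * k := fun i k l h => by
    have : D * k = D * l := by simpa using h
    exact Nat.eq_of_mul_eq_mul_left hD this
  have hsr : ∀ i, Summable fun k => a (i + D * k) := fun i => hs.comp_injective (hinj i)
  have hd : Summable fun N => |a (N + 1) - a N| :=
    summable_of_sum_range_le (fun _ => abs_nonneg _) htv
  have hdt : ∑' N, |a (N + 1) - a N| ≤ ε * S :=
    hd.tsum_le_of_sum_range_le htv
  have hSpos : 0 < S := hs.tsum_pos (fun N => (ha N).le) 0 (ha 0)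
  have hε0 : 0 ≤ ε := by
    have := htv 0
    simp only [range_zero, sum_empty] at this
    exact nonneg_of_mul_nonneg_left this hSpos
  have hstep : ∀ i, |r (i + 1) - r i| ≤ ε * S := by
    intro i
    have h1 : r (i + 1) - r i = ∑' k, (a (i + D * k + 1) - a (i + D * k)) := by
      rw [hr]
      simp only
      rw [← Summable.tsum_sub (hsr (i + 1)) (hsr i)]
      refine tsum_congr fun k => ?_
      rw [show i + 1 + D * k = i + D * k + 1 by ring]
    have h2 : Summable fun k => |a (i + D * k + 1) - a (i + D * k)| := hd.comp_injective (hinj i)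
    rw [h1]
    refine le_trans ?_ (le_trans (tsum_comp_le_tsum_of_inj hd (fun _ => abs_nonneg _) (hinj i)) hdt)
    exact norm_tsum_le_tsum_norm (f := fun k => a (i + D * k + 1) - a (i + D * k)) h2
  have hdist : ∀ i l, |r (i + l) - r i| ≤ l * (ε * S) := by
    intro i l
    induction l with
    | zero => simp
    | succ l ih =>
      have := abs_sub_le (r (i + (l + 1))) (r (i + l)) (r i)
      have h2 := hstep (i + l)
      rw [← add_assoc] at this ⊢
      push_cast
      linarith
  have hεS : 0 ≤ ε * S := by positivity
  have hall : ∀ i i', i < D → i' < D → |r i' - r i| ≤ D * (ε * S) := by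
    intro i i' hi hi'
    rcases le_total i i' with h | h
    · obtain ⟨l, rfl⟩ := Nat.exists_eq_add_of_le h
      refine (hdist i l).trans (mul_le_mul_of_nonneg_right ?_ hεS)
      exact_mod_cast (by omega : l ≤ D)
    · obtain ⟨l, rfl⟩ := Nat.exists_eq_add_of_le h
      rw [abs_sub_comm]
      refine (hdist i' l).trans (mul_le_mul_of_nonneg_right ?_ hεS)
      exact_mod_cast (by omega : l ≤ D)
  have : NeZero D := ⟨hD.ne'⟩
  have hsum : S ≤ D * (r i + D * (ε * S)) := by
    calc S = ∑ j : ZMod D, ∑' m, a (j.val + D * m) := Nat.sumByResidueClasses hs D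
      _ ≤ ∑ j : ZMod D, (r i + D * (ε * S)) := by
          refine sum_le_sum fun j _ => ?_
          have := (abs_le.1 (hall i j.val hi (ZMod.val_lt j))).2
          change r j.val ≤ _
          linarith
      _ = D * (r i + D * (ε * S)) := by
          rw [sum_const, card_univ, ZMod.card, nsmul_eq_mul]
  have hDpos : (0 : ℝ) < D := by exact_mod_cast hD
  have hlow : S ≤ 2 * D * r i := by nlinarith
  have hrpos : 0 < r i := by
    by_contra h
    nlinarith
  have h1 := hall i i' hi hi'
  change |r i' / r i - 1| ≤ _
  rw [div_sub_one hrpos.ne', abs_div, abs_of_pos hrpos, div_le_iff₀ hrpos]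
  refine h1.trans ?_
  have := mul_le_mul_of_nonneg_left hlow (mul_nonneg hDpos.le hε0)
  nlinarith

/-- The limiting value of the logarithm of the ratio `f (t + 1) / f t` at `t = (x + 1) n`. -/
noncomputable def logRate (p q x : ℝ) : ℝ :=
  p * (Real.log (x + 3) - Real.log x) - q * (Real.log (x + 2) - Real.log (x + 1))

theorem hasDerivAt_logRate (p q : ℝ) {x : ℝ} (hx : 0 < x) :
    HasDerivAt (logRate p q)
      (((q - 3 * p) * (x * (x + 3)) - 6 * p) / (x * (x + 1) * (x + 2) * (x + 3))) x := by
  have hlog : ∀ c : ℝ, 0 ≤ c → HasDerivAt (fun y => Real.log (y + c)) (1 / (x + c)) x :=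
    fun c hc => ((hasDerivAt_id x).add_const c).log (by simp; positivity)
  have h0 : HasDerivAt (fun y => Real.log y) (1 / x) x := by
    simpa using hlog 0 le_rfl
  have := (((hlog 3 (by norm_num)).sub h0).const_mul p).sub
    (((hlog 2 (by norm_num)).sub (hlog 1 (by norm_num))).const_mul q)
  refine this.congr_deriv ?_
  field_simp
  ring

theorem continuousOn_logRate (p q : ℝ) : ContinuousOn (logRate p q) (Set.Ioi 0) :=
  fun _ hx => (hasDerivAt_logRate p q hx).continuousAt.continuousWithinAt

theorem tendsto_logRate_atTop (p q : ℝ) :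
    Filter.Tendsto (logRate p q) Filter.atTop (nhds 0) := by
  have hinv : Filter.Tendsto (fun x : ℝ => x⁻¹) Filter.atTop (nhds 0) := tendsto_inv_atTop_zero
  have hlog : ∀ c : ℝ, Filter.Tendsto (fun x : ℝ => Real.log (1 + c * x⁻¹)) Filter.atTop
      (nhds 0) := fun c => by
    have h1 : Filter.Tendsto (fun x : ℝ => 1 + c * x⁻¹) Filter.atTop (nhds 1) := by
      simpa using (hinv.const_mul c).const_add 1
    simpa using h1.log one_ne_zero
  have := ((hlog 3).const_mul p).sub (((hlog 2).sub (hlog 1)).const_mul q)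
  simp only [mul_zero, sub_zero] at this
  refine this.congr' ?_
  filter_upwards [Filter.eventually_gt_atTop 0] with x hx
  have key : ∀ c : ℝ, 0 ≤ c → Real.log (1 + c * x⁻¹) = Real.log (x + c) - Real.log x := by
    intro c hc
    rw [← Real.log_div (by positivity) hx.ne']
    congr 1
    field_simp
  rw [key 3 (by norm_num), key 2 (by norm_num), key 1 (by norm_num), logRate]
  ring

/-- `logRate p q` crosses zero exactly once on `(0, ∞)`, strictly decreasingly. -/
theorem exists_logRate_zero {p q : ℝ} (hp : 0 < p) (hpq : 3 * p < q) :
    ∃ z : ℝ, 0 < z ∧ logRate p q z = 0 ∧ StrictAntiOn (logRate p q) (Set.Ioc 0 z) ∧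
      ∀ x, z ≤ x → logRate p q x ≤ 0 := by
  have hqp : 0 < q - 3 * p := by linarith
  obtain ⟨c, hc, hcc⟩ : ∃ c : ℝ, 0 < c ∧ (q - 3 * p) * (c * (c + 3)) = 6 * p := by
    set w := 6 * p / (q - 3 * p) with hw
    have hwpos : 0 < w := by positivity
    refine ⟨(Real.sqrt (9 + 4 * w) - 3) / 2, ?_, ?_⟩
    · have : (3 : ℝ) < Real.sqrt (9 + 4 * w) := by
        rw [Real.lt_sqrt (by norm_num)]
        linarith
      linarith
    · have h1 : Real.sqrt (9 + 4 * w) ^ 2 = 9 + 4 * w := Real.sq_sqrt (by positivity)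
      have h2 : (q - 3 * p) * w = 6 * p := by rw [hw]; field_simp
      rw [← h2]
      linear_combination (q - 3 * p) / 4 * h1
  have hanti : StrictAntiOn (logRate p q) (Set.Ioc 0 c) := by
    refine strictAntiOn_of_deriv_neg (convex_Ioc 0 c)
      ((continuousOn_logRate p q).mono Set.Ioc_subset_Ioi_self) ?_
    rw [interior_Ioc]
    rintro x ⟨hx, hxc⟩
    rw [(hasDerivAt_logRate p q hx).deriv]
    refine div_neg_of_neg_of_pos ?_ (by positivity)
    have : x * (x + 3) < c * (c + 3) := by nlinarith
    nlinarith
  have hmono : MonotoneOn (logRate p q) (Set.Ici c) := by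
    refine monotoneOn_of_deriv_nonneg (convex_Ici c)
      ((continuousOn_logRate p q).mono fun x hx => hc.trans_le hx) ?_ ?_
    · rw [interior_Ici]
      exact fun x hx =>
        (hasDerivAt_logRate p q (hc.trans hx)).differentiableAt.differentiableWithinAt
    · rw [interior_Ici]
      intro x hx
      have hx' : c < x := hx
      have hx0 : 0 < x := hc.trans hx'
      rw [(hasDerivAt_logRate p q hx0).deriv]
      refine div_nonneg ?_ (by positivity)
      have : c * (c + 3) ≤ x * (x + 3) := by nlinarith
      nlinarith
  have hright : ∀ x, c ≤ x → logRate p q x ≤ 0 := by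
    intro x hx
    refine ge_of_tendsto (tendsto_logRate_atTop p q) ?_
    filter_upwards [Filter.eventually_ge_atTop x] with y hy
    exact hmono hx (hx.trans hy) hy
  obtain ⟨b, hb, hbpos⟩ : ∃ b : ℝ, 0 < b ∧ 0 < logRate p q b := by
    refine ⟨Real.exp (-(q / p * Real.log 2)), Real.exp_pos _, ?_⟩
    set b := Real.exp (-(q / p * Real.log 2)) with hbdef
    have hb : 0 < b := Real.exp_pos _
    have h1 : 0 < Real.log (b + 3) := Real.log_pos (by linarith)
    have h2 : Real.log (b + 2) - Real.log (b + 1) ≤ Real.log 2 := by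
      rw [← Real.log_div (by positivity) (by positivity)]
      refine Real.log_le_log (by positivity) ?_
      rw [div_le_iff₀ (by positivity)]
      linarith
    have h3 : p * Real.log b = -(q * Real.log 2) := by
      rw [hbdef, Real.log_exp]
      field_simp
    have h4 := mul_le_mul_of_nonneg_left h2 (by linarith : (0 : ℝ) ≤ q)
    have h5 : 0 < p * Real.log (b + 3) := by positivity
    rw [logRate]
    linarith
  have hbc : b < c := by
    by_contra h
    exact absurd (hright b (not_lt.1 h)) (not_le.2 hbpos)
  obtain ⟨z, ⟨hbz, hzc⟩, hz⟩ := intermediate_value_Icc' hbc.le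
    ((continuousOn_logRate p q).mono fun x hx => hb.trans_le hx.1) ⟨hright c le_rfl, hbpos.le⟩
  have hz0 : 0 < z := hb.trans_le hbz
  refine ⟨z, hz0, hz, hanti.mono (Set.Ioc_subset_Ioc_right hzc), fun x hx => ?_⟩
  rcases le_total c x with h | h
  · exact hright x h
  · rw [← hz]
    exact hanti.antitoneOn ⟨hz0, hzc⟩ ⟨hz0.trans_le hx, h⟩ hx

theorem exp_logRate (p q : ℕ) {u v : ℝ} (hu : 0 < u) (hv : 0 < v) :
    Real.exp (logRate p q (u / v)) =
      ((u + 3 * v) / u) ^ p * ((u + v) / (u + 2 * v)) ^ q := by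
  have hx : 0 < u / v := by positivity
  rw [logRate, sub_eq_add_neg, Real.exp_add, ← mul_neg, neg_sub, ← Real.log_div (by positivity)
    (by positivity), ← Real.log_div (by positivity) (by positivity), Real.exp_nat_mul,
    Real.exp_nat_mul, Real.exp_log (by positivity), Real.exp_log (by positivity)]
  congr 2 <;> field_simp

theorem add_one_div_le_pow_and_pow_le {D : ℕ} (hD : 0 < D) {y : ℝ} (hy : 1 < y) :
    (y + 1) / y ≤ ((y + 1 / D) / y) ^ D ∧ ((y + 1 / D) / y) ^ D ≤ y / (y - 1) := by
  have hD' : (0 : ℝ) < D := by exact_mod_cast hD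
  have hy0 : 0 < y := by linarith
  have hy1 : 0 < y - 1 := by linarith
  have heq : (y + 1 / D) / y = 1 + 1 / (D * y) := by field_simp
  rw [heq]
  constructor
  · have := one_add_mul_le_pow (a := 1 / (D * y)) (by
      have : 0 < 1 / (D * y) := by positivity
      linarith) D
    refine le_trans (le_of_eq ?_) this
    field_simp
  · have h1 : 1 + 1 / (D * y) ≤ Real.exp (1 / (D * y)) := by
      linarith [Real.add_one_le_exp (1 / (D * y))]
    have h2 := pow_le_pow_left₀ (by positivity) h1 D
    rw [← Real.exp_nat_mul, show (D : ℝ) * (1 / (D * y)) = 1 / y by field_simp] at h2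
    refine h2.trans ?_
    have h3 := Real.add_one_le_exp (-(1 / y))
    have h4 : (y - 1) / y ≤ Real.exp (-(1 / y)) := by
      refine le_trans (le_of_eq ?_) h3
      field_simp
      ring
    rw [Real.exp_neg] at h4
    rw [← inv_div (y - 1) y]
    exact (le_inv_comm₀ (by positivity) (Real.exp_pos _)).1 h4

theorem prod_shift_pow_bounds {D : ℕ} (hD : 0 < D) {t : ℝ} (ht : 1 < t) (n : ℕ) :
    (t + n + 1) / t ≤
        ((∏ i ∈ range (n + 1), (t + 1 / D + i)) / ∏ i ∈ range (n + 1), (t + i)) ^ D ∧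
      ((∏ i ∈ range (n + 1), (t + 1 / D + i)) / ∏ i ∈ range (n + 1), (t + i)) ^ D ≤
        (t + n) / (t - 1) := by
  have hD' : (0 : ℝ) < D := by exact_mod_cast hD
  have ht1 : 0 < t - 1 := by linarith
  have ht0 : 0 < t := by linarith
  induction n with
  | zero => simpa using add_one_div_le_pow_and_pow_le hD ht
  | succ n ih =>
    rw [prod_range_succ _ (n + 1), prod_range_succ _ (n + 1), mul_div_mul_comm, mul_pow]
    have hn : (0 : ℝ) ≤ n := n.cast_nonneg
    have h := add_one_div_le_pow_and_pow_le hD (y := t + ((n + 1 : ℕ) : ℝ)) (by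
      push_cast
      linarith)
    rw [show t + ((n + 1 : ℕ) : ℝ) + 1 / D = t + 1 / D + ((n + 1 : ℕ) : ℝ) by ring] at h
    have hpos : 0 ≤ ((t + 1 / D + ((n + 1 : ℕ) : ℝ)) / (t + ((n + 1 : ℕ) : ℝ))) ^ D := by
      positivity
    have hl : 0 ≤ (t + ((n + 1 : ℕ) : ℝ) + 1) / (t + ((n + 1 : ℕ) : ℝ)) := by positivity
    constructor
    · refine le_trans (le_of_eq ?_) (mul_le_mul ih.1 h.1 hl
        (le_trans (by positivity) ih.1))
      push_cast
      field_simp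
      ring
    · refine (mul_le_mul ih.2 h.2 hpos (by positivity)).trans (le_of_eq ?_)
      push_cast
      have : t + (n + 1) - 1 ≠ 0 := by linarith
      have : t + (n : ℝ) ≠ 0 := by positivity
      rw [show t + ((n : ℝ) + 1) - 1 = t + n by ring]
      field_simp

theorem R_add_eq (s D n : ℕ) (u : ℝ) :
    R s D n (n + u) = (D : ℝ) ^ (3 * D * n) * (n.factorial : ℝ) ^ (s + 1 - 3 * D) *
      (∏ j ∈ range (3 * D * n + 1), (u + (j : ℝ) / D)) /
      (∏ j ∈ range (n + 1), (n + u + j)) ^ (s + 1) := by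
  rw [R]
  simp only [add_sub_cancel_left]

theorem R_add_pos (s n : ℕ) {D : ℕ} (hD : 0 < D) {u : ℝ} (hu : 0 < u) :
    0 < R s D n (n + u) := by
  have hD' : (0 : ℝ) < D := by exact_mod_cast hD
  rw [R_add_eq]
  have h1 : 0 < ∏ j ∈ range (3 * D * n + 1), (u + (j : ℝ) / D) :=
    prod_pos fun _ _ => by positivity
  have h2 : 0 < ∏ j ∈ range (n + 1), ((n : ℝ) + u + j) := prod_pos fun _ _ => by positivity
  positivity

theorem R_eq_zero (s : ℕ) {D n m j : ℕ} (hD : 0 < D) (hj : j ≤ D) (hm : m + 1 < n) :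
    R s D n ((m : ℝ) + 1 + (j : ℝ) / D) = 0 := by
  have hD' : (D : ℝ) ≠ 0 := by exact_mod_cast hD.ne'
  obtain ⟨l, rfl⟩ : ∃ l, n = m + 2 + l := Nat.exists_eq_add_of_le (by omega)
  have hz : ∏ i ∈ range (3 * D * (m + 2 + l) + 1),
      ((m : ℝ) + 1 + (j : ℝ) / D - ((m + 2 + l : ℕ) : ℝ) + (i : ℝ) / D) = 0 := by
    refine prod_eq_zero (i := D * (l + 1) - j) (mem_range.2 ?_) ?_
    · have : D * (l + 1) ≤ 3 * D * (m + 2 + l) := by nlinarith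
      omega
    · rw [Nat.cast_sub (by nlinarith)]
      push_cast
      field_simp
      ring
  rw [R, hz]
  simp

theorem prod_add_div_shift (D : ℕ) (u : ℝ) (M : ℕ) :
    (∏ j ∈ range M, (u + 1 / D + (j : ℝ) / D)) * u =
      (∏ j ∈ range M, (u + (j : ℝ) / D)) * (u + (M : ℝ) / D) := by
  have h := prod_range_succ' (fun j : ℕ => u + (j : ℝ) / D) M
  rw [prod_range_succ] at h
  rw [h]
  congr 1
  · refine prod_congr rfl fun j _ => ?_
    push_cast
    ring
  · simp

theorem R_shift_div (s n : ℕ) {D : ℕ} (hD : 0 < D) {u : ℝ} (hu : 0 < u) :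
    R s D n (n + (u + 1 / D)) / R s D n (n + u) =
      ((u + 3 * n + 1 / D) / u) /
        ((∏ i ∈ range (n + 1), ((n : ℝ) + u + 1 / D + i)) /
          ∏ i ∈ range (n + 1), ((n : ℝ) + u + i)) ^ (s + 1) := by
  have hD' : (0 : ℝ) < D := by exact_mod_cast hD
  have hA := prod_add_div_shift D u (3 * D * n + 1)
  rw [R_add_eq, R_add_eq]
  have h1 : 0 < ∏ j ∈ range (3 * D * n + 1), (u + (j : ℝ) / D) :=
    prod_pos fun _ _ => by positivity
  have h2 : 0 < ∏ j ∈ range (n + 1), ((n : ℝ) + u + j) := prod_pos fun _ _ => by positivity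
  have h3 : 0 < ∏ j ∈ range (n + 1), ((n : ℝ) + u + 1 / D + j) :=
    prod_pos fun _ _ => by positivity
  simp only [← add_assoc]
  have hA' : ∏ j ∈ range (3 * D * n + 1), (u + 1 / D + (j : ℝ) / D) =
      (∏ j ∈ range (3 * D * n + 1), (u + (j : ℝ) / D)) * ((u + 3 * n + 1 / D) / u) := by
    rw [← mul_div_assoc, eq_div_iff hu.ne', hA]
    congr 1
    push_cast
    field_simp
    ring
  rw [hA']
  set A := ∏ j ∈ range (3 * D * n + 1), (u + (j : ℝ) / D)
  set P := ∏ j ∈ range (n + 1), ((n : ℝ) + u + j)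
  set Q := ∏ j ∈ range (n + 1), ((n : ℝ) + u + 1 / D + j)
  have hf : (0 : ℝ) < n.factorial := by exact_mod_cast n.factorial_pos
  set B := (u + 3 * n + 1 / D) / u
  have hK : (0 : ℝ) < (D : ℝ) ^ (3 * D * n) * (n.factorial : ℝ) ^ (s + 1 - 3 * D) := by positivity
  set K := (D : ℝ) ^ (3 * D * n) * (n.factorial : ℝ) ^ (s + 1 - 3 * D)
  rw [div_pow]
  field_simp

theorem R_shift_div_pow_bounds {s D n : ℕ} (hD : 0 < D) (hDs : D ≤ s + 1) (hn : 0 < n) {u : ℝ}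
    (hu : 0 < u) :
    Real.exp (logRate D (s + 1 : ℕ) (u / n)) * (1 - 1 / (n : ℝ)) ^ (s + 1) ≤
        (R s D n (n + (u + 1 / D)) / R s D n (n + u)) ^ D ∧
      (R s D n (n + (u + 1 / D)) / R s D n (n + u)) ^ D ≤
        Real.exp (logRate D (s + 1 : ℕ) (u / n)) := by
  have hD' : (0 : ℝ) < D := by exact_mod_cast hD
  have hn1 : (1 : ℝ) ≤ n := by exact_mod_cast hn
  have hn0 : (0 : ℝ) < n := by linarith
  have hpow : ∀ B Q : ℝ, (B / Q ^ (s + 1)) ^ D = B ^ D / (Q ^ D) ^ (s + 1) := fun B Q => by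
    rw [div_pow, ← pow_mul, ← pow_mul, mul_comm]
  rw [exp_logRate D (s + 1) hu hn0, R_shift_div s n hD hu, hpow]
  have hb := prod_shift_pow_bounds hD (t := n + u) (by linarith) n
  set Q := ((∏ i ∈ range (n + 1), ((n : ℝ) + u + 1 / D + i)) /
          ∏ i ∈ range (n + 1), ((n : ℝ) + u + i)) ^ D
  have hQ : 0 < Q := lt_of_lt_of_le (by positivity) hb.1
  have ht1 : 0 < (n : ℝ) + u - 1 := by linarith
  constructor
  · have h1 : ((u + n) / (u + 2 * n)) * (1 - 1 / (n : ℝ)) ≤ Q⁻¹ := by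
      have h2 : ((n + u + n) / (n + u - 1))⁻¹ ≤ Q⁻¹ := inv_anti₀ hQ hb.2
      refine le_trans ?_ h2
      rw [inv_div, show (n : ℝ) + u + n = u + 2 * n by ring, div_mul_eq_mul_div]
      refine div_le_div_of_nonneg_right ?_ (by positivity)
      have h3 : (u + n) * (1 / (n : ℝ)) = u / n + 1 := by field_simp
      have h4 : 0 < u / n := by positivity
      linarith
    have h0 : 0 ≤ 1 - 1 / (n : ℝ) := by
      rw [sub_nonneg, div_le_one hn0]
      exact hn1
    rw [mul_assoc, ← mul_pow, div_eq_mul_inv _ (Q ^ (s + 1)), ← inv_pow]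
    refine mul_le_mul (pow_le_pow_left₀ (by positivity) ?_ D)
      (pow_le_pow_left₀ (by positivity) h1 _) (by positivity) (by positivity)
    refine div_le_div_of_nonneg_right ?_ hu.le
    have : 0 < 1 / (D : ℝ) := by positivity
    linarith
  · have h1 : Q⁻¹ ≤ (u + n) / (u + 2 * n + 1) := by
      have h2 := inv_anti₀ (by positivity) hb.1
      rw [inv_div] at h2
      refine h2.trans (le_of_eq ?_)
      congr 1 <;> ring
    have hA : (u + 3 * n + 1 / D) / (u + 3 * n) ≤ (u + 2 * n + 1) / (u + 2 * n) := by
      have h3 : 1 / (D : ℝ) ≤ 1 := by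
        rw [div_le_one hD']
        exact_mod_cast hD
      rw [div_le_div_iff₀ (by positivity) (by positivity)]
      nlinarith
    have hB : 1 ≤ (u + 2 * n + 1) / (u + 2 * n) := by
      rw [le_div_iff₀ (by positivity)]
      linarith
    have hAB : ((u + 3 * n + 1 / D) / (u + 3 * n)) ^ D ≤
        ((u + 2 * n + 1) / (u + 2 * n)) ^ (s + 1) :=
      (pow_le_pow_left₀ (by positivity) hA D).trans (pow_le_pow_right₀ hB hDs)
    rw [div_eq_mul_inv _ (Q ^ (s + 1)), ← inv_pow]
    calc ((u + 3 * n + 1 / D) / u) ^ D * Q⁻¹ ^ (s + 1)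
        ≤ ((u + 3 * n + 1 / D) / u) ^ D * ((u + n) / (u + 2 * n + 1)) ^ (s + 1) :=
          mul_le_mul_of_nonneg_left (pow_le_pow_left₀ (by positivity) h1 _) (by positivity)
      _ = ((u + 3 * n) / u) ^ D * ((u + n) / (u + 2 * n + 1)) ^ (s + 1) *
            ((u + 3 * n + 1 / D) / (u + 3 * n)) ^ D := by
          rw [mul_right_comm, ← mul_pow]
          congr 2
          field_simp
      _ ≤ ((u + 3 * n) / u) ^ D * ((u + n) / (u + 2 * n + 1)) ^ (s + 1) *
            ((u + 2 * n + 1) / (u + 2 * n)) ^ (s + 1) :=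
          mul_le_mul_of_nonneg_left hAB (by positivity)
      _ = ((u + 3 * n) / u) ^ D * ((u + n) / (u + 2 * n)) ^ (s + 1) := by
          rw [mul_assoc, ← mul_pow]
          congr 2
          field_simp

theorem summable_R {s D n : ℕ} (hD : 0 < D) (hs : 3 * D ≤ s) (hn : 0 < n) :
    Summable fun N : ℕ => R s D n (n + ((N : ℝ) + 1) / D) := by
  have hD' : (0 : ℝ) < D := by exact_mod_cast hD
  have hn1 : (1 : ℝ) ≤ n := by exact_mod_cast hn
  set K := (D : ℝ) ^ (3 * D * n) * (n.factorial : ℝ) ^ (s + 1 - 3 * D) with hK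
  have hK0 : 0 ≤ K := by positivity
  have hsum : Summable fun N : ℕ => K * 3 ^ (3 * D * n + 1) * (D : ℝ) ^ 2 *
      (1 / ((N + 1 : ℕ) : ℝ) ^ 2) :=
    (((summable_nat_add_iff 1).2 (Real.summable_one_div_nat_pow.2 one_lt_two))).mul_left _
  refine hsum.of_nonneg_of_le (fun N => (R_add_pos s n hD (by positivity)).le) fun N => ?_
  set u : ℝ := ((N : ℝ) + 1) / D with hu
  have hu0 : 0 < u := by positivity
  have hy : 1 ≤ (n : ℝ) + u := by linarith
  have hy0 : 0 < (n : ℝ) + u := by linarith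
  rw [R_add_eq, ← hK]
  have hnum : ∏ j ∈ range (3 * D * n + 1), (u + (j : ℝ) / D) ≤
      (3 * (n + u)) ^ (3 * D * n + 1) := by
    calc _ ≤ ∏ j ∈ range (3 * D * n + 1), (3 * ((n : ℝ) + u)) := by
          refine prod_le_prod (fun _ _ => by positivity) fun j hj => ?_
          have h1 : j ≤ 3 * D * n := by
            have := mem_range.1 hj
            omega
          have h2 : (j : ℝ) ≤ 3 * D * n := by exact_mod_cast h1
          have h3 : (j : ℝ) / D ≤ 3 * n := by
            rw [div_le_iff₀ hD']
            linarith
          linarith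
      _ = _ := by rw [prod_const, card_range]
  have hden : ((n : ℝ) + u) ^ (n + 1) ≤ ∏ j ∈ range (n + 1), ((n : ℝ) + u + j) := by
    calc _ = ∏ j ∈ range (n + 1), ((n : ℝ) + u) := by rw [prod_const, card_range]
      _ ≤ _ := prod_le_prod (fun _ _ => hy0.le) fun j _ => by
          have : (0 : ℝ) ≤ j := j.cast_nonneg
          linarith
  have hden2 : ((n : ℝ) + u) ^ (3 * D * n + 1) * u ^ 2 ≤
      (∏ j ∈ range (n + 1), ((n : ℝ) + u + j)) ^ (s + 1) := by
    calc _ ≤ ((n : ℝ) + u) ^ (3 * D * n + 1) * ((n : ℝ) + u) ^ 2 :=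
          mul_le_mul_of_nonneg_left (pow_le_pow_left₀ hu0.le (by linarith) 2) (by positivity)
      _ = ((n : ℝ) + u) ^ (3 * D * n + 1 + 2) := by rw [← pow_add]
      _ ≤ ((n : ℝ) + u) ^ ((n + 1) * (s + 1)) := pow_le_pow_right₀ hy (by nlinarith)
      _ = (((n : ℝ) + u) ^ (n + 1)) ^ (s + 1) := by rw [pow_mul]
      _ ≤ _ := pow_le_pow_left₀ (by positivity) hden _
  calc _ ≤ K * (3 * (n + u)) ^ (3 * D * n + 1) / (((n : ℝ) + u) ^ (3 * D * n + 1) * u ^ 2) :=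
        div_le_div₀ (by positivity) (mul_le_mul_of_nonneg_left hnum hK0) (by positivity) hden2
    _ = _ := by
        rw [mul_pow, hu]
        push_cast
        field_simp

theorem tsum_R_eq {s D n j : ℕ} (hD : 0 < D) (hs : 3 * D ≤ s) (hn : 0 < n) (hj : 1 ≤ j)
    (hjD : j ≤ D) :
    ∑' m : ℕ, R s D n ((m : ℝ) + 1 + (j : ℝ) / D) =
      ∑' k : ℕ, R s D n (n + (((j - 1 + D * k : ℕ) : ℝ) + 1) / D) := by
  have hD' : (D : ℝ) ≠ 0 := by exact_mod_cast hD.ne'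
  have hterm : ∀ k : ℕ, R s D n (((k + (n - 1) : ℕ) : ℝ) + 1 + (j : ℝ) / D) =
      R s D n (n + (((j - 1 + D * k : ℕ) : ℝ) + 1) / D) := by
    intro k
    congr 1
    push_cast [Nat.cast_sub hj, Nat.cast_sub hn]
    field_simp
    ring
  have hsum : Summable fun k : ℕ => R s D n (n + (((j - 1 + D * k : ℕ) : ℝ) + 1) / D) :=
    (summable_R hD hs hn).comp_injective (i := fun k => j - 1 + D * k) fun k l h => by
      have : D * k = D * l := by simpa using h
      exact Nat.eq_of_mul_eq_mul_left hD this
  have h := Summable.sum_add_tsum_nat_add' (f := fun m : ℕ => R s D n ((m : ℝ) + 1 + (j : ℝ) / D))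
    (k := n - 1) (by simpa only [hterm] using hsum)
  rw [← h, sum_eq_zero fun m hm => ?_, zero_add]
  · exact tsum_congr hterm
  · exact R_eq_zero s hD hjD (by have := mem_range.1 hm; omega)

/-- Near and away from the zero of the rate function, the sequence `R s D n (n + N / D)` is
almost unimodal, so its total variation is negligible compared with its sum. -/
theorem eventually_sum_abs_sub_R_le {s D : ℕ} (hD : 0 < D) (hs : 3 * D ≤ s) {ε : ℝ}
    (hε : 0 < ε) :
    ∀ᶠ n : ℕ in Filter.atTop, ∀ M : ℕ,
      ∑ N ∈ range M, |R s D n (n + (((N + 1 : ℕ) : ℝ) + 1) / D) -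
        R s D n (n + ((N : ℝ) + 1) / D)| ≤
      4 * ε * ∑' N : ℕ, R s D n (n + ((N : ℝ) + 1) / D) := by
  have hD' : (0 : ℝ) < D := by exact_mod_cast hD
  obtain ⟨z, hz, hz0, hanti, hright⟩ := exists_logRate_zero (p := D) (q := (s + 1 : ℕ)) hD'
    (by exact_mod_cast (by omega : 3 * D < s + 1))
  set h := logRate D (s + 1 : ℕ) with hh
  obtain ⟨y, hyε, hyz, hy⟩ : ∃ y, Real.exp (h y) < 1 + ε ∧ y < z ∧ 0 < y := by
    have hcont : Filter.Tendsto (fun y => Real.exp (h y)) (nhds z) (nhds 1) := by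
      have := (hasDerivAt_logRate (D : ℝ) (s + 1 : ℕ) hz).continuousAt.rexp.tendsto
      rw [← hh, hz0, Real.exp_zero] at this
      exact this
    have h1 := (hcont.mono_left (nhdsWithin_le_nhds (s := Set.Iio z))).eventually_lt_const
      (show (1 : ℝ) < 1 + ε by linarith)
    exact (h1.and ((eventually_mem_nhdsWithin).and
      (nhdsWithin_le_nhds (Ioi_mem_nhds hz)))).exists
  have hy1 : 1 < Real.exp (h y) := by
    rw [Real.one_lt_exp_iff, ← hz0]
    exact hanti ⟨hy, hyz.le⟩ ⟨hz, le_rfl⟩ hyz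
  have hlim : Filter.Tendsto (fun n : ℕ => (1 - 1 / (n : ℝ)) ^ (s + 1)) Filter.atTop
      (nhds 1) := by
    simpa using (tendsto_one_div_atTop_nhds_zero_nat (𝕜 := ℝ)).const_sub 1 |>.pow (s + 1)
  have hlimy : Filter.Tendsto (fun n : ℕ => Real.exp (h y) * (1 - 1 / (n : ℝ)) ^ (s + 1))
      Filter.atTop (nhds (Real.exp (h y))) := by
    simpa using hlim.const_mul (Real.exp (h y))
  have hwidth : Filter.Tendsto (fun n : ℕ => (z - y) * D * (n : ℝ)) Filter.atTop Filter.atTop :=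
    tendsto_natCast_atTop_atTop.const_mul_atTop (mul_pos (sub_pos.2 hyz) hD')
  filter_upwards [Filter.eventually_gt_atTop 0, hlimy.eventually_const_lt hy1,
    hlim.eventually_const_lt (show 1 - ε < 1 by linarith),
    hwidth.eventually_ge_atTop (1 + 2 / ε)] with n hn hny hnε hnw M
  have hn0 : (0 : ℝ) < n := by exact_mod_cast hn
  set a : ℕ → ℝ := fun N => R s D n (n + ((N : ℝ) + 1) / D) with ha
  have hapos : ∀ N, 0 < a N := fun N => R_add_pos s n hD (by positivity)
  have hratio : ∀ N : ℕ,
      Real.exp (h (((N : ℝ) + 1) / D / n)) * (1 - 1 / (n : ℝ)) ^ (s + 1) ≤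
        (a (N + 1) / a N) ^ D ∧
      (a (N + 1) / a N) ^ D ≤ Real.exp (h (((N : ℝ) + 1) / D / n)) := by
    intro N
    have h1 := R_shift_div_pow_bounds (s := s) hD (by omega) hn
      (show 0 < ((N : ℝ) + 1) / D by positivity)
    rw [← add_div, ← hh] at h1
    simpa only [ha, Nat.cast_add, Nat.cast_one] using h1
  have hx : ∀ N : ℕ, 0 < ((N : ℝ) + 1) / D / n := fun N => by positivity
  have hρ : ∀ N, 0 < a (N + 1) / a N := fun N => div_pos (hapos _) (hapos _)
  have hpw : 0 ≤ (1 - 1 / (n : ℝ)) ^ (s + 1) :=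
    pow_nonneg (sub_nonneg.2 ((div_le_one hn0).2 (by exact_mod_cast hn))) _
  have hfy : (⌊y * D * n⌋₊ : ℝ) ≤ y * D * n := Nat.floor_le (by positivity)
  have hfz : (⌊z * D * n⌋₊ : ℝ) ≤ z * D * n := Nat.floor_le (by positivity)
  have hfy' := Nat.lt_floor_add_one (y * D * n)
  have hfz' := Nat.lt_floor_add_one (z * D * n)
  have hW : 2 / ε ≤ (⌊z * D * n⌋₊ : ℝ) - ⌊y * D * n⌋₊ := by linarith
  have h2ε : 0 < 2 / ε := by positivity
  have hle : ∀ {N : ℕ} {x : ℝ}, ((N : ℝ) + 1) ≤ x * D * n → ((N : ℝ) + 1) / D / n ≤ x := by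
    intro N x hN
    rw [div_div, div_le_iff₀ (by positivity)]
    linarith
  have hge : ∀ {N : ℕ} {x : ℝ}, x * D * n ≤ ((N : ℝ) + 1) → x ≤ ((N : ℝ) + 1) / D / n := by
    intro N x hN
    rw [div_div, le_div_iff₀ (by positivity)]
    linarith
  have main := sum_abs_sub_le_of_almost_unimodal hapos (summable_R hD hs hn) hε.le
    (N₁ := ⌊y * D * n⌋₊) (N₂ := ⌊z * D * n⌋₊)
    (by exact_mod_cast (by linarith : (⌊y * D * n⌋₊ : ℝ) < ⌊z * D * n⌋₊)) ?_ ?_ ?_ M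
  · refine main.trans (mul_le_mul_of_nonneg_right ?_ (tsum_nonneg fun N => (hapos N).le))
    have : 2 / ((⌊z * D * n⌋₊ : ℝ) - ⌊y * D * n⌋₊) ≤ ε := by
      rw [div_le_iff₀ (h2ε.trans_le hW), mul_comm]
      exact (div_le_iff₀ hε).1 hW
    linarith
  · intro N hN
    have hN' : (N : ℝ) + 1 ≤ ⌊y * D * n⌋₊ := by exact_mod_cast hN
    have hxy := hle (hN'.trans hfy)
    have h1 := hanti.antitoneOn ⟨hx N, hxy.trans hyz.le⟩ ⟨hy, hyz.le⟩ hxy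
    have h2 : 1 ≤ (a (N + 1) / a N) ^ D := by
      refine hny.le.trans (le_trans ?_ (hratio N).1)
      exact mul_le_mul_of_nonneg_right (Real.exp_le_exp.2 h1) hpw
    exact (one_le_div (hapos N)).1 ((one_le_pow_iff_of_nonneg (hρ N).le hD.ne').1 h2)
  · intro N hN1 hN2
    have hN1' : (⌊y * D * n⌋₊ : ℝ) ≤ N := by exact_mod_cast hN1
    have hN2' : (N : ℝ) + 1 ≤ ⌊z * D * n⌋₊ := by exact_mod_cast hN2
    have hxz := hle (hN2'.trans hfz)
    have hyx := hge (hfy'.le.trans (by linarith))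
    have h1 := hanti.antitoneOn ⟨hy, hyz.le⟩ ⟨hx N, hxz⟩ hyx
    have h0 := hanti.antitoneOn ⟨hx N, hxz⟩ ⟨hz, le_rfl⟩ hxz
    rw [hz0] at h0
    have hup : (a (N + 1) / a N) ^ D < 1 + ε :=
      (hratio N).2.trans_lt ((Real.exp_le_exp.2 h1).trans_lt hyε)
    have hlow : 1 - ε < (a (N + 1) / a N) ^ D := by
      refine hnε.trans_le (le_trans ?_ (hratio N).1)
      exact le_mul_of_one_le_left hpw (Real.one_le_exp h0)
    have hρε : |a (N + 1) / a N - 1| ≤ ε := by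
      rw [abs_le]
      rcases le_total 1 (a (N + 1) / a N) with h1 | h1
      · have := le_self_pow₀ h1 hD.ne'
        constructor <;> linarith
      · have := pow_le_of_le_one (hρ N).le h1 hD.ne'
        constructor <;> linarith
    rwa [div_sub_one (hapos N).ne', abs_div, abs_of_pos (hapos N), div_le_iff₀ (hapos N)] at hρε
  · intro N hN
    have hN' : (⌊z * D * n⌋₊ : ℝ) ≤ N := by exact_mod_cast hN
    have h1 := hright _ (hge (N := N) (hfz'.le.trans (by linarith)))
    have h2 : (a (N + 1) / a N) ^ D ≤ 1 := (hratio N).2.trans (Real.exp_le_one_iff.2 h1)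
    exact (div_le_one (hapos N)).1 ((pow_le_one_iff_of_nonneg (hρ N).le hD.ne').1 h2)

theorem stmt12 :
    ∃ C : ℝ, 0 < C ∧ ∀ s D : ℕ, 0 < s → 0 < D → Odd s → 3 * D ≤ s →
      C ≤ (s : ℝ) / (D * Real.log D) →
      ∀ j j' : ℕ, 1 ≤ j → j ≤ D → 1 ≤ j' → j' ≤ D →
        Filter.Tendsto
          (fun n : ℕ => (∑' m : ℕ, R s D n ((m : ℝ) + 1 + (j' : ℝ) / D)) /
            (∑' m : ℕ, R s D n ((m : ℝ) + 1 + (j : ℝ) / D)))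
          (Filter.atTop ⊓ Filter.principal {n : ℕ | 0 < n ∧ Even (D * n)})
          (nhds 1) := by
  refine ⟨1, one_pos, fun s D _ hD _ hs _ j j' hj hjD hj' hjD' => ?_⟩
  refine Filter.Tendsto.mono_left ?_ inf_le_left
  have hD1 : (0 : ℝ) < D := by exact_mod_cast hD
  rw [Metric.tendsto_nhds]
  intro η hη
  set ε : ℝ := min 1 η / (16 * (D : ℝ) ^ 2) with hε
  have hm : 0 < min 1 η := lt_min one_pos hη
  have hεpos : 0 < ε := by positivity
  have hval : 2 * (D : ℝ) ^ 2 * (4 * ε) = min 1 η / 2 := by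
    rw [hε]
    field_simp
    norm_num
  filter_upwards [Filter.eventually_gt_atTop 0, eventually_sum_abs_sub_R_le hD hs hεpos]
    with n hn htv
  rw [tsum_R_eq hD hs hn hj hjD, tsum_R_eq hD hs hn hj' hjD', Real.dist_eq]
  have h1 := min_le_left 1 η
  have h2 := min_le_right 1 η
  have key := abs_tsum_residue_div_sub_one_le
    (a := fun N : ℕ => R s D n (n + ((N : ℝ) + 1) / D))
    (fun N => R_add_pos s n hD (by positivity)) (summable_R hD hs hn) hD
    (by rw [hval]; linarith) htv (i := j - 1) (i' := j' - 1) (by omega) (by omega)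
  rw [hval] at key
  exact key.trans_lt (by linarith)
end

section
/- At least two of the numbers ζ(5), ζ(7), ζ(9), …, ζ(77) are irrational; that is, there exist odd integers i, j with 5 ≤ i < j ≤ 77 such that both ζ(i) and ζ(j) are irrational. -/
/-- The Riemann zeta value `ζ(i) = ∑_{m ≥ 1} 1/m^i`, as a real number. -/
noncomputable def zetaVal (i : ℕ) : ℝ := ∑' m : ℕ, 1 / ((m : ℝ) + 1) ^ i

theorem div_add_div_add_div_add_div_lt {m q : ℕ} (h1 : m < q) (h2 : q ≤ 42 * m) :
    21 * m / q + 14 * m / q + 6 * m / q + m / q + 1 ≤ 42 * m / q := by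
  have hq : 0 < q := by omega
  have a1 : 2 * (21 * m / q) ≤ 42 * m / q := by
    rw [Nat.le_div_iff_mul_le hq]; have := Nat.div_mul_le_self (21 * m) q; linarith
  have a2 : 3 * (14 * m / q) ≤ 42 * m / q := by
    rw [Nat.le_div_iff_mul_le hq]; have := Nat.div_mul_le_self (14 * m) q; linarith
  have a3 : 7 * (6 * m / q) ≤ 42 * m / q := by
    rw [Nat.le_div_iff_mul_le hq]; have := Nat.div_mul_le_self (6 * m) q; linarith
  have a4 : m / q = 0 := Nat.div_eq_of_lt h1
  have a5 : 1 ≤ 42 * m / q := by rwa [Nat.le_div_iff_mul_le hq, one_mul]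
  omega

theorem div_add_div_add_div_add_div_le (m q : ℕ) :
    21 * m / q + 14 * m / q + 6 * m / q + m / q ≤ 42 * m / q := by
  calc _ ≤ (21 * m + 14 * m) / q + 6 * m / q + m / q := by grw [Nat.div_add_div_le_add_div]
    _ ≤ (21 * m + 14 * m + 6 * m) / q + m / q := by grw [Nat.div_add_div_le_add_div]
    _ ≤ (21 * m + 14 * m + 6 * m + m) / q := by grw [Nat.div_add_div_le_add_div]
    _ = _ := by congr 1; ring

open Nat in
theorem lcmUpto_mul_factorial_dvd (m : ℕ) (hm : 0 < m) :
    lcmUpto (42 * m) * ((21 * m)! * (14 * m)! * (6 * m)! * m !) ∣ lcmUpto m * (42 * m)! := by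
  have e1 := lcmUpto_ne_zero
  have e2 := Nat.factorial_ne_zero
  rw [← Nat.factorization_prime_le_iff_dvd (by simp [e1, e2]) (by simp [e1, e2])]
  intro p hp
  set b := p.log (42 * m) + 1 with hb
  have hlog : ∀ x, x ≤ 42 * m → p.log x < b := fun x hx =>
    Nat.lt_succ_of_le (Nat.log_mono_right hx)
  rw [Nat.factorization_mul (by simp [e1]) (by simp [e2]),
    Nat.factorization_mul (by simp [e2]) (by simp [e2]),
    Nat.factorization_mul (by simp [e2]) (by simp [e2]),
    Nat.factorization_mul (by simp [e2]) (by simp [e2]),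
    Nat.factorization_mul (e1 _) (e2 _)]
  simp only [Finsupp.add_apply, factorization_lcmUpto _ hp]
  rw [Nat.factorization_factorial hp (hlog (21 * m) (by omega)),
    Nat.factorization_factorial hp (hlog (14 * m) (by omega)),
    Nat.factorization_factorial hp (hlog (6 * m) (by omega)),
    Nat.factorization_factorial hp (hlog m (by omega)),
    Nat.factorization_factorial hp (hlog (42 * m) (by omega))]
  have hcard : p.log (42 * m) ≤ p.log m + ∑ i ∈ Finset.Ico 1 b, if m < p ^ i then 1 else 0 := by
    have h3 : Finset.Ico (p.log m + 1) b ⊆ (Finset.Ico 1 b).filter (fun i => m < p ^ i) := by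
      intro i hi
      simp only [Finset.mem_Ico, Finset.mem_filter] at hi ⊢
      exact ⟨⟨by omega, hi.2⟩, Nat.lt_pow_of_log_lt hp.one_lt (by omega)⟩
    have h4 := Finset.card_le_card h3
    rw [← Finset.card_filter]
    simp only [Nat.card_Ico] at h4
    omega
  have hterm : ∑ i ∈ Finset.Ico 1 b, (21 * m / p ^ i + 14 * m / p ^ i + 6 * m / p ^ i + m / p ^ i
      + if m < p ^ i then 1 else 0) ≤ ∑ i ∈ Finset.Ico 1 b, 42 * m / p ^ i := by
    refine Finset.sum_le_sum fun i hi => ?_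
    rw [Finset.mem_Ico] at hi
    split_ifs with h
    · exact div_add_div_add_div_add_div_lt h (Nat.pow_le_of_le_log (by omega) (by omega))
    · simpa using div_add_div_add_div_add_div_le m (p ^ i)
  simp only [Finset.sum_add_distrib] at hterm
  omega

open Nat in
theorem choose_mul_pow_mul_pow_le (x y a b : ℕ) :
    (a + b)! * (x ^ a * y ^ b) ≤ (x + y) ^ (a + b) * (a ! * b !) := by
  have h : (a + b).choose a * (x ^ a * y ^ b) ≤ (x + y) ^ (a + b) := by
    rw [add_pow]
    have := Finset.single_le_sum (s := Finset.range (a + b + 1))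
      (f := fun m => x ^ m * y ^ (a + b - m) * (a + b).choose m) (fun _ _ => Nat.zero_le _)
      (a := a) (by simp)
    simp only [Nat.add_sub_cancel_left] at this
    calc _ = _ := by ring
      _ ≤ _ := this
  rw [← Nat.add_choose_mul_factorial_mul_factorial a b, ← Nat.choose_symm_add]
  calc _ = ((a + b).choose a * (x ^ a * y ^ b)) * (a ! * b !) := by ring
    _ ≤ _ := by gcongr

open Nat in
theorem factorial_le_multinomial (m : ℕ) :
    ((42 * m)! : ℝ) ≤ ((31 / 10 : ℝ) ^ 41) ^ m * ((21 * m)! * (14 * m)! * (6 * m)! * m !) := by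
  have h1 := choose_mul_pow_mul_pow_le 1 1 (21 * m) (21 * m)
  have h2 := choose_mul_pow_mul_pow_le 14 7 (14 * m) (7 * m)
  have h3 := choose_mul_pow_mul_pow_le 6 1 (6 * m) (1 * m)
  rw [show 21 * m + 21 * m = 42 * m by ring] at h1
  rw [show 14 * m + 7 * m = 21 * m by ring] at h2
  rw [show 6 * m + 1 * m = 7 * m by ring] at h3
  simp only [one_pow, mul_one, one_mul, Nat.reduceAdd] at h1 h2 h3
  have f : ∀ k : ℕ, (0 : ℝ) < k ! := fun k => by positivity
  have g1 : ((42 * m)! : ℝ) ≤ 2 ^ (42 * m) * ((21 * m)! * (21 * m)!) := by exact_mod_cast h1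
  have g2 : ((21 * m)! : ℝ) * (14 ^ (14 * m) * 7 ^ (7 * m)) ≤ 21 ^ (21 * m) * ((14 * m)! * (7 * m)!) := by
    exact_mod_cast h2
  have g3 : ((7 * m)! : ℝ) * 6 ^ (6 * m) ≤ 7 ^ (7 * m) * ((6 * m)! * m !) := by exact_mod_cast h3
  have key : (2 : ℝ) ^ (42 * m) * 21 ^ (21 * m) ≤
      ((31 / 10 : ℝ) ^ 41) ^ m * (14 ^ (14 * m) * 6 ^ (6 * m)) := by
    have h : (2 : ℝ) ^ 42 * 21 ^ 21 ≤ (31 / 10 : ℝ) ^ 41 * (14 ^ 14 * 6 ^ 6) := by norm_num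
    simpa only [pow_mul, mul_pow] using pow_le_pow_left₀ (by positivity) h m
  refine le_of_mul_le_mul_right (a := (14 : ℝ) ^ (14 * m) * 7 ^ (7 * m) * 6 ^ (6 * m)) ?_ (by positivity)
  calc _ ≤ 2 ^ (42 * m) * ((21 * m)! * (21 * m)!) * ((14 : ℝ) ^ (14 * m) * 7 ^ (7 * m) *
        6 ^ (6 * m)) := by
        gcongr
    _ = 2 ^ (42 * m) * (21 * m)! * 6 ^ (6 * m) * ((21 * m)! * ((14 : ℝ) ^ (14 * m) * 7 ^ (7 * m))) := by
      ring
    _ ≤ 2 ^ (42 * m) * (21 * m)! * 6 ^ (6 * m) * (21 ^ (21 * m) * ((14 * m)! * (7 * m)!)) := by gcongr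
    _ = 2 ^ (42 * m) * (21 * m)! * 21 ^ (21 * m) * (14 * m)! * ((7 * m)! * 6 ^ (6 * m)) := by ring
    _ ≤ 2 ^ (42 * m) * (21 * m)! * 21 ^ (21 * m) * (14 * m)! * (7 ^ (7 * m) * ((6 * m)! * m !)) := by
      gcongr
    _ = (2 ^ (42 * m) * 21 ^ (21 * m)) * ((21 * m)! * (14 * m)! * (6 * m)! * m ! * 7 ^ (7 * m)) := by
      ring
    _ ≤ (((31 / 10 : ℝ) ^ 41) ^ m * (14 ^ (14 * m) * 6 ^ (6 * m))) *
        ((21 * m)! * (14 * m)! * (6 * m)! * m ! * 7 ^ (7 * m)) := by gcongr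
    _ = _ := by ring

/-- A Chebyshev-type upper bound for `lcm(1, …, n)` along the powers of `42`. -/
theorem lcmUpto_pow_le (j : ℕ) : (Nat.lcmUpto (42 ^ j) : ℝ) ≤ (31 / 10 : ℝ) ^ (42 ^ j) := by
  induction j with
  | zero => norm_num [Nat.lcmUpto]
  | succ j ih =>
    set m := 42 ^ j with hm
    have hpos : 0 < m := by positivity
    have h := Nat.le_of_dvd (Nat.mul_pos (Nat.lcmUpto_pos _) (Nat.factorial_pos _))
      (lcmUpto_mul_factorial_dvd m hpos)
    have h' : (Nat.lcmUpto (42 * m) : ℝ) *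
        ((21 * m).factorial * (14 * m).factorial * (6 * m).factorial * m.factorial) ≤
        Nat.lcmUpto m * (42 * m).factorial := by exact_mod_cast h
    rw [pow_succ' 42 j, ← hm]
    refine le_of_mul_le_mul_right (h'.trans ?_)
      (by positivity : (0 : ℝ) < (21 * m).factorial * (14 * m).factorial * (6 * m).factorial * m.factorial)
    calc _ ≤ (31 / 10 : ℝ) ^ m * (((31 / 10 : ℝ) ^ 41) ^ m *
          ((21 * m).factorial * (14 * m).factorial * (6 * m).factorial * m.factorial)) := by
          gcongr; exact factorial_le_multinomial m
      _ = _ := by rw [← pow_mul, show 42 * m = m + 41 * m by ring, pow_add]; ring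

/-- The subring of rationals that are integral at the prime `p`. -/
def padicIntegral (p : ℕ) [Fact p.Prime] : Subring ℚ where
  carrier := {q | padicNorm p q ≤ 1}
  mul_mem' {a b} ha hb := by
    simp only [Set.mem_ofPred_eq, padicNorm.mul] at *
    exact mul_le_one₀ ha (padicNorm.nonneg _) hb
  one_mem' := by simp
  add_mem' {a b} ha hb := padicNorm.nonarchimedean.trans (max_le ha hb)
  zero_mem' := by simp
  neg_mem' {a} ha := by simpa [padicNorm.neg] using ha

section PadicIntegrality

variable {p : ℕ} [Fact p.Prime]

theorem mem_padicIntegral {q : ℚ} : q ∈ padicIntegral p ↔ padicNorm p q ≤ 1 := Iff.rfl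

theorem intCast_div_mem_padicIntegral {a b : ℤ} {m : ℕ} (ha : (p : ℤ) ^ m ∣ a)
    (hb : ¬ (p : ℤ) ^ (m + 1) ∣ b) : (a / b : ℚ) ∈ padicIntegral p := by
  have hp : 0 < (p : ℚ) := by exact_mod_cast (Fact.out : p.Prime).pos
  rw [mem_padicIntegral, padicNorm.div]
  have h1 : padicNorm p a ≤ (p : ℚ) ^ (-m : ℤ) := padicNorm.dvd_iff_norm_le.1 (by exact_mod_cast ha)
  have h2 : ¬ padicNorm p b ≤ (p : ℚ) ^ (-(m + 1 : ℕ) : ℤ) := fun h =>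
    hb (by exact_mod_cast padicNorm.dvd_iff_norm_le.2 h)
  have hb0 : (b : ℚ) ≠ 0 := by
    rintro h
    exact hb (by rw [Int.cast_eq_zero.1 h]; exact dvd_zero _)
  obtain ⟨z, hz⟩ := padicNorm.values_discrete (p := p) hb0
  rw [hz] at h2 ⊢
  have hp1 : 1 < (p : ℚ) := by exact_mod_cast (Fact.out : p.Prime).one_lt
  rw [zpow_le_zpow_iff_right₀ hp1] at h2
  push_cast at h2
  refine div_le_one_of_le₀ (h1.trans ?_) (by positivity)
  exact zpow_le_zpow_right₀ hp1.le (by omega)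

theorem natCast_div_mem_padicIntegral {a b : ℕ} (hb : b ≠ 0)
    (h : padicValNat p b ≤ padicValNat p a) : (a / b : ℚ) ∈ padicIntegral p := by
  have := @intCast_div_mem_padicIntegral p _ a b (padicValNat p b)
    (by exact_mod_cast (pow_dvd_pow p h).trans pow_padicValNat_dvd)
    (by exact_mod_cast pow_succ_padicValNat_not_dvd hb)
  simpa using this

theorem exists_intCast_of_forall_mem_padicIntegral {q : ℚ}
    (h : ∀ (p : ℕ) [Fact p.Prime], q ∈ padicIntegral p) : ∃ z : ℤ, (z : ℚ) = q := by
  suffices hd : q.den = 1 from ⟨q.num, Rat.coe_int_num_of_den_eq_one hd⟩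
  by_contra hd
  obtain ⟨p, hp, hpd⟩ := Nat.exists_prime_and_dvd hd
  have := Fact.mk hp
  have h1 := h p
  rw [mem_padicIntegral, ← Rat.num_div_den q, padicNorm.div] at h1
  have h2 : padicNorm p q.den < 1 := (padicNorm.nat_lt_one_iff _).2 hpd
  have h3 : padicNorm p q.num = 1 := by
    rw [padicNorm.int_eq_one_iff]
    intro h4
    have h5 : p ∣ q.num.natAbs := Int.natCast_dvd.1 h4
    have := Nat.dvd_gcd h5 hpd
    rw [q.reduced] at this
    exact hp.one_lt.ne' (Nat.dvd_one.1 this)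
  have h4 : 0 < padicNorm p q.den :=
    lt_of_le_of_ne (padicNorm.nonneg _) (padicNorm.nonzero (by exact_mod_cast q.den_nz)).symm
  rw [h3, div_le_one h4] at h1
  linarith

open PowerSeries

/-- Power series over `ℚ` that become `p`-integral after the substitution `X ↦ p ^ E * X`. -/
def scaledIntegral (p : ℕ) [Fact p.Prime] (E : ℕ) : Subring ℚ⟦X⟧ where
  carrier := {f | ∀ j, coeff j f * ((p : ℚ) ^ E) ^ j ∈ padicIntegral p}
  mul_mem' {f g} hf hg j := by
    rw [coeff_mul, Finset.sum_mul]
    refine Subring.sum_mem _ fun x hx => ?_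
    rw [← Finset.HasAntidiagonal.mem_antidiagonal.1 hx, pow_add]
    convert Subring.mul_mem _ (hf x.1) (hg x.2) using 1
    ring
  one_mem' j := by
    rw [coeff_one]
    split_ifs with h
    · simp [h]
    · simp
  add_mem' {f g} hf hg j := by
    rw [map_add, add_mul]
    exact Subring.add_mem _ (hf j) (hg j)
  zero_mem' j := by simp
  neg_mem' {f} hf j := by
    rw [map_neg, neg_mul]
    exact Subring.neg_mem _ (hf j)

theorem C_mem_scaledIntegral {E : ℕ} {q : ℚ} (hq : q ∈ padicIntegral p) :
    C q ∈ scaledIntegral p E := by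
  intro j
  rw [coeff_C]
  split_ifs with h
  · simpa [h] using hq
  · simp

theorem C_mul_X_mem_scaledIntegral {E : ℕ} {q : ℚ} (hq : q * (p : ℚ) ^ E ∈ padicIntegral p) :
    C q * X ∈ scaledIntegral p E := by
  intro j
  rw [coeff_C_mul, coeff_X]
  split_ifs with h
  · simpa [h] using hq
  · simp

theorem geom_mem_scaledIntegral {E : ℕ} {q : ℚ} (hq : q * (p : ℚ) ^ E ∈ padicIntegral p) :
    PowerSeries.mk (fun j => q ^ j) ∈ scaledIntegral p E := by
  intro j
  rw [coeff_mk, ← mul_pow]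
  exact Subring.pow_mem _ hq j

theorem mk_pow_mul_one_sub (q : ℚ) : PowerSeries.mk (fun j => q ^ j) * (1 - C q * X) = 1 := by
  ext j
  rw [mul_sub, mul_one, map_sub, ← mul_assoc, mul_comm _ (C q), mul_assoc, coeff_C_mul]
  cases j with
  | zero => simp
  | succ j =>
    rw [coeff_succ_mul_X]
    simp [coeff_one, pow_succ']

theorem card_filter_dvd_ge {q D : ℕ} (hq : 0 < q) (hD : Nat.Coprime D q) (α : ℤ) (N : ℕ) :
    N / q ≤ ((Finset.range N).filter (fun i : ℕ => (q : ℤ) ∣ α + D * i)).card := by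
  obtain ⟨a, b, hab⟩ := Nat.isCoprime_iff_coprime.2 hD
  have hq' : (0 : ℤ) < q := by exact_mod_cast hq
  set v := ((-α * a) % q).toNat with hv
  have hv' : (v : ℤ) = (-α * a) % q := Int.toNat_of_nonneg (Int.emod_nonneg _ hq'.ne')
  have hvd : (q : ℤ) ∣ α + D * v := by
    have h1 : (q : ℤ) ∣ (-α * a) - v := by
      rw [hv']; exact Int.dvd_self_sub_emod
    obtain ⟨e, he⟩ := h1
    refine ⟨α * b - D * e, ?_⟩
    have : (v : ℤ) = -α * a - q * e := by linarith
    rw [this]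
    linear_combination (-α) * hab
  have h2 := Nat.count_modEq_card N hq v
  have h3 : N.count (· ≡ v [MOD q]) ≤
      ((Finset.range N).filter (fun i : ℕ => (q : ℤ) ∣ α + D * i)).card := by
    rw [Nat.count_eq_card_filter_range]
    refine Finset.card_le_card fun i hi => ?_
    rw [Finset.mem_filter] at hi ⊢
    refine ⟨hi.1, ?_⟩
    have h4 : (q : ℤ) ∣ v - i := (Nat.modEq_iff_dvd.1 hi.2)
    have : α + D * i = (α + D * v) - D * (v - i) := by ring
    rw [this]
    exact dvd_sub hvd (h4.mul_left _)
  omega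

theorem pow_card_filter_dvd (p : ℕ) (z : ℤ) (E : ℕ) :
    (p : ℤ) ^ ((Finset.Ico 1 (E + 1)).filter (fun e => (p : ℤ) ^ e ∣ z)).card ∣ z := by
  set S := (Finset.Ico 1 (E + 1)).filter (fun e => (p : ℤ) ^ e ∣ z) with hS
  by_contra h
  have hsub : S ⊆ Finset.Ico 1 S.card := by
    intro e he
    have he' := he
    rw [hS, Finset.mem_filter, Finset.mem_Ico] at he'
    rw [Finset.mem_Ico]
    refine ⟨he'.1.1, ?_⟩
    by_contra hlt
    exact h ((pow_dvd_pow _ (not_lt.1 hlt)).trans he'.2)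
  have h1 := Finset.card_le_card hsub
  rw [Nat.card_Ico] at h1
  have h0 : S.card = 0 := by omega
  rw [h0] at h
  simp at h

theorem linear_eq_C_mul (z : ℤ) (D : ℕ) (E : ℕ) : ∃ s ∈ scaledIntegral p E,
    C (z : ℚ) + C (D : ℚ) * X =
      C ((p : ℚ) ^ ((Finset.Ico 1 (E + 1)).filter (fun e => (p : ℤ) ^ e ∣ z)).card) * s := by
  have hp : (p : ℚ) ≠ 0 := by exact_mod_cast (Fact.out : p.Prime).ne_zero
  set m := ((Finset.Ico 1 (E + 1)).filter (fun e => (p : ℤ) ^ e ∣ z)).card with hm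
  have hmE : m ≤ E := (Finset.card_filter_le _ _).trans (by simp)
  obtain ⟨y, hy⟩ := pow_card_filter_dvd p z E
  rw [← hm] at hy
  refine ⟨C (y : ℚ) + C (D / (p : ℚ) ^ m) * X, Subring.add_mem _
    (C_mem_scaledIntegral (intCast_mem _ _)) (C_mul_X_mem_scaledIntegral ?_), ?_⟩
  · obtain ⟨r, hr⟩ := Nat.exists_eq_add_of_le hmE
    have : (D / (p : ℚ) ^ m) * (p : ℚ) ^ E = ((D * p ^ r : ℕ) : ℚ) := by
      rw [hr, pow_add]; push_cast; field_simp
    rw [this]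
    exact natCast_mem _ _
  · rw [mul_add, ← mul_assoc, ← map_mul, ← map_mul, mul_div_cancel₀ _ (pow_ne_zero _ hp)]
    rw [hy]; push_cast; rfl

/-- A normalised product of an arithmetic progression of linear factors is integral after
rescaling. -/
theorem block_mem_scaledIntegral {D N n : ℕ} (α : ℤ) {W : ℕ} (hN : N ≤ n)
    (hW : p ∣ D → (W / N.factorial : ℚ) ∈ padicIntegral p) :
    C (W / N.factorial : ℚ) * ∏ i ∈ Finset.range N, (C ((α + D * i : ℤ) : ℚ) + C (D : ℚ) * X) ∈
      scaledIntegral p (Nat.log p n) := by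
  set E := Nat.log p n with hE
  have hpp : p.Prime := Fact.out
  by_cases hD : p ∣ D
  · refine Subring.mul_mem _ (C_mem_scaledIntegral (hW hD)) (Subring.prod_mem _ fun i _ =>
      Subring.add_mem _ (C_mem_scaledIntegral (intCast_mem _ _)) (C_mul_X_mem_scaledIntegral ?_))
    exact_mod_cast natCast_mem (padicIntegral p) (D * p ^ E)
  · choose s hs hs' using fun i : ℕ => linear_eq_C_mul (p := p) (α + D * i) D E
    set m : ℕ → ℕ := fun i =>
      ((Finset.Ico 1 (E + 1)).filter (fun e => (p : ℤ) ^ e ∣ α + D * i)).card with hm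
    have hsum : padicValNat p N.factorial ≤ ∑ i ∈ Finset.range N, m i := by
      rw [padicValNat_factorial (b := E + 1) (Nat.lt_succ_of_le (Nat.log_mono_right hN))]
      simp only [hm, Finset.card_filter]
      rw [Finset.sum_comm]
      refine Finset.sum_le_sum fun e he => ?_
      rw [← Finset.card_filter]
      have := card_filter_dvd_ge (q := p ^ e) (D := D) (pow_pos hpp.pos _)
        (Nat.Coprime.pow_right _ ((Nat.Prime.coprime_iff_not_dvd hpp).2 hD).symm) α N
      exact_mod_cast this
    rw [Finset.prod_congr rfl fun i _ => hs' i, Finset.prod_mul_distrib, ← mul_assoc, ← map_prod,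
      ← map_mul, Finset.prod_pow_eq_pow_sum]
    refine Subring.mul_mem _ (C_mem_scaledIntegral ?_) (Subring.prod_mem _ fun i _ => hs i)
    have h1 : ((p ^ (∑ i ∈ Finset.range N, m i) : ℕ) / (N.factorial : ℕ) : ℚ) ∈ padicIntegral p :=
      natCast_div_mem_padicIntegral (Nat.factorial_ne_zero _) (by rwa [padicValNat.prime_pow])
    have h2 := Subring.mul_mem _ (natCast_mem (padicIntegral p) W) h1
    convert h2 using 1
    push_cast
    ring

theorem exists_mul_prod_eq_factorial {n k : ℕ} (hk : k ≤ n) :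
    ∃ V ∈ scaledIntegral p (Nat.log p n),
      V * ∏ i ∈ (Finset.range (n + 1)).erase k, (C ((i : ℚ) - k) + X) = C (n.factorial : ℚ) := by
  have hpp : p.Prime := Fact.out
  set s := (Finset.range (n + 1)).erase k with hs
  have hne : ∀ i ∈ s, ((i : ℚ) - k) ≠ 0 := by
    intro i hi
    rw [sub_ne_zero]
    exact_mod_cast (Finset.mem_erase.1 hi).1
  have hprod : ∏ i ∈ s, ((i : ℚ) - k) = (-1) ^ k * (k.factorial * (n - k).factorial) := by
    have h1 : s = Finset.range k ∪ Finset.Ico (k + 1) (n + 1) := by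
      ext i; simp [hs]; omega
    rw [h1, Finset.prod_union (by
      rw [Finset.disjoint_left]; intro i hi; simp at hi ⊢; omega)]
    have h2 : ∏ i ∈ Finset.range k, ((i : ℚ) - k) = (-1) ^ k * k.factorial := by
      rw [← Finset.prod_range_reflect, ← Finset.prod_range_add_one_eq_factorial]
      push_cast
      rw [← Finset.card_range k, ← Finset.prod_const, Finset.card_range, ← Finset.prod_mul_distrib]
      refine Finset.prod_congr rfl fun i hi => ?_
      rw [Finset.mem_range] at hi
      rw [show k - 1 - i = k - (i + 1) by omega, Nat.cast_sub (by omega)]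
      push_cast; ring
    have h3 : ∏ i ∈ Finset.Ico (k + 1) (n + 1), ((i : ℚ) - k) = (n - k).factorial := by
      rw [Finset.prod_Ico_eq_prod_range, ← Finset.prod_range_add_one_eq_factorial]
      push_cast
      refine Finset.prod_congr rfl fun i hi => ?_
      ring
    rw [h2, h3]; ring
  refine ⟨C ((-1) ^ k * n.choose k : ℚ) * ∏ i ∈ s,
    PowerSeries.mk (fun j => (-1 / ((i : ℚ) - k)) ^ j),
    Subring.mul_mem _ (C_mem_scaledIntegral ?_) (Subring.prod_mem _ fun i hi =>
      geom_mem_scaledIntegral ?_), ?_⟩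
  · exact Subring.mul_mem _ (Subring.pow_mem _ (Subring.neg_mem _ (Subring.one_mem _)) _)
      (natCast_mem _ _)
  · have h4 : ¬ (p : ℤ) ^ (Nat.log p n + 1) ∣ (i : ℤ) - k := by
      intro h5
      have h6 : (i : ℤ) - k ≠ 0 := by exact_mod_cast hne i hi
      have h7 := Int.le_of_dvd (by positivity) ((dvd_abs _ _).2 h5)
      have h8 : n < p ^ (Nat.log p n + 1) := Nat.lt_pow_succ_log_self hpp.one_lt n
      have h9 : i ≤ n := by
        have := Finset.mem_range.1 (Finset.mem_erase.1 hi).2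
        omega
      zify at h8 h9 hk
      have h10 : |(i : ℤ) - k| ≤ n := by rw [abs_le]; constructor <;> omega
      linarith
    have := intCast_div_mem_padicIntegral (p := p) (a := -(p : ℤ) ^ (Nat.log p n))
      (b := (i : ℤ) - k) (m := Nat.log p n) (by simp) h4
    convert this using 1
    push_cast
    ring
  · rw [mul_assoc, ← Finset.prod_mul_distrib]
    have h5 : ∀ i ∈ s, PowerSeries.mk (fun j => (-1 / ((i : ℚ) - k)) ^ j) * (C ((i : ℚ) - k) + X) =
        C ((i : ℚ) - k) := by
      intro i hi
      have h6 : C ((i : ℚ) - k) + X = (1 - C (-1 / ((i : ℚ) - k)) * X) * C ((i : ℚ) - k) := by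
        rw [sub_mul, one_mul, mul_right_comm, ← map_mul, div_mul_cancel₀ _ (hne i hi)]
        simp
      rw [h6, ← mul_assoc, mk_pow_mul_one_sub, one_mul]
    rw [Finset.prod_congr rfl h5, ← map_prod, ← map_mul, hprod]
    congr 1
    have h7 : ((-1 : ℚ) ^ k) * (-1) ^ k = 1 := by rw [← mul_pow]; simp
    rw [← Nat.choose_mul_factorial_mul_factorial hk]
    push_cast
    linear_combination (n.choose k * (k.factorial * (n - k).factorial) : ℚ) * h7

end PadicIntegrality

section PartialFractions

open Polynomial

/-- The basic term `(X + k) ^ j * ∏_{i ≠ k} (X + i) ^ A` of a partial fraction expansion with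
cleared denominators. -/
noncomputable def pfTerm (n A k j : ℕ) : ℚ[X] :=
  (X + C (k : ℚ)) ^ j * ∏ i ∈ (Finset.range (n + 1)).erase k, (X + C (i : ℚ)) ^ A

theorem pfTerm_monic (n A k j : ℕ) : (pfTerm n A k j).Monic :=
  ((monic_X_add_C _).pow _).mul (monic_prod_of_monic _ _ fun _ _ => (monic_X_add_C _).pow _)

theorem pfTerm_natDegree {n k : ℕ} (hk : k ≤ n) (A j : ℕ) :
    (pfTerm n A k j).natDegree = j + n * A := by
  rw [pfTerm, ((monic_X_add_C _).pow _).natDegree_mul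
    (monic_prod_of_monic _ _ fun _ _ => (monic_X_add_C _).pow _),
    natDegree_prod_of_monic _ _ fun _ _ => (monic_X_add_C _).pow _]
  simp only [natDegree_pow, natDegree_X_add_C, Finset.sum_const, smul_eq_mul, mul_one]
  rw [Finset.card_erase_of_mem (by simp; omega)]
  simp

theorem exists_partialFraction {n A : ℕ} {P : ℚ[X]} (hA : 0 < A)
    (hdeg : P.natDegree + 1 < A * (n + 1)) :
    ∃ c : ℕ → ℕ → ℚ, P = ∑ k ∈ Finset.range (n + 1), ∑ j ∈ Finset.range A,
        C (c k j) * pfTerm n A k j ∧ ∑ k ∈ Finset.range (n + 1), c k (A - 1) = 0 := by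
  obtain ⟨q, r, hr, hP⟩ := eq_quo_mul_prod_pow_add_sum_rem_mul_prod_pow
    (s := Finset.range (n + 1)) P (g := fun i : ℕ => X + C (i : ℚ)) (fun i _ => monic_X_add_C _)
    (fun i _ j _ hij => by
      have := isCoprime_X_sub_C_of_isUnit_sub (R := ℚ) (a := -(i : ℚ)) (b := -(j : ℚ))
        (by
          rw [isUnit_iff_ne_zero]
          intro h
          exact hij (by exact_mod_cast (by linarith : (i : ℚ) = j)))
      simpa using this) (fun _ => A)
  set c : ℕ → ℕ → ℚ := fun k j => if h : j < A then (r k ⟨j, h⟩).coeff 0 else 0 with hc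
  have hsum : ∑ i ∈ Finset.range (n + 1), ∑ j, r i j * (X + C (i : ℚ)) ^ j.1 *
      ∏ k ∈ (Finset.range (n + 1)).erase i, (X + C (k : ℚ)) ^ A =
      ∑ k ∈ Finset.range (n + 1), ∑ j ∈ Finset.range A, C (c k j) * pfTerm n A k j := by
    refine Finset.sum_congr rfl fun k hk => ?_
    rw [Finset.sum_range]
    refine Finset.sum_congr rfl fun j _ => ?_
    have h1 := hr k hk j
    rw [degree_X_add_C] at h1
    have h2 : r k j = C ((r k j).coeff 0) :=
      eq_C_of_degree_le_zero (Nat.WithBot.lt_one_iff_le_zero.1 h1)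
    rw [h2, pfTerm, mul_assoc]
    simp [hc]
  rw [hsum] at hP
  set M := ∏ i ∈ Finset.range (n + 1), (X + C (i : ℚ)) ^ A with hM
  have hMm : M.Monic := monic_prod_of_monic _ _ fun _ _ => (monic_X_add_C _).pow _
  have hMd : M.natDegree = (n + 1) * A := by
    rw [hM, natDegree_prod_of_monic _ _ fun _ _ => (monic_X_add_C _).pow _]
    simp only [natDegree_pow, natDegree_X_add_C, Finset.sum_const, smul_eq_mul, mul_one,
      Finset.card_range]
  set S := ∑ k ∈ Finset.range (n + 1), ∑ j ∈ Finset.range A, C (c k j) * pfTerm n A k j with hS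
  have hSd : S.natDegree ≤ A - 1 + n * A := by
    refine natDegree_sum_le_of_forall_le _ _ fun k hk => natDegree_sum_le_of_forall_le _ _
      fun j hj => (natDegree_C_mul_le _ _).trans ?_
    rw [pfTerm_natDegree (by simpa [Nat.lt_succ_iff] using hk)]
    have := Finset.mem_range.1 hj
    omega
  have hq : q = 0 := by
    by_contra hq
    have h1 : (q * M).natDegree = q.natDegree + (n + 1) * A := by
      rw [natDegree_mul hq hMm.ne_zero, hMd]
    have h2 : (q * M).natDegree ≤ max P.natDegree S.natDegree := by
      rw [show q * M = P - S by rw [hP]; ring]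
      exact natDegree_sub_le _ _
    have h3 : (n + 1) * A = A * (n + 1) := mul_comm _ _
    have h4 : (n + 1) * A = A + n * A := by ring
    rcases le_max_iff.1 h2 with h | h <;> omega
  rw [hq, zero_mul, zero_add] at hP
  refine ⟨c, hP, ?_⟩
  have h1 : P.coeff (A - 1 + n * A) = 0 := by
    refine coeff_eq_zero_of_natDegree_lt ?_
    have h4 : A * (n + 1) = A + n * A := by ring
    omega
  rw [hP, hS, finsetSum_coeff] at h1
  rw [← h1]
  refine Finset.sum_congr rfl fun k hk => ?_
  have hk' : k ≤ n := by simpa [Nat.lt_succ_iff] using hk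
  rw [finsetSum_coeff, Finset.sum_eq_single (A - 1)]
  · rw [coeff_C_mul, ← pfTerm_natDegree hk' A (A - 1), (pfTerm_monic _ _ _ _).coeff_natDegree,
      mul_one]
  · intro j hj hjA
    rw [coeff_C_mul, coeff_eq_zero_of_natDegree_lt, mul_zero]
    rw [pfTerm_natDegree hk']
    have := Finset.mem_range.1 hj
    omega
  · intro h
    simp at h
    omega

theorem aeval_pfTerm_self (n A k j : ℕ) :
    aeval (PowerSeries.X - PowerSeries.C (k : ℚ)) (pfTerm n A k j) = PowerSeries.X ^ j *
      (∏ i ∈ (Finset.range (n + 1)).erase k, (PowerSeries.C ((i : ℚ) - k) + PowerSeries.X)) ^ A := by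
  rw [pfTerm, map_mul, map_pow, map_prod, ← Finset.prod_pow]
  congr 1
  · simp [← PowerSeries.algebraMap_eq]
  · refine Finset.prod_congr rfl fun i _ => ?_
    simp only [map_pow, map_add, aeval_X, aeval_C, map_sub, ← PowerSeries.algebraMap_eq]
    congr 1
    simp
    ring

theorem X_pow_dvd_aeval_pfTerm {n k k' : ℕ} (hk : k ≤ n) (h : k' ≠ k) (A j : ℕ) :
    (PowerSeries.X ^ A : PowerSeries ℚ) ∣
      aeval (PowerSeries.X - PowerSeries.C (k : ℚ)) (pfTerm n A k' j) := by
  rw [pfTerm, map_mul, map_prod]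
  refine Dvd.dvd.mul_left ?_ _
  refine dvd_trans ?_ (Finset.dvd_prod_of_mem _ (a := k) (by simp [h.symm]; omega))
  simp [← PowerSeries.algebraMap_eq]

theorem partialFraction_coeff_mem {p : ℕ} [Fact p.Prime] {n A : ℕ} {P : ℚ[X]} {c : ℕ → ℕ → ℚ}
    (hP : P = ∑ k ∈ Finset.range (n + 1), ∑ j ∈ Finset.range A, C (c k j) * pfTerm n A k j)
    {k : ℕ} (hk : k ≤ n)
    (hint : aeval (PowerSeries.X - PowerSeries.C (k : ℚ)) P ∈ scaledIntegral p (Nat.log p n))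
    {j : ℕ} (hj : j < A) :
    (n.factorial : ℚ) ^ A * c k j * ((p : ℚ) ^ Nat.log p n) ^ j ∈ padicIntegral p := by
  obtain ⟨V, hV, hV'⟩ := exists_mul_prod_eq_factorial (p := p) hk
  have h1 := Subring.mul_mem _ (Subring.pow_mem _ hV A) hint j
  suffices h2 : PowerSeries.coeff j
      (V ^ A * aeval (PowerSeries.X - PowerSeries.C (k : ℚ)) P) = n.factorial ^ A * c k j by
    rwa [h2] at h1
  have hkk : k ∈ Finset.range (n + 1) := by simp; omega
  rw [hP, map_sum, ← Finset.add_sum_erase _ _ hkk, mul_add, map_add]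
  have h3 : PowerSeries.X ^ A ∣ V ^ A * ∑ x ∈ (Finset.range (n + 1)).erase k,
      aeval (PowerSeries.X - PowerSeries.C (k : ℚ))
        (∑ j ∈ Finset.range A, C (c x j) * pfTerm n A x j) := by
    refine Dvd.dvd.mul_left (Finset.dvd_sum fun x hx => ?_) _
    rw [map_sum]
    refine Finset.dvd_sum fun i _ => ?_
    rw [map_mul]
    exact (X_pow_dvd_aeval_pfTerm hk (Finset.mem_erase.1 hx).1 A i).mul_left _
  rw [(PowerSeries.X_pow_dvd_iff.1 h3) j hj, add_zero, map_sum, Finset.mul_sum]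
  have h4 : ∀ i ∈ Finset.range A, V ^ A * aeval (PowerSeries.X - PowerSeries.C (k : ℚ))
      (C (c k i) * pfTerm n A k i) =
      PowerSeries.C ((n.factorial : ℚ) ^ A * c k i) * PowerSeries.X ^ i := by
    intro i _
    rw [map_mul, aeval_pfTerm_self, aeval_C, map_mul, map_pow PowerSeries.C, ← hV', mul_pow]
    rw [← PowerSeries.algebraMap_eq]
    ring
  rw [Finset.sum_congr rfl h4, map_sum, Finset.sum_eq_single j]
  · rw [PowerSeries.coeff_C_mul, PowerSeries.coeff_X_pow_self, mul_one]
  · intro i _ hij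
    rw [PowerSeries.coeff_C_mul, PowerSeries.coeff_X_pow, if_neg hij.symm, mul_zero]
  · intro h
    simp at h
    omega

end PartialFractions

section RationalFunction

open Polynomial

/-- A normalised product of linear factors in arithmetic progression. -/
noncomputable def progBlock (D W N : ℕ) (α : ℤ) : ℚ[X] :=
  C (W / N.factorial : ℚ) * ∏ i ∈ Finset.range N, (C ((α + D * i : ℤ) : ℚ) + C (D : ℚ) * X)

theorem eval_progBlock (D W N : ℕ) (α : ℤ) (t : ℚ) : (progBlock D W N α).eval t =
    W / N.factorial * ∏ i ∈ Finset.range N, (α + D * i + D * t) := by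
  rw [progBlock, eval_mul, eval_prod, eval_C]
  simp

theorem aeval_progBlock_mem {p : ℕ} [Fact p.Prime] {D W N n : ℕ} (α : ℤ) (hN : N ≤ n)
    (hW : p ∣ D → (W / N.factorial : ℚ) ∈ padicIntegral p) (k : ℕ) :
    aeval (PowerSeries.X - PowerSeries.C (k : ℚ)) (progBlock D W N α) ∈
      scaledIntegral p (Nat.log p n) := by
  convert block_mem_scaledIntegral (α - D * k) hN hW using 1
  rw [progBlock, map_mul, map_prod, aeval_C, PowerSeries.algebraMap_eq]
  congr 1
  refine Finset.prod_congr rfl fun i _ => ?_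
  simp only [map_add, map_mul, aeval_C, aeval_X, PowerSeries.algebraMap_eq]
  push_cast
  simp only [map_add, map_mul, map_sub]
  ring

theorem natDegree_progBlock_le (D W N : ℕ) (α : ℤ) : (progBlock D W N α).natDegree ≤ N := by
  refine (natDegree_C_mul_le _ _).trans ((natDegree_prod_le _ _).trans ?_)
  refine (Finset.sum_le_card_nsmul _ _ 1 fun i _ => ?_).trans (by simp)
  compute_degree

theorem eval_progBlock_reflect (D W N : ℕ) (α β : ℤ) (n : ℕ)
    (h : α + β + D * N = D * n + D) (t : ℚ) :
    (progBlock D W N α).eval (-n - t) = (-1) ^ N * (progBlock D W N β).eval t := by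
  rw [eval_progBlock, eval_progBlock, mul_left_comm, ← Finset.prod_range_reflect,
    ← Finset.card_range N, ← Finset.prod_const, Finset.card_range, ← Finset.prod_mul_distrib]
  congr 1
  refine Finset.prod_congr rfl fun i hi => ?_
  have hi' := Finset.mem_range.1 hi
  have h' : (α + β + D * N : ℚ) = D * n + D := by exact_mod_cast h
  rw [Nat.cast_sub (by omega), Nat.cast_sub (by omega)]
  push_cast
  linear_combination h'

theorem eval_progBlock_eq_zero {D W N : ℕ} {α : ℤ} {t : ℚ} {i : ℕ} (hi : i < N)
    (h : (α + D * i + D * t : ℚ) = 0) : (progBlock D W N α).eval t = 0 := by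
  rw [eval_progBlock, Finset.prod_eq_zero (Finset.mem_range.2 hi) h, mul_zero]

/-- The factors of the numerator vanishing at integers. -/
noncomputable def numInt (n : ℕ) : ℚ[X] :=
  progBlock 1 1 n (-(2 * n - 1)) * progBlock 1 1 (n - 1) (-(n - 1)) *
    (progBlock 1 1 (n - 1) (n + 1) * progBlock 1 1 n (2 * n))

/-- The factors of the numerator vanishing at the points of `ℤ + 1/2`, `ℤ + 1/3` and `ℤ + 2/3`. -/
noncomputable def numFrac (n : ℕ) (e : ℕ) : ℚ[X] :=
  progBlock 2 (2 ^ n) n (2 * ((e - 2) * n) + 1) *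
    (progBlock 3 (3 ^ (n / 2)) n (3 * ((e - 2) * n) + 2) *
      progBlock 3 (3 ^ (n / 2)) n (3 * ((e - 2) * n) + 1))

/-- The numerator of the rational function. -/
noncomputable def numPoly (n : ℕ) : ℚ[X] := numInt n * ∏ e ∈ Finset.range 5, numFrac n e

/-- The very-well-poised type rational function underlying the construction. -/
noncomputable def ratFun (n : ℕ) (t : ℚ) : ℚ :=
  n.factorial ^ 77 * (numPoly n).eval t / ∏ k ∈ Finset.range (n + 1), (t + k) ^ 77

theorem natDegree_numPoly_le (n : ℕ) : (numPoly n).natDegree ≤ 19 * n := by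
  have h1 : (numInt n).natDegree ≤ 4 * n := by
    rw [numInt]
    refine natDegree_mul_le.trans ?_
    have e1 := natDegree_mul_le (p := progBlock 1 1 n (-(2 * n - 1)))
      (q := progBlock 1 1 (n - 1) (-(n - 1)))
    have e2 := natDegree_mul_le (p := progBlock 1 1 (n - 1) (n + 1))
      (q := progBlock 1 1 n (2 * n))
    have b1 := natDegree_progBlock_le 1 1 n (-(2 * n - 1))
    have b2 := natDegree_progBlock_le 1 1 (n - 1) (-(n - 1))
    have b3 := natDegree_progBlock_le 1 1 (n - 1) (n + 1)
    have b4 := natDegree_progBlock_le 1 1 n (2 * n)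
    omega
  have h2 : ∀ e ∈ Finset.range 5, (numFrac n e).natDegree ≤ 3 * n := by
    intro e _
    rw [numFrac]
    have b1 := natDegree_progBlock_le 2 (2 ^ n) n (2 * ((e - 2) * n) + 1)
    have b2 := natDegree_progBlock_le 3 (3 ^ (n / 2)) n (3 * ((e - 2) * n) + 2)
    have b3 := natDegree_progBlock_le 3 (3 ^ (n / 2)) n (3 * ((e - 2) * n) + 1)
    have e2 := natDegree_mul_le (p := progBlock 3 (3 ^ (n / 2)) n (3 * ((e - 2) * n) + 2))
      (q := progBlock 3 (3 ^ (n / 2)) n (3 * ((e - 2) * n) + 1))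
    refine natDegree_mul_le.trans ?_
    omega
  have h3 : (∏ e ∈ Finset.range 5, numFrac n e).natDegree ≤ 15 * n := by
    refine (natDegree_prod_le _ _).trans ((Finset.sum_le_card_nsmul _ _ _ h2).trans ?_)
    rw [Finset.card_range, smul_eq_mul]
    omega
  refine natDegree_mul_le.trans ?_
  omega

theorem two_pow_div_factorial_mem {p : ℕ} [Fact p.Prime] (hp : p ∣ 2) (n : ℕ) :
    ((2 ^ n : ℕ) / n.factorial : ℚ) ∈ padicIntegral p := by
  obtain rfl : p = 2 := (Nat.prime_dvd_prime_iff_eq Fact.out Nat.prime_two).1 hp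
  refine natCast_div_mem_padicIntegral (Nat.factorial_ne_zero _) ?_
  rw [padicValNat.prime_pow]
  have := sub_one_mul_padicValNat_factorial (p := 2) n
  omega

theorem three_pow_div_factorial_mem {p : ℕ} [Fact p.Prime] (hp : p ∣ 3) (n : ℕ) :
    ((3 ^ (n / 2) : ℕ) / n.factorial : ℚ) ∈ padicIntegral p := by
  obtain rfl : p = 3 := (Nat.prime_dvd_prime_iff_eq Fact.out Nat.prime_three).1 hp
  refine natCast_div_mem_padicIntegral (Nat.factorial_ne_zero _) ?_
  rw [padicValNat.prime_pow]
  have := sub_one_mul_padicValNat_factorial (p := 3) n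
  omega

theorem aeval_numPoly_mem {p : ℕ} [Fact p.Prime] (n k : ℕ) :
    aeval (PowerSeries.X - PowerSeries.C (k : ℚ)) (numPoly n) ∈
      scaledIntegral p (Nat.log p n) := by
  have hp1 : ∀ {q : ℚ}, p ∣ 1 → q ∈ padicIntegral p := fun h =>
    absurd (Nat.dvd_one.1 h) (Fact.out : p.Prime).one_lt.ne'
  rw [numPoly, numInt, map_mul, map_mul, map_mul, map_mul, map_prod]
  refine Subring.mul_mem _ (Subring.mul_mem _ (Subring.mul_mem _ ?_ ?_) (Subring.mul_mem _ ?_ ?_))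
    (Subring.prod_mem _ fun e _ => ?_)
  · exact aeval_progBlock_mem _ le_rfl hp1 k
  · exact aeval_progBlock_mem _ (Nat.sub_le _ _) hp1 k
  · exact aeval_progBlock_mem _ (Nat.sub_le _ _) hp1 k
  · exact aeval_progBlock_mem _ le_rfl hp1 k
  · rw [numFrac, map_mul, map_mul]
    refine Subring.mul_mem _ ?_ (Subring.mul_mem _ ?_ ?_)
    · exact aeval_progBlock_mem _ le_rfl (fun h => two_pow_div_factorial_mem h n) k
    · exact aeval_progBlock_mem _ le_rfl (fun h => three_pow_div_factorial_mem h n) k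
    · exact aeval_progBlock_mem _ le_rfl (fun h => three_pow_div_factorial_mem h n) k

theorem eval_numPoly_reflect {n : ℕ} (hn : Even n) (hn0 : n ≠ 0) (t : ℚ) :
    (numPoly n).eval (-n - t) = (numPoly n).eval t := by
  have hs : (-1 : ℚ) ^ n = 1 := hn.neg_one_pow
  have hs' : ((-1 : ℚ) ^ (n - 1)) * (-1) ^ (n - 1) = 1 := by rw [← mul_pow]; simp
  have hn1 : ((n - 1 : ℕ) : ℤ) = n - 1 := by omega
  rw [numPoly, eval_mul, eval_mul, eval_prod, eval_prod]
  congr 1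
  · rw [numInt, eval_mul, eval_mul, eval_mul, eval_mul, eval_mul, eval_mul,
      eval_progBlock_reflect 1 1 n (-(2 * n - 1)) (2 * n) n (by push_cast; ring),
      eval_progBlock_reflect 1 1 (n - 1) (-(n - 1)) (n + 1) n (by rw [hn1]; push_cast; ring),
      eval_progBlock_reflect 1 1 (n - 1) (n + 1) (-(n - 1)) n (by rw [hn1]; push_cast; ring),
      eval_progBlock_reflect 1 1 n (2 * n) (-(2 * n - 1)) n (by push_cast; ring), hs]
    set A := eval t (progBlock 1 1 (n - 1) (n + 1))
    set B := eval t (progBlock 1 1 (n - 1) (-(n - 1)))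
    linear_combination (A * B * eval t (progBlock 1 1 n (-(2 * n - 1))) *
      eval t (progBlock 1 1 n (2 * n))) * hs'
  · rw [← Finset.prod_range_reflect]
    refine Finset.prod_congr rfl fun e he => ?_
    have he' : ((5 - 1 - e : ℕ) : ℤ) = 4 - e := by
      have := Finset.mem_range.1 he
      omega
    rw [numFrac, numFrac, eval_mul, eval_mul, eval_mul, eval_mul, he',
      eval_progBlock_reflect 2 (2 ^ n) n _ (2 * ((e - 2) * n) + 1) n (by push_cast; ring),
      eval_progBlock_reflect 3 (3 ^ (n / 2)) n _ (3 * ((e - 2) * n) + 1) n (by push_cast; ring),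
      eval_progBlock_reflect 3 (3 ^ (n / 2)) n _ (3 * ((e - 2) * n) + 2) n (by push_cast; ring), hs]
    ring

end RationalFunction

section Coefficients

open Polynomial Finset

theorem ratFun_reflect {n : ℕ} (hn : Even n) (hn0 : n ≠ 0) (t : ℚ) :
    ratFun n (-n - t) = -ratFun n t := by
  rw [ratFun, ratFun, eval_numPoly_reflect hn hn0, ← div_neg, ← prod_range_reflect]
  congr 1
  have h1 : ∀ k ∈ range (n + 1), (-(n : ℚ) - t + (n + 1 - 1 - k : ℕ)) ^ 77 =
      (-1) * (t + k) ^ 77 := by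
    intro k hk
    have := mem_range.1 hk
    rw [Nat.add_sub_cancel, Nat.cast_sub (by omega)]
    ring
  rw [prod_congr rfl h1, prod_mul_distrib, prod_const, card_range, hn.add_one.neg_one_pow,
    neg_one_mul]

theorem eval_pfTerm_div {n k j : ℕ} (hk : k ≤ n) (hj : j < 77) {t : ℚ}
    (ht : ∀ k : ℕ, k ≤ n → t + k ≠ 0) :
    (pfTerm n 77 k j).eval t / ∏ k ∈ range (n + 1), (t + k) ^ 77 = 1 / (t + k) ^ (77 - j) := by
  have hk' : k ∈ range (n + 1) := by simp; omega
  rw [pfTerm, ← mul_prod_erase _ _ hk', eval_mul, eval_prod]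
  simp only [eval_pow, eval_add, eval_X, eval_C]
  have h1 : ∏ i ∈ (range (n + 1)).erase k, (t + (i : ℚ)) ^ 77 ≠ 0 := by
    refine prod_ne_zero_iff.2 fun i hi => pow_ne_zero _ (ht i ?_)
    have := mem_range.1 (mem_erase.1 hi).2
    omega
  have h2 := ht k hk
  rw [mul_div_mul_right _ _ h1, div_eq_div_iff (pow_ne_zero _ h2) (pow_ne_zero _ h2), ← pow_add,
    one_mul]
  congr 1
  omega

/-- `b k s` are coefficients of `(t + k) ^ (-(s + 1))` in a partial fraction expansion of
`2 * ratFun n t`, with the vanishing and integrality properties provided by the symmetry and the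
arithmetic of the rational function. -/
structure IsRatFunCoeff (n : ℕ) (b : ℕ → ℕ → ℚ) : Prop where
  expansion : ∀ t : ℚ, (∀ k : ℕ, k ≤ n → t + k ≠ 0) →
    2 * ratFun n t = ∑ k ∈ range (n + 1), ∑ s ∈ range 77, b k s / (t + k) ^ (s + 1)
  sum_eq_zero : ∀ s, s = 0 ∨ Odd s → ∑ k ∈ range (n + 1), b k s = 0
  mem : ∀ (p : ℕ) [Fact p.Prime] (k s : ℕ), k ≤ n → s < 77 →
    b k s * ((p : ℚ) ^ Nat.log p n) ^ (76 - s) ∈ padicIntegral p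

theorem exists_isRatFunCoeff {n : ℕ} (hn : Even n) (hn0 : n ≠ 0) :
    ∃ b : ℕ → ℕ → ℚ, IsRatFunCoeff n b := by
  obtain ⟨c, hP, hc⟩ := exists_partialFraction (n := n) (A := 77) (P := numPoly n) (by norm_num)
    (by have := natDegree_numPoly_le n; omega)
  set a : ℕ → ℕ → ℚ := fun k s => n.factorial ^ 77 * c k (76 - s) with ha
  have hR : ∀ t : ℚ, (∀ k : ℕ, k ≤ n → t + k ≠ 0) →
      ratFun n t = ∑ k ∈ range (n + 1), ∑ s ∈ range 77, a k s / (t + k) ^ (s + 1) := by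
    intro t ht
    rw [ratFun]
    nth_rw 1 [hP]
    rw [eval_finsetSum, mul_sum, sum_div]
    refine sum_congr rfl fun k hk => ?_
    rw [eval_finsetSum, mul_sum, sum_div, ← sum_range_reflect]
    refine sum_congr rfl fun s hs => ?_
    have hs' := mem_range.1 hs
    rw [show 77 - 1 - s = 76 - s by omega, eval_mul, eval_C, ← mul_assoc, mul_div_assoc,
      eval_pfTerm_div (by simpa [Nat.lt_succ_iff] using hk) (by omega) ht,
      show 77 - (76 - s) = s + 1 by omega, mul_one_div]
  refine ⟨fun k s => a k s - (-1) ^ (s + 1) * a (n - k) s, ?_, ?_, ?_⟩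
  · intro t ht
    have h1 : ratFun n t = -ratFun n (-n - t) := by rw [ratFun_reflect hn hn0, neg_neg]
    have h2 := hR (-n - t) (fun k hk h => ht (n - k) (Nat.sub_le _ _)
      (by rw [Nat.cast_sub hk]; linarith))
    rw [two_mul]
    nth_rw 1 [hR t ht]
    rw [h1, h2, ← sub_eq_add_neg, ← sum_range_reflect (fun k => ∑ s ∈ range 77,
      a k s / (-(n : ℚ) - t + k) ^ (s + 1)), ← sum_sub_distrib]
    refine sum_congr rfl fun k hk => ?_
    rw [← sum_sub_distrib]
    refine sum_congr rfl fun s _ => ?_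
    have hk' := mem_range.1 hk
    rw [Nat.add_sub_cancel, Nat.cast_sub (by omega),
      show (-(n : ℚ) - t + (n - k)) = (-1) * (t + k) by ring, mul_pow, sub_div]
    congr 1
    have h3 : ((-1 : ℚ) ^ (s + 1)) * (-1) ^ (s + 1) = 1 := by rw [← mul_pow]; simp
    have h4 := pow_ne_zero (s + 1) (ht k (by omega))
    have h5 : ((-1 : ℚ) ^ (s + 1)) ≠ 0 := by positivity
    rw [div_eq_div_iff (mul_ne_zero h5 h4) h4]
    linear_combination (-(a (n - k) s) * (t + k) ^ (s + 1)) * h3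
  · intro s hs
    have h1 : ∑ k ∈ range (n + 1), a (n - k) s = ∑ k ∈ range (n + 1), a k s := by
      rw [← sum_range_reflect (fun k => a k s)]
      simp
    rw [sum_sub_distrib, ← mul_sum (f := fun k => a (n - k) s), h1]
    rcases hs with rfl | hs
    · simp only [ha, ← mul_sum]
      rw [hc]
      ring
    · rw [hs.add_one.neg_one_pow]
      ring
  · intro p _ k s hk hs
    have h1 : ∀ k ≤ n, a k s * ((p : ℚ) ^ Nat.log p n) ^ (76 - s) ∈ padicIntegral p :=
      fun k hk => partialFraction_coeff_mem hP hk (aeval_numPoly_mem n k) (by omega)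
    rw [sub_mul, mul_assoc ((-1) ^ (s + 1))]
    exact Subring.sub_mem _ (h1 k hk) (Subring.mul_mem _ (Subring.pow_mem _
      (Subring.neg_mem _ (Subring.one_mem _)) _) (h1 _ (Nat.sub_le _ _)))

theorem ratFun_eq_zero_of_numInt {n : ℕ} {t : ℚ} (h : (numInt n).eval t = 0) :
    ratFun n t = 0 := by
  rw [ratFun, numPoly, eval_mul, h, zero_mul, mul_zero, zero_div]

theorem ratFun_eq_zero_of_numFrac {n e : ℕ} (he : e < 5) {t : ℚ}
    (h : (numFrac n e).eval t = 0) : ratFun n t = 0 := by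
  rw [ratFun, numPoly, eval_mul, eval_prod, prod_eq_zero (mem_range.2 he) h, mul_zero, mul_zero,
    zero_div]

theorem ratFun_natCast_eq_zero {n m : ℕ} (hm : 0 < m) (hmn : m < 2 * n) : ratFun n m = 0 := by
  refine ratFun_eq_zero_of_numInt ?_
  rw [numInt, eval_mul, eval_mul]
  rcases le_or_gt n m with h | h
  · rw [eval_progBlock_eq_zero (i := 2 * n - 1 - m), zero_mul, zero_mul]
    · omega
    · rw [Nat.cast_sub (by omega), Nat.cast_sub (by omega)]
      push_cast
      ring
  · rw [eval_progBlock_eq_zero (α := -(n - 1)) (i := n - 1 - m), mul_zero, zero_mul]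
    · omega
    · rw [Nat.cast_sub (by omega), Nat.cast_sub (by omega)]
      push_cast
      ring

/-- The fractional parts at which the rational function is summed. -/
def fracParts : Finset ℚ := {1 / 2, 1 / 3, 2 / 3}

theorem ratFun_frac_eq_zero {n : ℕ} {c : ℚ} (hc : c ∈ fracParts) {j : ℤ} (hj : -(3 * n : ℤ) ≤ j)
    (hjn : j < 2 * n) : ratFun n (j + c) = 0 := by
  have hn : 0 < (n : ℤ) := by omega
  obtain ⟨r, hr⟩ : ∃ r : ℕ, (r : ℤ) = 2 * n - 1 - j := ⟨(2 * n - 1 - j).toNat, by omega⟩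
  have hdiv : (n : ℤ) * (r / n : ℕ) + (r % n : ℕ) = r := by exact_mod_cast Nat.div_add_mod r n
  have he : r / n < 5 := Nat.div_lt_of_lt_mul (by omega)
  have hi : r % n < n := Nat.mod_lt _ (by omega)
  set e := r / n
  set i := r % n
  have key : (j : ℚ) = 2 * n - 1 - (n * e + i) := by
    have : j = 2 * n - 1 - (n * e + i) := by omega
    exact_mod_cast this
  refine ratFun_eq_zero_of_numFrac he ?_
  rw [numFrac, eval_mul, eval_mul]
  simp only [fracParts, Finset.mem_insert, Finset.mem_singleton] at hc
  rcases hc with rfl | rfl | rfl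
  · rw [eval_progBlock_eq_zero (i := i) hi, zero_mul]
    rw [key]; push_cast; ring
  · rw [eval_progBlock_eq_zero (D := 3) (α := 3 * ((e - 2) * n) + 2) (i := i) hi, zero_mul,
      mul_zero]
    rw [key]; push_cast; ring
  · rw [eval_progBlock_eq_zero (D := 3) (α := 3 * ((e - 2) * n) + 1) (i := i) hi, mul_zero,
      mul_zero]
    rw [key]; push_cast; ring

end Coefficients

section LinearForms

open Finset Filter Topology

theorem sum_range_shift (f : ℕ → ℚ) (M k : ℕ) : ∑ m ∈ range M, f (m + k) =
    ∑ m ∈ range M, f m + ∑ l ∈ range k, f (M + l) - ∑ l ∈ range k, f l := by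
  have h1 := sum_range_add f M k
  have h2 := sum_range_add f k M
  rw [add_comm k M, h1] at h2
  rw [h2]
  simp [add_comm]

/-- The rational part of the linear form attached to the fractional part `c`. -/
def rationalPart (n : ℕ) (b : ℕ → ℕ → ℚ) (c : ℚ) : ℚ :=
  ∑ k ∈ range (n + 1), ∑ l ∈ range k, ∑ s ∈ range 77, b k s / (l + c) ^ (s + 1)

/-- Partial sums of the Hurwitz zeta series at `c` and `s + 1`. -/
def hurwitzSum (c : ℚ) (s M : ℕ) : ℚ := ∑ m ∈ range M, 1 / ((m : ℚ) + c) ^ (s + 1)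

/-- The boundary term in the expansion of partial sums. -/
def boundaryPart (n : ℕ) (b : ℕ → ℕ → ℚ) (c : ℚ) (M : ℕ) : ℚ :=
  ∑ k ∈ range (n + 1), ∑ s ∈ range 77, ∑ l ∈ range k, b k s / (M + l + c) ^ (s + 1)

theorem sum_ratFun {n : ℕ} {b : ℕ → ℕ → ℚ} (hb : IsRatFunCoeff n b) {c : ℚ} (hc : 0 < c)
    (M : ℕ) : ∑ m ∈ range M, 2 * ratFun n (m + c) =
      ∑ s ∈ range 77, (∑ k ∈ range (n + 1), b k s) * hurwitzSum c s M +
        boundaryPart n b c M - rationalPart n b c := by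
  have h1 : ∀ m ∈ range M, 2 * ratFun n (m + c) =
      ∑ k ∈ range (n + 1), ∑ s ∈ range 77, b k s / (m + c + k) ^ (s + 1) := fun m _ =>
    hb.expansion _ fun k _ => by positivity
  have h2 : ∑ s ∈ range 77, (∑ k ∈ range (n + 1), b k s) * hurwitzSum c s M =
      ∑ k ∈ range (n + 1), ∑ s ∈ range 77, ∑ m ∈ range M, b k s / (m + c) ^ (s + 1) := by
    rw [sum_comm]
    refine sum_congr rfl fun s _ => ?_
    rw [hurwitzSum, sum_mul]
    refine sum_congr rfl fun k _ => ?_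
    rw [mul_sum]
    refine sum_congr rfl fun m _ => by rw [mul_one_div]
  rw [sum_congr rfl h1, sum_comm, h2, boundaryPart, rationalPart, ← sum_add_distrib,
    ← sum_sub_distrib]
  refine sum_congr rfl fun k _ => ?_
  rw [sum_comm, sum_comm (s := range k), ← sum_add_distrib, ← sum_sub_distrib]
  refine sum_congr rfl fun s _ => ?_
  have h3 := sum_range_shift (fun m => b k s / ((m : ℚ) + c) ^ (s + 1)) M k
  push_cast at h3
  rw [← h3]
  refine sum_congr rfl fun m _ => by rw [add_right_comm]

theorem tendsto_boundaryPart (n : ℕ) (b : ℕ → ℕ → ℚ) (c : ℚ) :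
    Tendsto (fun M => (boundaryPart n b c M : ℝ)) atTop (𝓝 0) := by
  simp only [boundaryPart, Rat.cast_sum, Rat.cast_div, Rat.cast_pow, Rat.cast_add,
    Rat.cast_natCast]
  rw [← sum_const_zero (s := range (n + 1))]
  refine tendsto_finsetSum _ fun k _ => ?_
  rw [← sum_const_zero (s := range 77)]
  refine tendsto_finsetSum _ fun s _ => ?_
  rw [← sum_const_zero (s := range k)]
  refine tendsto_finsetSum _ fun l _ => ?_
  refine tendsto_const_nhds.div_atTop ((tendsto_pow_atTop (by omega)).comp ?_)
  exact tendsto_atTop_add_const_right _ _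
    (tendsto_atTop_add_const_right _ _ tendsto_natCast_atTop_atTop)

theorem tendsto_hurwitzSum_one {s : ℕ} (hs : 1 ≤ s) :
    Tendsto (fun M => (hurwitzSum 1 s M : ℝ)) atTop (𝓝 (zetaVal (s + 1))) := by
  have h1 : Summable fun m : ℕ => 1 / ((m : ℝ) + 1) ^ (s + 1) := by
    have := (summable_nat_add_iff 1).2 (Real.summable_one_div_nat_pow.2 (by omega : 1 < s + 1))
    simpa using this
  have := h1.hasSum.tendsto_sum_nat
  simpa [hurwitzSum, zetaVal] using this

theorem hurwitzSum_half (s M : ℕ) : hurwitzSum (1 / 2) s M =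
    2 ^ (s + 1) * hurwitzSum 1 s (2 * M) - hurwitzSum 1 s M := by
  induction M with
  | zero => simp [hurwitzSum]
  | succ M ih =>
    have h1 : ∀ c : ℚ, hurwitzSum c s (M + 1) = hurwitzSum c s M + 1 / ((M : ℚ) + c) ^ (s + 1) :=
      fun c => sum_range_succ _ _
    have h2 : hurwitzSum 1 s (2 * (M + 1)) = hurwitzSum 1 s (2 * M) +
        1 / (2 * (M : ℚ) + 1) ^ (s + 1) + 1 / (2 * (M : ℚ) + 1 + 1) ^ (s + 1) := by
      simp only [hurwitzSum]
      rw [show 2 * (M + 1) = 2 * M + 1 + 1 by ring, sum_range_succ _ (2 * M + 1),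
        sum_range_succ _ (2 * M)]
      push_cast
      ring
    rw [h1, h1, h2]
    have e1 : (1 : ℚ) / (M + 1 / 2) ^ (s + 1) = 2 ^ (s + 1) * (1 / (2 * M + 1) ^ (s + 1)) := by
      rw [mul_one_div, ← div_pow, ← one_div_pow]
      congr 1
      field_simp
    have e2 : (1 : ℚ) / (M + 1) ^ (s + 1) = 2 ^ (s + 1) * (1 / (2 * M + 1 + 1) ^ (s + 1)) := by
      rw [mul_one_div, ← div_pow, ← one_div_pow]
      congr 1
      field_simp
      ring
    linear_combination ih + e1 + e2

theorem hurwitzSum_third (s M : ℕ) : hurwitzSum (1 / 3) s M + hurwitzSum (2 / 3) s M =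
    3 ^ (s + 1) * hurwitzSum 1 s (3 * M) - hurwitzSum 1 s M := by
  induction M with
  | zero => simp [hurwitzSum]
  | succ M ih =>
    have h1 : ∀ c : ℚ, hurwitzSum c s (M + 1) = hurwitzSum c s M + 1 / ((M : ℚ) + c) ^ (s + 1) :=
      fun c => sum_range_succ _ _
    have h2 : hurwitzSum 1 s (3 * (M + 1)) = hurwitzSum 1 s (3 * M) +
        1 / (3 * (M : ℚ) + 1) ^ (s + 1) + 1 / (3 * (M : ℚ) + 1 + 1) ^ (s + 1) +
        1 / (3 * (M : ℚ) + 2 + 1) ^ (s + 1) := by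
      simp only [hurwitzSum]
      rw [show 3 * (M + 1) = 3 * M + 1 + 1 + 1 by ring, sum_range_succ _ (3 * M + 1 + 1),
        sum_range_succ _ (3 * M + 1), sum_range_succ _ (3 * M)]
      push_cast
      ring
    rw [h1, h1, h1, h2]
    have e1 : (1 : ℚ) / (M + 1 / 3) ^ (s + 1) = 3 ^ (s + 1) * (1 / (3 * M + 1) ^ (s + 1)) := by
      rw [mul_one_div, ← div_pow, ← one_div_pow]
      congr 1
      field_simp
    have e2 : (1 : ℚ) / (M + 2 / 3) ^ (s + 1) = 3 ^ (s + 1) * (1 / (3 * M + 1 + 1) ^ (s + 1)) := by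
      rw [mul_one_div, ← div_pow, ← one_div_pow]
      congr 1
      field_simp
      ring
    have e3 : (1 : ℚ) / (M + 1) ^ (s + 1) = 3 ^ (s + 1) * (1 / (3 * M + 2 + 1) ^ (s + 1)) := by
      rw [mul_one_div, ← div_pow, ← one_div_pow]
      congr 1
      field_simp
      ring
    linear_combination ih + e1 + e2 + e3

theorem tendsto_hurwitzSum_half {s : ℕ} (hs : 1 ≤ s) :
    Tendsto (fun M => (hurwitzSum (1 / 2) s M : ℝ)) atTop
      (𝓝 ((2 ^ (s + 1) - 1) * zetaVal (s + 1))) := by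
  have h1 := tendsto_hurwitzSum_one hs
  have h2 := h1.comp (tendsto_id.const_mul_atTop' (two_pos : 0 < 2))
  have h3 := (h2.const_mul (2 ^ (s + 1))).sub h1
  simp only [hurwitzSum_half]
  rw [sub_mul, one_mul]
  refine h3.congr fun M => ?_
  push_cast
  rfl

theorem tendsto_hurwitzSum_third {s : ℕ} (hs : 1 ≤ s) :
    Tendsto (fun M => (hurwitzSum (1 / 3) s M : ℝ) + hurwitzSum (2 / 3) s M) atTop
      (𝓝 ((3 ^ (s + 1) - 1) * zetaVal (s + 1))) := by
  have h1 := tendsto_hurwitzSum_one hs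
  have h2 := h1.comp (tendsto_id.const_mul_atTop' (three_pos : 0 < 3))
  have h3 := (h2.const_mul (3 ^ (s + 1))).sub h1
  simp only [← Rat.cast_add, hurwitzSum_third]
  rw [sub_mul, one_mul]
  refine h3.congr fun M => ?_
  push_cast
  rfl

end LinearForms

section Integrality

open Finset Filter Topology

variable {n : ℕ} {b : ℕ → ℕ → ℚ}

theorem IsRatFunCoeff.sum_div_mem (hb : IsRatFunCoeff n b) {p : ℕ} [Fact p.Prime] {k : ℕ}
    (hk : k ≤ n) {x : ℚ} (hx : (p : ℚ) ^ Nat.log p n / x ∈ padicIntegral p) :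
    ((p : ℚ) ^ Nat.log p n) ^ 77 * ∑ s ∈ range 77, b k s / x ^ (s + 1) ∈ padicIntegral p := by
  rw [mul_sum]
  refine Subring.sum_mem _ fun s hs => ?_
  have hs' := mem_range.1 hs
  convert Subring.mul_mem _ (hb.mem p k s hk hs') (Subring.pow_mem _ hx (s + 1)) using 1
  rw [show 77 = (76 - s) + (s + 1) by omega, pow_add, div_pow]
  ring

theorem not_pow_log_succ_dvd {p n : ℕ} (hp : 1 < p) {z : ℤ} (hz : z ≠ 0) (hzn : |z| ≤ n) :
    ¬ (p : ℤ) ^ (Nat.log p n + 1) ∣ z := by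
  intro h
  have h1 := Int.le_of_dvd (abs_pos.2 hz) ((dvd_abs _ _).2 h)
  have h2 : n < p ^ (Nat.log p n + 1) := Nat.lt_pow_succ_log_self hp n
  zify at h2
  linarith

theorem mem_fracParts_iff_exists {c : ℚ} (hc : c ∈ fracParts) :
    ∃ D u : ℕ, Nat.Coprime u D ∧ 0 < u ∧ u < D ∧ c = u / D := by
  simp only [fracParts, Finset.mem_insert, Finset.mem_singleton] at hc
  rcases hc with rfl | rfl | rfl
  · exact ⟨2, 1, by norm_num⟩
  · exact ⟨3, 1, by norm_num⟩
  · exact ⟨3, 2, by norm_num⟩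

theorem pos_of_mem_fracParts {c : ℚ} (hc : c ∈ fracParts) : 0 < c := by
  obtain ⟨D, u, -, hu, huD, rfl⟩ := mem_fracParts_iff_exists hc
  have : 0 < D := hu.trans huD
  positivity

theorem int_add_ne_zero_of_mem_fracParts {c : ℚ} (hc : c ∈ fracParts) (j : ℤ) :
    (j : ℚ) + c ≠ 0 := by
  obtain ⟨D, u, -, hu, huD, rfl⟩ := mem_fracParts_iff_exists hc
  have hD : (D : ℚ) ≠ 0 := by exact_mod_cast (hu.trans huD).ne'
  intro h
  have h1 : (j * D + u : ℚ) = 0 := by field_simp at h; linarith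
  have h2 : j * D + u = 0 := by exact_mod_cast h1
  have h3 : (0 : ℤ) < u := by exact_mod_cast hu
  have h4 : (u : ℤ) < D := by exact_mod_cast huD
  have h5 : -1 < j := by nlinarith
  nlinarith

theorem IsRatFunCoeff.rationalPart_one_mem (hb : IsRatFunCoeff n b) (p : ℕ) [Fact p.Prime] :
    ((p : ℚ) ^ Nat.log p n) ^ 77 * rationalPart n b 1 ∈ padicIntegral p := by
  rw [rationalPart, mul_sum]
  refine Subring.sum_mem _ fun k hk => ?_
  rw [mul_sum]
  refine Subring.sum_mem _ fun l hl => ?_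
  have hk' := mem_range.1 hk
  have hl' := mem_range.1 hl
  refine hb.sum_div_mem (by omega) ?_
  have h1 : ¬ (p : ℤ) ^ (Nat.log p n + 1) ∣ (l + 1 : ℤ) := by
    refine not_pow_log_succ_dvd (Fact.out : p.Prime).one_lt (by omega) ?_
    rw [abs_of_nonneg (by positivity)]
    omega
  have := intCast_div_mem_padicIntegral (a := (p : ℤ) ^ Nat.log p n) dvd_rfl h1
  simpa using this

theorem IsRatFunCoeff.rationalPart_frac_mem (hb : IsRatFunCoeff n b) {c : ℚ}
    (hc : c ∈ fracParts) (p : ℕ) [hp : Fact p.Prime] :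
    ((p : ℚ) ^ Nat.log p n) ^ 77 * rationalPart n b c ∈ padicIntegral p := by
  rw [rationalPart, mul_sum]
  refine Subring.sum_mem _ fun k hk => ?_
  rw [mul_sum]
  refine Subring.sum_mem _ fun l hl => ?_
  have hk' := mem_range.1 hk
  have hl' := mem_range.1 hl
  obtain ⟨D, u, hDu, hu, huD, hcu⟩ := mem_fracParts_iff_exists hc
  have hD : (D : ℚ) ≠ 0 := by exact_mod_cast (hu.trans huD).ne'
  have hmem : ∀ j : ℤ, ¬ (p : ℤ) ^ (Nat.log p n + 1) ∣ D * j + u →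
      (p : ℚ) ^ Nat.log p n / (j + c) ∈ padicIntegral p := by
    intro j hj
    have := intCast_div_mem_padicIntegral (a := (p : ℤ) ^ Nat.log p n * D)
      (Dvd.intro _ rfl) hj
    convert this using 1
    have h1 := int_add_ne_zero_of_mem_fracParts hc j
    have h2 : ((D * j + u : ℤ) : ℚ) = D * (j + c) := by
      rw [hcu]; push_cast; field_simp
    rw [h2]
    push_cast
    field_simp
  by_cases hz : (p : ℤ) ^ (Nat.log p n + 1) ∣ D * (l : ℤ) + u
  · have hpD : ¬ p ∣ D := by
      intro h
      have h1 : (p : ℤ) ∣ D * (l : ℤ) + u := (dvd_pow_self _ (by omega)).trans hz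
      have h2 : p ∣ D * l + u := by exact_mod_cast h1
      have h3 : p ∣ u := (Nat.dvd_add_right (h.mul_right l)).1 h2
      have h4 := Nat.dvd_gcd h3 h
      rw [hDu] at h4
      exact hp.out.one_lt.ne' (Nat.dvd_one.1 h4)
    have hcop : IsCoprime ((p : ℤ) ^ (Nat.log p n + 1)) D :=
      (Nat.isCoprime_iff_coprime.2 ((Nat.Prime.coprime_iff_not_dvd hp.out).2 hpD)).pow_left
    have h0 : ratFun n (((l : ℤ) - k : ℤ) + c) = 0 := ratFun_frac_eq_zero hc (by omega) (by omega)
    have h1 := hb.expansion (((l : ℤ) - k : ℤ) + c) (fun k' _ => by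
      have := int_add_ne_zero_of_mem_fracParts hc ((l : ℤ) - k + k')
      push_cast at this ⊢
      rwa [add_right_comm] at this)
    rw [h0, mul_zero, ← add_sum_erase _ _ hk] at h1
    have h2 : ∑ s ∈ range 77, b k s / (l + c) ^ (s + 1) =
        -∑ k' ∈ (range (n + 1)).erase k, ∑ s ∈ range 77,
          b k' s / ((((l : ℤ) - k + k' : ℤ) : ℚ) + c) ^ (s + 1) := by
      rw [eq_neg_iff_add_eq_zero, h1]
      push_cast
      congr 1
      · refine sum_congr rfl fun s _ => ?_
        congr 2
        ring
      · refine sum_congr rfl fun k' _ => sum_congr rfl fun s _ => ?_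
        congr 2
        ring
    rw [h2, mul_neg, mul_sum]
    refine Subring.neg_mem _ (Subring.sum_mem _ fun k' hk'' => ?_)
    have h3 := mem_erase.1 hk''
    have h4 := mem_range.1 h3.2
    refine hb.sum_div_mem (by omega) (hmem _ fun h5 => ?_)
    have h6 : (p : ℤ) ^ (Nat.log p n + 1) ∣ ((k' : ℤ) - k) * D := by
      have := dvd_sub h5 hz
      rwa [show D * ((l : ℤ) - k + k') + u - (D * l + u) = (k' - k) * D by ring] at this
    refine not_pow_log_succ_dvd hp.out.one_lt (by omega) ?_ (hcop.dvd_of_dvd_mul_right h6)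
    rw [abs_le]
    omega
  · exact hb.sum_div_mem (by omega) (by simpa using hmem l hz)

theorem exists_intCast_lcmUpto_mul {y : ℚ}
    (h : ∀ (p : ℕ) [Fact p.Prime], ((p : ℚ) ^ Nat.log p n) ^ 77 * y ∈ padicIntegral p) :
    ∃ z : ℤ, (z : ℚ) = (n.lcmUpto : ℚ) ^ 77 * y := by
  refine exists_intCast_of_forall_mem_padicIntegral fun p hp => ?_
  have h1 : p ^ Nat.log p n ∣ n.lcmUpto := by
    have := Nat.factorization_lcmUpto n hp.out
    rw [← this]
    exact Nat.ordProj_dvd _ _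
  obtain ⟨e, he⟩ := h1
  have h2 := Subring.mul_mem _ (natCast_mem (padicIntegral p) (e ^ 77)) (h p)
  convert h2 using 1
  rw [he]
  push_cast
  ring

theorem IsRatFunCoeff.sum_mem (hb : IsRatFunCoeff n b) {s : ℕ} (hs : s < 77) (p : ℕ)
    [Fact p.Prime] :
    ((p : ℚ) ^ Nat.log p n) ^ 77 * ∑ k ∈ range (n + 1), b k s ∈ padicIntegral p := by
  rw [mul_sum]
  refine Subring.sum_mem _ fun k hk => ?_
  have h1 := hb.mem p k s (by simpa [Nat.lt_succ_iff] using hk) hs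
  have h2 := Subring.mul_mem _ h1 (natCast_mem (padicIntegral p) ((p ^ Nat.log p n) ^ (s + 1)))
  convert h2 using 1
  rw [show 77 = (76 - s) + (s + 1) by omega, pow_add]
  push_cast
  ring

/-- The weighted combination of values of the rational function over the four residue classes. -/
noncomputable def weightedTerm (n : ℕ) (w : ℤ × ℤ × ℤ) (m : ℕ) : ℚ :=
  w.1 * ratFun n (m + 1) + w.2.1 * ratFun n (m + 1 / 2) +
    w.2.2 * (ratFun n (m + 1 / 3) + ratFun n (m + 2 / 3))

/-- The weight of `ζ(i)` in the linear form. -/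
def zetaWeight (w : ℤ × ℤ × ℤ) (i : ℕ) : ℤ := w.1 + w.2.1 * (2 ^ i - 1) + w.2.2 * (3 ^ i - 1)

theorem IsRatFunCoeff.tendsto_sum_weightedTerm (hb : IsRatFunCoeff n b) (w : ℤ × ℤ × ℤ) :
    Tendsto (fun M => 2 * ∑ m ∈ range M, (weightedTerm n w m : ℝ)) atTop
      (𝓝 (∑ s ∈ range 77, (∑ k ∈ range (n + 1), (b k s : ℝ)) *
          (zetaWeight w (s + 1) * zetaVal (s + 1)) -
        (w.1 * rationalPart n b 1 + w.2.1 * rationalPart n b (1 / 2) +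
          w.2.2 * (rationalPart n b (1 / 3) + rationalPart n b (2 / 3)) : ℚ))) := by
  have h1 : ∀ M, 2 * ∑ m ∈ range M, (weightedTerm n w m : ℝ) =
      ∑ s ∈ range 77, (∑ k ∈ range (n + 1), (b k s : ℝ)) * (w.1 * hurwitzSum 1 s M +
        w.2.1 * hurwitzSum (1 / 2) s M + w.2.2 * (hurwitzSum (1 / 3) s M + hurwitzSum (2 / 3) s M))
      + (w.1 * boundaryPart n b 1 M + w.2.1 * boundaryPart n b (1 / 2) M +
          w.2.2 * (boundaryPart n b (1 / 3) M + boundaryPart n b (2 / 3) M)) -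
        (w.1 * rationalPart n b 1 + w.2.1 * rationalPart n b (1 / 2) +
          w.2.2 * (rationalPart n b (1 / 3) + rationalPart n b (2 / 3)) : ℚ) := by
    intro M
    have e1 := sum_ratFun hb (c := 1) (by norm_num) M
    have e2 := sum_ratFun hb (c := 1 / 2) (by norm_num) M
    have e3 := sum_ratFun hb (c := 1 / 3) (by norm_num) M
    have e4 := sum_ratFun hb (c := 2 / 3) (by norm_num) M
    have e5 : 2 * ∑ m ∈ range M, weightedTerm n w m =
        w.1 * ∑ m ∈ range M, 2 * ratFun n (m + 1) + w.2.1 * ∑ m ∈ range M, 2 * ratFun n (m + 1 / 2)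
        + w.2.2 * (∑ m ∈ range M, 2 * ratFun n (m + 1 / 3) +
          ∑ m ∈ range M, 2 * ratFun n (m + 2 / 3)) := by
      simp only [weightedTerm, mul_sum, ← sum_add_distrib]
      refine sum_congr rfl fun m _ => by ring
    have e6 : ∀ B : ℕ → ℚ, ∑ s ∈ range 77, B s * (w.1 * hurwitzSum 1 s M +
        w.2.1 * hurwitzSum (1 / 2) s M + w.2.2 * (hurwitzSum (1 / 3) s M + hurwitzSum (2 / 3) s M))
        = w.1 * ∑ s ∈ range 77, B s * hurwitzSum 1 s M +
          w.2.1 * ∑ s ∈ range 77, B s * hurwitzSum (1 / 2) s M +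
          w.2.2 * (∑ s ∈ range 77, B s * hurwitzSum (1 / 3) s M +
            ∑ s ∈ range 77, B s * hurwitzSum (2 / 3) s M) := by
      intro B
      simp only [mul_sum, ← sum_add_distrib]
      refine sum_congr rfl fun m _ => by ring
    have e7 := e6 (fun s => ∑ k ∈ range (n + 1), b k s)
    rw [e1, e2, e3, e4] at e5
    have e8 : 2 * ∑ m ∈ range M, weightedTerm n w m =
        ∑ s ∈ range 77, (∑ k ∈ range (n + 1), b k s) * (w.1 * hurwitzSum 1 s M +
        w.2.1 * hurwitzSum (1 / 2) s M + w.2.2 * (hurwitzSum (1 / 3) s M + hurwitzSum (2 / 3) s M))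
      + (w.1 * boundaryPart n b 1 M + w.2.1 * boundaryPart n b (1 / 2) M +
          w.2.2 * (boundaryPart n b (1 / 3) M + boundaryPart n b (2 / 3) M)) -
        (w.1 * rationalPart n b 1 + w.2.1 * rationalPart n b (1 / 2) +
          w.2.2 * (rationalPart n b (1 / 3) + rationalPart n b (2 / 3))) := by
      rw [e5, e7]
      ring
    exact_mod_cast e8
  simp only [h1]
  refine Tendsto.sub_const ?_ _
  rw [← add_zero (∑ s ∈ range 77, _)]
  refine Tendsto.add (tendsto_finsetSum _ fun s _ => ?_) ?_
  · rcases Nat.eq_zero_or_pos s with rfl | hs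
    · have := hb.sum_eq_zero 0 (Or.inl rfl)
      have h2 : ∑ k ∈ range (n + 1), (b k 0 : ℝ) = 0 := by exact_mod_cast this
      simp [h2]
    · refine Tendsto.const_mul _ ?_
      have := ((tendsto_hurwitzSum_one hs).const_mul (w.1 : ℝ)).add
        ((tendsto_hurwitzSum_half hs).const_mul (w.2.1 : ℝ)) |>.add
        ((tendsto_hurwitzSum_third hs).const_mul (w.2.2 : ℝ))
      convert this using 2
      rw [zetaWeight]
      push_cast
      ring
  · have := ((tendsto_boundaryPart n b 1).const_mul (w.1 : ℝ)).add
        ((tendsto_boundaryPart n b (1 / 2)).const_mul (w.2.1 : ℝ)) |>.add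
        (((tendsto_boundaryPart n b (1 / 3)).add
          (tendsto_boundaryPart n b (2 / 3))).const_mul (w.2.2 : ℝ))
    simpa using this

theorem exists_tendsto_sum_weightedTerm (hn : Even n) (hn0 : n ≠ 0) {w : ℤ × ℤ × ℤ} {i₀ q : ℕ}
    (hw : zetaWeight w 3 = 0) (hw₀ : zetaWeight w i₀ = 0)
    (hq : ∀ i, Odd i → 5 ≤ i → i ≤ 77 → i ≠ i₀ → ∃ z : ℤ, (q : ℝ) * zetaVal i = z) :
    ∃ L : ℝ, Tendsto (fun M => ∑ m ∈ range M, (weightedTerm n w m : ℝ)) atTop (𝓝 L) ∧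
      ∃ z : ℤ, 2 * q * (n.lcmUpto : ℝ) ^ 77 * L = z := by
  obtain ⟨b, hb⟩ := exists_isRatFunCoeff hn hn0
  have h1 := (hb.tendsto_sum_weightedTerm w).const_mul (1 / 2 : ℝ)
  set L := ∑ s ∈ range 77, (∑ k ∈ range (n + 1), (b k s : ℝ)) *
          (zetaWeight w (s + 1) * zetaVal (s + 1)) -
        (w.1 * rationalPart n b 1 + w.2.1 * rationalPart n b (1 / 2) +
          w.2.2 * (rationalPart n b (1 / 3) + rationalPart n b (2 / 3)) : ℚ) with hL
  refine ⟨1 / 2 * L, h1.congr fun M => by ring, ?_⟩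
  have hterm : ∀ s ∈ range 77, ∃ z : ℤ, (n.lcmUpto : ℝ) ^ 77 * ((∑ k ∈ range (n + 1), (b k s : ℝ)) *
      (zetaWeight w (s + 1) * ((q : ℝ) * zetaVal (s + 1)))) = z := by
    intro s hs
    have hs' := mem_range.1 hs
    by_cases h0 : s = 0 ∨ Odd s
    · have := hb.sum_eq_zero s h0
      have h2 : ∑ k ∈ range (n + 1), (b k s : ℝ) = 0 := by exact_mod_cast this
      exact ⟨0, by simp [h2]⟩
    · push Not at h0
      rw [Nat.not_odd_iff_even] at h0
      by_cases h2 : s + 1 = 3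
      · exact ⟨0, by rw [h2, hw]; simp⟩
      by_cases h3 : s + 1 = i₀
      · exact ⟨0, by rw [h3, hw₀]; simp⟩
      obtain ⟨y, hy⟩ := hq (s + 1) h0.2.add_one (by obtain ⟨r, hr⟩ := h0.2; omega) (by omega) h3
      obtain ⟨x, hx⟩ := exists_intCast_lcmUpto_mul fun p _ => hb.sum_mem hs' p
      have hx' : (x : ℝ) = (n.lcmUpto : ℝ) ^ 77 * ∑ k ∈ range (n + 1), (b k s : ℝ) := by
        exact_mod_cast hx
      refine ⟨x * (zetaWeight w (s + 1) * y), ?_⟩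
      push_cast
      rw [hy, hx']
      ring
  choose! f hf using hterm
  have hhalf : (1 / 2 : ℚ) ∈ fracParts := by simp [fracParts]
  have hthird : (1 / 3 : ℚ) ∈ fracParts := by simp [fracParts]
  have htwothird : (2 / 3 : ℚ) ∈ fracParts := by simp [fracParts]
  obtain ⟨y₁, hy₁⟩ := exists_intCast_lcmUpto_mul fun p _ => hb.rationalPart_one_mem p
  obtain ⟨y₂, hy₂⟩ := exists_intCast_lcmUpto_mul fun p _ => hb.rationalPart_frac_mem hhalf p
  obtain ⟨y₃, hy₃⟩ := exists_intCast_lcmUpto_mul fun p _ => hb.rationalPart_frac_mem hthird p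
  obtain ⟨y₄, hy₄⟩ := exists_intCast_lcmUpto_mul fun p _ =>
    hb.rationalPart_frac_mem htwothird p
  have hy : ((w.1 * y₁ + w.2.1 * y₂ + w.2.2 * (y₃ + y₄) : ℤ) : ℝ) = (n.lcmUpto : ℝ) ^ 77 *
      (w.1 * rationalPart n b 1 + w.2.1 * rationalPart n b (1 / 2) +
          w.2.2 * (rationalPart n b (1 / 3) + rationalPart n b (2 / 3)) : ℚ) := by
    have : ((w.1 * y₁ + w.2.1 * y₂ + w.2.2 * (y₃ + y₄) : ℤ) : ℚ) = (n.lcmUpto : ℚ) ^ 77 *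
      (w.1 * rationalPart n b 1 + w.2.1 * rationalPart n b (1 / 2) +
          w.2.2 * (rationalPart n b (1 / 3) + rationalPart n b (2 / 3))) := by
      push_cast
      rw [hy₁, hy₂, hy₃, hy₄]
      ring
    exact_mod_cast this
  refine ⟨∑ s ∈ range 77, f s - q * (w.1 * y₁ + w.2.1 * y₂ + w.2.2 * (y₃ + y₄)), ?_⟩
  have e1 : 2 * q * (n.lcmUpto : ℝ) ^ 77 * (1 / 2 * L) = q * (n.lcmUpto : ℝ) ^ 77 * L := by ring
  rw [e1, hL, mul_sub, mul_sum, Int.cast_sub, Int.cast_sum, Int.cast_mul, hy]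
  push_cast
  congr 1
  · refine sum_congr rfl fun s hs => ?_
    rw [← hf s hs]
    ring
  · ring

end Integrality

section Estimates

open Finset

/-- The rising product `x (x + 1) ⋯ (x + N - 1)`. -/
def risingProd {K : Type*} [CommRing K] (x : K) (N : ℕ) : K := ∏ i ∈ range N, (x + i)

theorem risingProd_add {K : Type*} [CommRing K] (x : K) (M N : ℕ) :
    risingProd x (M + N) = risingProd x M * risingProd (x + M) N := by
  rw [risingProd, prod_range_add, risingProd, risingProd]
  congr 1
  refine prod_congr rfl fun i _ => by push_cast; ring

theorem Rat.cast_risingProd (x : ℚ) (N : ℕ) :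
    ((risingProd x N : ℚ) : ℝ) = risingProd (x : ℝ) N := by
  simp [risingProd]

theorem eval_progBlock_one (N : ℕ) (α : ℤ) (t : ℚ) : (progBlock 1 1 N α).eval t =
    risingProd (t + α) N / N.factorial := by
  rw [eval_progBlock, risingProd, Nat.cast_one, one_div_mul_eq_div]
  congr 1
  refine prod_congr rfl fun i _ => by ring

theorem eval_progBlock_two (n : ℕ) (α : ℤ) (t : ℚ) : (progBlock 2 (2 ^ n) n (2 * α + 1)).eval t =
    4 ^ n * risingProd (t + α + 1 / 2) n / n.factorial := by
  have h : ∏ i ∈ range n, (((2 * α + 1 : ℤ) : ℚ) + (2 : ℕ) * i + (2 : ℕ) * t) =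
      ∏ i ∈ range n, (2 * (t + α + 1 / 2 + i)) :=
    prod_congr rfl fun i _ => by push_cast; ring
  rw [eval_progBlock, h, prod_mul_distrib, prod_const, card_range, ← risingProd,
    show (4 : ℚ) = 2 * 2 by norm_num, mul_pow]
  push_cast
  ring

theorem eval_progBlock_three (n : ℕ) (α u : ℤ) (t : ℚ) :
    (progBlock 3 (3 ^ (n / 2)) n (3 * α + u)).eval t =
      3 ^ (n / 2) * 3 ^ n * risingProd (t + α + u / 3) n / n.factorial := by
  have h : ∏ i ∈ range n, (((3 * α + u : ℤ) : ℚ) + (3 : ℕ) * i + (3 : ℕ) * t) =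
      ∏ i ∈ range n, (3 * (t + α + u / 3 + i)) :=
    prod_congr rfl fun i _ => by push_cast; ring
  rw [eval_progBlock, h, prod_mul_distrib, prod_const, card_range, ← risingProd]
  push_cast
  ring

/-- The product of the linear factors of the numerator over `ℤ + c`. -/
def fracProd {K : Type*} [CommRing K] (n : ℕ) (t c : K) : K :=
  risingProd (t - 2 * n + c) (2 * n) * risingProd (t + c) n * risingProd (t + n + c) (2 * n)

/-- The product of the linear factors of the numerator over `ℤ`. -/
def intProd {K : Type*} [CommRing K] (n : ℕ) (t : K) : K :=
  risingProd (t - 2 * n + 1) (2 * n - 1) * risingProd (t + n + 1) (2 * n - 1)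

theorem prod_risingProd_eq_fracProd (n : ℕ) (t c : ℚ) :
    ∏ e ∈ range 5, risingProd (t + ((e - 2) * n) + c) n = fracProd n t c := by
  rw [fracProd, two_mul n, risingProd_add, risingProd_add]
  simp only [prod_range_succ, prod_range_zero, one_mul]
  push_cast
  rw [show t + (0 - 2) * (n : ℚ) + c = t - 2 * n + c by ring,
    show t - 2 * (n : ℚ) + c + n = t + (1 - 2) * n + c by ring,
    show t + (2 - 2) * (n : ℚ) + c = t + c by ring,
    show t + (3 - 2) * (n : ℚ) + c = t + n + c by ring,
    show t + n + c + (n : ℚ) = t + (4 - 2) * n + c by ring]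
  ring

theorem eval_numInt {n : ℕ} (hn : 0 < n) (t : ℚ) :
    (numInt n).eval t = n ^ 2 * intProd n t / n.factorial ^ 4 := by
  have h1 : 2 * n - 1 = n + (n - 1) := by omega
  have h2 : 2 * n - 1 = (n - 1) + n := by omega
  have h3 : ((n - 1 : ℕ) : ℚ) = n - 1 := by rw [Nat.cast_sub (by omega)]; simp
  have h4 : (n.factorial : ℚ) = n * (n - 1).factorial := by
    exact_mod_cast (Nat.mul_factorial_pred hn.ne').symm
  have h5 : ((n - 1).factorial : ℚ) ≠ 0 := by positivity
  have h6 : (n : ℚ) ≠ 0 := by positivity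
  rw [numInt, Polynomial.eval_mul, Polynomial.eval_mul, Polynomial.eval_mul, eval_progBlock_one,
    eval_progBlock_one, eval_progBlock_one, eval_progBlock_one, intProd]
  nth_rw 1 [h1]
  rw [h2, risingProd_add, risingProd_add, h3, h4]
  push_cast
  rw [show t + -(2 * (n : ℚ) - 1) = t - 2 * n + 1 by ring,
    show t + -((n : ℚ) - 1) = t - 2 * n + 1 + n by ring,
    show t + ((n : ℚ) + 1) = t + n + 1 by ring, show t + 2 * (n : ℚ) = t + n + 1 + (n - 1) by ring]
  field_simp

theorem eval_numFrac {n : ℕ} (hn : Even n) (e : ℕ) (t : ℚ) :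
    (numFrac n e).eval t = 108 ^ n / n.factorial ^ 3 *
      (risingProd (t + (e - 2) * n + 1 / 2) n * risingProd (t + (e - 2) * n + 1 / 3) n *
        risingProd (t + (e - 2) * n + 2 / 3) n) := by
  have h1 : (108 : ℚ) ^ n = 4 ^ n * ((3 ^ (n / 2) * 3 ^ n) * (3 ^ (n / 2) * 3 ^ n)) := by
    have h2 : (3 : ℚ) ^ (n / 2) * 3 ^ (n / 2) = 3 ^ n := by
      rw [← pow_add, ← two_mul, Nat.two_mul_div_two_of_even hn]
    rw [show (108 : ℚ) = 4 * (3 * 3 * 3) by norm_num, mul_pow, mul_pow, mul_pow]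
    linear_combination (-(4 ^ n * 3 ^ n * 3 ^ n)) * h2
  rw [numFrac, Polynomial.eval_mul, Polynomial.eval_mul, eval_progBlock_two, eval_progBlock_three,
    eval_progBlock_three, h1]
  push_cast
  have h5 : (n.factorial : ℚ) ≠ 0 := by positivity
  field_simp

theorem ratFun_eq {n : ℕ} (hn : Even n) (hn0 : 0 < n) (t : ℚ) : ratFun n t =
    n.factorial ^ 58 * n ^ 2 * 108 ^ (5 * n) * (intProd n t *
      (fracProd n t (1 / 2) * fracProd n t (1 / 3) * fracProd n t (2 / 3))) /
        risingProd t (n + 1) ^ 77 := by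
  rw [ratFun, numPoly, Polynomial.eval_mul, Polynomial.eval_prod, eval_numInt hn0]
  simp only [eval_numFrac hn]
  rw [prod_mul_distrib, prod_mul_distrib, prod_mul_distrib, prod_risingProd_eq_fracProd,
    prod_risingProd_eq_fracProd, prod_risingProd_eq_fracProd, prod_const, card_range, prod_pow,
    risingProd]
  congr 1
  rw [div_pow, ← pow_mul, ← pow_mul, mul_comm n 5]
  have h5 : (n.factorial : ℚ) ≠ 0 := by positivity
  field_simp
  ring

section Positivity

variable {K : Type*} [Field K] [LinearOrder K] [IsStrictOrderedRing K]

theorem risingProd_pos {x : K} (hx : 0 < x) (N : ℕ) : 0 < risingProd x N :=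
  prod_pos fun _ _ => by positivity

theorem fracProd_pos {n : ℕ} {t c : K} (ht : 2 * n ≤ t) (hc : 0 < c) : 0 < fracProd n t c := by
  have hn : (0 : K) ≤ n := by positivity
  have h1 : 0 < t - 2 * n + c := by linarith
  have h2 : 0 < t + c := by linarith
  have h3 : 0 < t + n + c := by linarith
  exact mul_pos (mul_pos (risingProd_pos h1 _) (risingProd_pos h2 _)) (risingProd_pos h3 _)

theorem intProd_pos {n : ℕ} {t : K} (ht : 2 * n ≤ t) : 0 < intProd n t := by
  have hn : (0 : K) ≤ n := by positivity
  exact mul_pos (risingProd_pos (by linarith) _) (risingProd_pos (by linarith) _)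

/-- Log-concavity up to a constant for rising products. -/
theorem risingProd_half_sq_le {x : K} (hx : 0 < x) (N : ℕ) :
    risingProd (x + 1 / 2) N ^ 2 ≤
      (1 + 1 / (3 * x)) * (risingProd x N * risingProd (x + 1) N) := by
  have key : ∀ N : ℕ, risingProd (x + 1 / 2) N ^ 2 * (1 + 1 / (3 * (x + N))) ≤
      (1 + 1 / (3 * x)) * (risingProd x N * risingProd (x + 1) N) := by
    intro N
    induction N with
    | zero => simp [risingProd]
    | succ N ih =>
      have hs : ∀ y : K, risingProd y (N + 1) = risingProd y N * (y + N) :=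
        fun y => prod_range_succ _ _
      rw [hs, hs, hs]
      set z : K := x + N with hz
      have hz0 : 0 < z := by positivity
      have h1 : (x + 1 / 2 + N) ^ 2 * (1 + 1 / (3 * (x + (N + 1 : ℕ)))) ≤
          (1 + 1 / (3 * z)) * (z * (z + 1)) := by
        rw [show x + 1 / 2 + N = z + 1 / 2 by rw [hz]; ring,
          show x + ((N + 1 : ℕ) : K) = z + 1 by rw [hz]; push_cast; ring]
        have e1 : (z + 1 / 2) ^ 2 * (1 + 1 / (3 * (z + 1))) =
            (z + 1 / 2) ^ 2 * (3 * z + 4) / (3 * (z + 1)) := by field_simp; ring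
        have e2 : (1 + 1 / (3 * z)) * (z * (z + 1)) = (3 * z + 1) * (z + 1) / 3 := by field_simp
        rw [e1, e2, div_le_div_iff₀ (by positivity) (by positivity)]
        nlinarith [mul_pos hz0 hz0]
      have h2 : 0 ≤ risingProd (x + 1 / 2) N ^ 2 := sq_nonneg _
      have h3 : 0 ≤ z * (z + 1) := by positivity
      calc (risingProd (x + 1 / 2) N * (x + 1 / 2 + N)) ^ 2 * (1 + 1 / (3 * (x + (N + 1 : ℕ))))
          = risingProd (x + 1 / 2) N ^ 2 *
            ((x + 1 / 2 + N) ^ 2 * (1 + 1 / (3 * (x + (N + 1 : ℕ))))) := by ring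
        _ ≤ risingProd (x + 1 / 2) N ^ 2 * ((1 + 1 / (3 * z)) * (z * (z + 1))) := by gcongr
        _ = (risingProd (x + 1 / 2) N ^ 2 * (1 + 1 / (3 * z))) * (z * (z + 1)) := by ring
        _ ≤ ((1 + 1 / (3 * x)) * (risingProd x N * risingProd (x + 1) N)) * (z * (z + 1)) := by
          gcongr
        _ = _ := by rw [hz]; ring
  refine le_trans ?_ (key N)
  refine le_mul_of_one_le_right (sq_nonneg _) ?_
  have : 0 < 1 / (3 * (x + N)) := by positivity
  linarith

theorem risingProd_mul_le_half_sq {x : K} (hx : 0 < x) (N : ℕ) :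
    risingProd x N * risingProd (x + 1) N ≤ risingProd (x + 1 / 2) N ^ 2 := by
  rw [risingProd, risingProd, risingProd, ← prod_mul_distrib, ← prod_pow]
  refine prod_le_prod (fun i _ => by positivity) fun i _ => ?_
  nlinarith

theorem risingProd_half_sq_le_of_le {x y : K} (hy : 0 < y) (hxy : y ≤ x) {N : ℕ} :
    risingProd (x + 1 / 2) N ^ 2 ≤
      (1 + 1 / (3 * y)) * (risingProd x N * risingProd (x + 1) N) := by
  have hx := hy.trans_le hxy
  have h1 := risingProd_pos hx N
  have h2 := risingProd_pos (by linarith : 0 < x + 1) N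
  refine (risingProd_half_sq_le hx N).trans ?_
  gcongr

theorem intProd_half_sq_le {n : ℕ} (hn : 42 ≤ n) {t : K} (ht : 2 * n ≤ t) :
    intProd n (t + 1 / 2) ^ 2 ≤ 4 / 3 * (127 / 126) * (intProd n t * intProd n (t + 1)) := by
  have hn' : (42 : K) ≤ n := by exact_mod_cast hn
  have h1 := risingProd_half_sq_le_of_le (x := t - 2 * n + 1) (y := 1) one_pos (by linarith)
    (N := 2 * n - 1)
  have h2 := risingProd_half_sq_le_of_le (x := t + n + 1) (y := 42) (by norm_num) (by linarith)
    (N := 2 * n - 1)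
  have h3 := mul_le_mul h1 h2 (sq_nonneg _) (le_trans (sq_nonneg _) h1)
  simp only [intProd]
  rw [show t + 1 / 2 - 2 * (n : K) + 1 = t - 2 * n + 1 + 1 / 2 by ring,
    show t + 1 / 2 + (n : K) + 1 = t + n + 1 + 1 / 2 by ring,
    show t + 1 - 2 * (n : K) + 1 = t - 2 * n + 1 + 1 by ring,
    show t + 1 + (n : K) + 1 = t + n + 1 + 1 by ring, mul_pow]
  refine h3.trans (le_of_eq ?_)
  norm_num
  ring

theorem fracProd_half_sq_le {n : ℕ} (hn : 42 ≤ n) {t c : K} (ht : 2 * n ≤ t) (hc : 0 < c) :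
    fracProd n (t + 1 / 2) c ^ 2 ≤
      (1 + 1 / (3 * c)) * (127 / 126) ^ 2 * (fracProd n t c * fracProd n (t + 1) c) := by
  have hn' : (42 : K) ≤ n := by exact_mod_cast hn
  have h1 := risingProd_half_sq_le_of_le (x := t - 2 * n + c) hc (by linarith) (N := 2 * n)
  have h2 := risingProd_half_sq_le_of_le (x := t + c) (y := 42) (by norm_num) (by linarith)
    (N := n)
  have h3 := risingProd_half_sq_le_of_le (x := t + n + c) (y := 42) (by norm_num) (by linarith)
    (N := 2 * n)
  have h4 := mul_le_mul h1 h2 (sq_nonneg _) (le_trans (sq_nonneg _) h1)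
  have h5 := mul_le_mul h4 h3 (sq_nonneg _) (le_trans (by positivity) h4)
  simp only [fracProd]
  rw [show t + 1 / 2 - 2 * (n : K) + c = t - 2 * n + c + 1 / 2 by ring,
    show t + 1 / 2 + (n : K) + c = t + n + c + 1 / 2 by ring,
    show t + 1 / 2 + c = t + c + 1 / 2 by ring,
    show t + 1 - 2 * (n : K) + c = t - 2 * n + c + 1 by ring,
    show t + 1 + (n : K) + c = t + n + c + 1 by ring,
    show t + 1 + c = t + c + 1 by ring, mul_pow, mul_pow]
  refine h5.trans (le_of_eq ?_)
  norm_num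
  ring

end Positivity

theorem ratFun_pos {n : ℕ} (hn : Even n) (hn0 : 0 < n) {t : ℚ} (ht : 2 * n ≤ t) :
    0 < ratFun n t := by
  have hn' : (0 : ℚ) < n := by exact_mod_cast hn0
  have ht0 : 0 < t := by linarith
  have h1 := intProd_pos ht
  have h2 := fracProd_pos ht (by norm_num : (0 : ℚ) < 1 / 2)
  have h3 := fracProd_pos ht (by norm_num : (0 : ℚ) < 1 / 3)
  have h4 := fracProd_pos ht (by norm_num : (0 : ℚ) < 2 / 3)
  have h5 := risingProd_pos ht0 (n + 1)
  rw [ratFun_eq hn hn0]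
  positivity

theorem ratFun_half_le {n : ℕ} (hn : Even n) (hn0 : 42 ≤ n) {t : ℚ} (ht : 2 * n ≤ t) :
    ratFun n (t + 1 / 2) ≤ 3 / 2 * (ratFun n t + ratFun n (t + 1)) := by
  have hp : 0 < n := by omega
  have hn' : (0 : ℚ) < n := by exact_mod_cast hp
  have ht0 : 0 < t := by linarith
  have p0 := ratFun_pos hn hp ht
  have p1 := ratFun_pos hn hp (by linarith : 2 * n ≤ t + 1)
  have p2 := ratFun_pos hn hp (by linarith : 2 * n ≤ t + 1 / 2)
  suffices h : ratFun n (t + 1 / 2) ^ 2 ≤ 9 * (ratFun n t * ratFun n (t + 1)) by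
    refine abs_le_of_sq_le_sq' ?_ (by positivity) |>.2
    nlinarith [sq_nonneg (ratFun n t - ratFun n (t + 1))]
  have h1 := intProd_half_sq_le hn0 ht
  have h2 := fracProd_half_sq_le hn0 ht (by norm_num : (0 : ℚ) < 1 / 2)
  have h3 := fracProd_half_sq_le hn0 ht (by norm_num : (0 : ℚ) < 1 / 3)
  have h4 := fracProd_half_sq_le hn0 ht (by norm_num : (0 : ℚ) < 2 / 3)
  have h5 := risingProd_mul_le_half_sq ht0 (n + 1)
  have a1 := intProd_pos ht
  have a2 := fracProd_pos ht (by norm_num : (0 : ℚ) < 1 / 2)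
  have a3 := fracProd_pos ht (by norm_num : (0 : ℚ) < 1 / 3)
  have a4 := fracProd_pos ht (by norm_num : (0 : ℚ) < 2 / 3)
  have a5 := risingProd_pos ht0 (n + 1)
  have ht1 : 2 * n ≤ t + 1 := by linarith
  have b1 := intProd_pos ht1
  have b2 := fracProd_pos ht1 (by norm_num : (0 : ℚ) < 1 / 2)
  have b3 := fracProd_pos ht1 (by norm_num : (0 : ℚ) < 1 / 3)
  have b4 := fracProd_pos ht1 (by norm_num : (0 : ℚ) < 2 / 3)
  have b5 := risingProd_pos (by linarith : 0 < t + 1) (n + 1)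
  have m1 := mul_le_mul h1 (mul_le_mul (mul_le_mul h2 h3 (sq_nonneg _) (by positivity)) h4
    (sq_nonneg _) (by positivity)) (by positivity) (by positivity)
  rw [ratFun_eq hn hp, ratFun_eq hn hp, ratFun_eq hn hp]
  set c := (n.factorial ^ 58 * n ^ 2 * 108 ^ (5 * n) : ℚ) with hc
  have hc0 : 0 < c := by positivity
  rw [div_mul_div_comm, div_pow, ← mul_div_assoc, ← mul_pow, ← pow_mul, mul_comm 77 2, pow_mul]
  refine div_le_div₀ (by positivity) ?_ (by positivity) (pow_le_pow_left₀ (by positivity) h5 _)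
  set Z := intProd n t * intProd n (t + 1) * ((fracProd n t (1 / 2) * fracProd n (t + 1) (1 / 2)) *
    (fracProd n t (1 / 3) * fracProd n (t + 1) (1 / 3)) *
    (fracProd n t (2 / 3) * fracProd n (t + 1) (2 / 3))) with hZ
  have hZ0 : 0 < Z := by positivity
  have m2 : (intProd n (t + 1 / 2) * (fracProd n (t + 1 / 2) (1 / 2) *
      fracProd n (t + 1 / 2) (1 / 3) * fracProd n (t + 1 / 2) (2 / 3))) ^ 2 ≤ 9 * Z := by
    calc _ = intProd n (t + 1 / 2) ^ 2 * (fracProd n (t + 1 / 2) (1 / 2) ^ 2 *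
      fracProd n (t + 1 / 2) (1 / 3) ^ 2 * fracProd n (t + 1 / 2) (2 / 3) ^ 2) := by ring
      _ ≤ _ := m1
      _ = (20 / 3 * (127 / 126) ^ 7) * Z := by rw [hZ]; ring
      _ ≤ 9 * Z := by gcongr; norm_num
  calc _ = c ^ 2 * (intProd n (t + 1 / 2) * (fracProd n (t + 1 / 2) (1 / 2) *
      fracProd n (t + 1 / 2) (1 / 3) * fracProd n (t + 1 / 2) (2 / 3))) ^ 2 := by ring
    _ ≤ c ^ 2 * (9 * Z) := by gcongr
    _ = _ := by rw [hZ]; ring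

end Estimates

section UpperBound

open Finset

theorem prod_le_pow_card_of_sum_le {ι : Type*} (s : Finset ι) {x : ι → ℝ} {M : ℝ} (hM : 0 < M)
    (hx : ∀ i ∈ s, 0 ≤ x i) (hs : ∑ i ∈ s, x i ≤ #s * M) : ∏ i ∈ s, x i ≤ M ^ #s := by
  have h1 : ∏ i ∈ s, x i = M ^ #s * ∏ i ∈ s, (x i / M) := by
    rw [← prod_const, ← prod_mul_distrib]
    exact prod_congr rfl fun i _ => by field_simp
  have h2 : ∏ i ∈ s, (x i / M) ≤ ∏ i ∈ s, Real.exp (x i / M - 1) := by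
    refine prod_le_prod (fun i hi => div_nonneg (hx i hi) hM.le) fun i _ => ?_
    have := Real.add_one_le_exp (x i / M - 1)
    linarith
  have h3 : ∏ i ∈ s, Real.exp (x i / M - 1) ≤ 1 := by
    rw [← Real.exp_sum, Real.exp_le_one_iff, sum_sub_distrib, ← sum_div, sum_const, nsmul_one,
      sub_nonpos, div_le_iff₀ hM]
    exact hs
  rw [h1]
  exact mul_le_of_le_one_right (by positivity) (h2.trans h3)

theorem factorial_mul_pow_le {n : ℕ} (hn : 0 < n) :
    (n.factorial : ℝ) * (27 / 10) ^ n ≤ 27 / 10 * n ^ (n + 1) := by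
  induction n, hn using Nat.le_induction with
  | base => norm_num
  | succ n hn ih =>
    have hn' : (0 : ℝ) < n := by exact_mod_cast hn
    have h1 : 1 - 1 / ((n : ℝ) + 1) ≤ Real.exp (-(1 / (n + 1))) := by
      have := Real.add_one_le_exp (-(1 / ((n : ℝ) + 1)))
      linarith
    have h2 : (n / (n + 1) : ℝ) ^ (n + 1) ≤ Real.exp (-1) := by
      calc (n / (n + 1) : ℝ) ^ (n + 1) = (1 - 1 / ((n : ℝ) + 1)) ^ (n + 1) := by
            congr 1
            field_simp
            ring
        _ ≤ Real.exp (-(1 / (n + 1))) ^ (n + 1) := by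
          refine pow_le_pow_left₀ ?_ h1 _
          rw [sub_nonneg, div_le_one (by positivity)]
          linarith
        _ = Real.exp (-1) := by
          rw [← Real.exp_nat_mul]
          congr 1
          push_cast
          field_simp
    have h3 : Real.exp (-1) ≤ 10 / 27 := by
      rw [Real.exp_neg, inv_le_comm₀ (Real.exp_pos _) (by norm_num)]
      have := Real.exp_one_gt_d9
      norm_num at this ⊢
      linarith
    have h4 : 27 / 10 * (n : ℝ) ^ (n + 1) ≤ ((n : ℝ) + 1) ^ (n + 1) := by
      have := h2.trans h3
      rw [div_pow, div_le_iff₀ (by positivity)] at this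
      linarith
    rw [Nat.factorial_succ]
    push_cast
    calc ((n : ℝ) + 1) * n.factorial * (27 / 10) ^ (n + 1)
        = ((n : ℝ) + 1) * (27 / 10) * (n.factorial * (27 / 10) ^ n) := by ring
      _ ≤ ((n : ℝ) + 1) * (27 / 10) * (27 / 10 * n ^ (n + 1)) := by gcongr
      _ ≤ ((n : ℝ) + 1) * (27 / 10) * ((n : ℝ) + 1) ^ (n + 1) := by gcongr
      _ = _ := by ring

theorem ratFun_cast_eq {n : ℕ} (hn : Even n) (hn0 : 0 < n) (t : ℚ) : (ratFun n t : ℝ) =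
    n.factorial ^ 58 * n ^ 2 * 108 ^ (5 * n) * (intProd n (t : ℝ) *
      (fracProd n (t : ℝ) (1 / 2) * fracProd n (t : ℝ) (1 / 3) * fracProd n (t : ℝ) (2 / 3))) /
        risingProd (t : ℝ) (n + 1) ^ 77 := by
  rw [ratFun_eq hn hn0]
  simp only [intProd, fracProd]
  push_cast [Rat.cast_risingProd]
  rfl

variable {n : ℕ} {t : ℝ}

theorem risingProd_reflect (x : ℝ) (N : ℕ) :
    risingProd x N = ∏ i ∈ range N, (x + N - 1 - i) := by
  rw [risingProd, ← prod_range_reflect]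
  refine prod_congr rfl fun i hi => ?_
  have hi' := mem_range.1 hi
  rw [Nat.cast_sub (by omega), Nat.cast_sub (by omega)]
  push_cast
  ring

theorem risingProd_outer_le (ht : 2 * n ≤ t) {c d : ℝ} (hc : 0 ≤ c) (hd : 0 ≤ d)
    (hcd : c + d = 1) : risingProd (t - 2 * n + c) (2 * n) * risingProd (t + n + d) (2 * n) ≤
      ∏ i ∈ range (2 * n), ((t - i) * (t + n + i)) := by
  have hn : (0 : ℝ) ≤ n := by positivity
  rw [risingProd_reflect, risingProd, ← prod_mul_distrib]
  have key : ∀ i ∈ range (2 * n), (i : ℝ) + 1 ≤ 2 * n := fun i hi => by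
    exact_mod_cast mem_range.1 hi
  refine prod_le_prod (fun i hi => ?_) fun i hi => ?_ <;>
    have hi' := key i hi <;> have hi0 : (0 : ℝ) ≤ i := by positivity
  · refine mul_nonneg ?_ (by linarith)
    push_cast
    linarith
  · obtain rfl : c = 1 - d := by linarith
    push_cast
    nlinarith [mul_nonneg hd hi0, mul_nonneg hd hn, mul_nonneg hd hd]

theorem mul_intProd_le (hn : 0 < n) (ht : 2 * n ≤ t) : t * (t + n) * intProd n t ≤
    ∏ i ∈ range (2 * n), ((t - i) * (t + n + i)) := by
  refine le_trans (le_of_eq ?_) (risingProd_outer_le ht zero_le_one le_rfl (add_zero 1))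
  obtain ⟨N, hN⟩ : ∃ N, 2 * n = N + 1 := ⟨2 * n - 1, by omega⟩
  have hN' : (2 * n : ℝ) = N + 1 := by exact_mod_cast hN
  have e1 : risingProd (t - 2 * n + 1) (2 * n) = risingProd (t - 2 * n + 1) N * t := by
    rw [hN, risingProd_add, risingProd, risingProd]
    simp only [range_one, prod_singleton, Nat.cast_zero, add_zero, hN']
    congr 1
    ring
  have e2 : risingProd (t + n + 0) (2 * n) = (t + n) * risingProd (t + n + 1) N := by
    rw [hN, add_comm N 1, risingProd_add]
    simp [risingProd]
  rw [e1, e2, intProd, hN, Nat.add_sub_cancel]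
  ring

theorem prod_outer_le (hn : 60 ≤ n) (ht : 2 * n ≤ t) :
    ∏ i ∈ range (2 * n), ((t - i) * (t + n + i)) ≤
      ((t * (t + n) - 4 / 5 * n ^ 2) * (t * (t + n) - 19 / 5 * n ^ 2)) ^ n := by
  have hn' : (60 : ℝ) ≤ n := by exact_mod_cast hn
  have hY : 6 * (n : ℝ) ^ 2 ≤ t * (t + n) := by nlinarith
  have hn2 : 0 < (n : ℝ) ^ 2 := by positivity
  have sum_eq : ∀ a : ℝ, ∀ N : ℕ, ∑ i ∈ range N, (t - (a + i)) * (t + n + (a + i)) =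
      N * (t * (t + n)) - N * (a * (n + a)) - (n + 2 * a) * (N * (N - 1) / 2) -
        N * (N - 1) * (2 * N - 1) / 6 := by
    intro a N
    induction N with
    | zero => simp
    | succ N ih => rw [sum_range_succ, ih]; push_cast; ring
  have key : ∀ i ∈ range n, (i : ℝ) + 1 ≤ n := fun i hi => by
    exact_mod_cast mem_range.1 hi
  have nonneg : ∀ a : ℝ, 0 ≤ a → a ≤ n → ∀ i ∈ range n,
      0 ≤ (t - (a + i)) * (t + n + (a + i)) := fun a ha han i hi => by
    have := key i hi
    have : (0 : ℝ) ≤ i := by positivity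
    exact mul_nonneg (by linarith) (by linarith)
  have h1 : ∏ i ∈ range n, ((t - i) * (t + n + i)) ≤ (t * (t + n) - 4 / 5 * n ^ 2) ^ n := by
    have := prod_le_pow_card_of_sum_le (range n) (M := t * (t + n) - 4 / 5 * n ^ 2) (by linarith)
      (nonneg 0 le_rfl (by linarith)) (by
        rw [sum_eq, card_range]
        nlinarith [mul_nonneg (by linarith : (0 : ℝ) ≤ n) (by linarith : (0 : ℝ) ≤ n - 60)])
    simpa using this
  have h2 : ∏ i ∈ range n, ((t - (n + i)) * (t + n + (n + i))) ≤
      (t * (t + n) - 19 / 5 * n ^ 2) ^ n := by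
    have := prod_le_pow_card_of_sum_le (range n) (M := t * (t + n) - 19 / 5 * n ^ 2) (by linarith)
      (nonneg n (by linarith) le_rfl) (by
        rw [sum_eq, card_range]
        nlinarith [mul_nonneg (by linarith : (0 : ℝ) ≤ n) (mul_nonneg (by linarith : (0 : ℝ) ≤ n)
          (by linarith : (0 : ℝ) ≤ n - 60))])
    simpa using this
  rw [two_mul, prod_range_add, mul_pow]
  push_cast
  exact mul_le_mul h1 h2 (prod_nonneg (nonneg n (by linarith) le_rfl)) (pow_nonneg (by linarith) _)

theorem risingProd_inner_le (ht : 0 < t) {c d : ℝ} (hc : 0 ≤ c) (hd : 0 ≤ d) (hcd : c + d = 1) :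
    risingProd (t + c) n * risingProd (t + d) n ≤ ((t + n / 2) ^ 2) ^ n := by
  have key : ∀ i ∈ range n, (i : ℝ) + 1 ≤ n := fun i hi => by
    exact_mod_cast mem_range.1 hi
  rw [mul_comm, risingProd_reflect, risingProd, ← prod_mul_distrib]
  calc _ ≤ ∏ _i ∈ range n, (t + (n : ℝ) / 2) ^ 2 := by
        refine prod_le_prod (fun i hi => ?_) fun i hi => ?_
        · have := key i hi
          have : (0 : ℝ) ≤ i := by positivity
          exact mul_nonneg (by linarith) (by linarith)
        · obtain rfl : c = 1 - d := by linarith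
          nlinarith [sq_nonneg ((n : ℝ) / 2 - i - (1 - d))]
    _ = _ := by rw [prod_const, card_range]

theorem mul_pow_le_risingProd (ht : 0 < t) (h : ℕ) :
    t * (t * (t + (2 * h : ℕ))) ^ h ≤ risingProd t (2 * h + 1) := by
  refine (abs_le_of_sq_le_sq' ?_ (risingProd_pos ht _).le).2
  have key : ∀ i ∈ range (2 * h + 1), (i : ℝ) ≤ (2 * h : ℕ) := fun i hi => by
    exact_mod_cast Nat.lt_succ_iff.1 (mem_range.1 hi)
  have h1 : (t * (t + (2 * h : ℕ))) ^ (2 * h + 1) ≤ risingProd t (2 * h + 1) ^ 2 := by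
    rw [sq]
    nth_rw 2 [risingProd_reflect]
    rw [risingProd, ← prod_mul_distrib, ← card_range (2 * h + 1), ← prod_const, card_range]
    refine prod_le_prod (fun i _ => by positivity) fun i hi => ?_
    have := key i hi
    have : (0 : ℝ) ≤ i := by positivity
    push_cast at *
    nlinarith
  refine le_trans ?_ h1
  have h2 : t ^ 2 ≤ t * (t + (2 * h : ℕ)) := by
    have : (0 : ℝ) ≤ (2 * h : ℕ) := by positivity
    nlinarith
  calc (t * (t * (t + (2 * h : ℕ))) ^ h) ^ 2 = (t * (t + (2 * h : ℕ))) ^ (2 * h) * t ^ 2 := by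
        rw [mul_pow, ← pow_mul, mul_comm h 2, mul_comm]
    _ ≤ (t * (t + (2 * h : ℕ))) ^ (2 * h) * (t * (t + (2 * h : ℕ))) := by gcongr
    _ = _ := (pow_succ _ _).symm

theorem prod_inner_le (ht : 0 < t) (h : ℕ) :
    risingProd (t + 1 / 2) (2 * h) * (risingProd (t + 1 / 3) (2 * h) *
      risingProd (t + 2 / 3) (2 * h)) ≤ ((t + h) ^ 2) ^ (3 * h) := by
  have h1 := risingProd_inner_le (n := 2 * h) ht (c := 1 / 2) (d := 1 / 2) (by norm_num)
    (by norm_num) (by norm_num)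
  have h2 := risingProd_inner_le (n := 2 * h) ht (c := 1 / 3) (d := 2 / 3) (by norm_num)
    (by norm_num) (by norm_num)
  have p1 := risingProd_pos (by linarith : 0 < t + 1 / 3) (2 * h)
  have p2 := risingProd_pos (by linarith : 0 < t + 2 / 3) (2 * h)
  push_cast at h1 h2
  rw [mul_div_cancel_left₀ _ (two_ne_zero)] at h1 h2
  have h3 : risingProd (t + 1 / 2) (2 * h) ≤ ((t + h) ^ 2) ^ h := by
    refine (abs_le_of_sq_le_sq' ?_ (by positivity)).2
    rw [sq, ← pow_mul _ h, mul_comm h 2]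
    exact h1
  refine (mul_le_mul h3 h2 (by positivity) (by positivity)).trans_eq ?_
  rw [← pow_add]
  congr 1
  ring

theorem fracProd_prod_le {h : ℕ} (hn : 60 ≤ 2 * h) (ht : 2 * (2 * h : ℕ) ≤ t) :
    fracProd (2 * h) t (1 / 2) * fracProd (2 * h) t (1 / 3) * fracProd (2 * h) t (2 / 3) ≤
      (∏ i ∈ range (2 * (2 * h)), ((t - i) * (t + (2 * h : ℕ) + i))) ^ 3 *
        ((t + h) ^ 2) ^ (3 * h) := by
  set n := 2 * h with hnh
  have hn' : (60 : ℝ) ≤ n := by exact_mod_cast hn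
  have o1 := risingProd_outer_le ht (c := 1 / 2) (d := 1 / 2) (by norm_num) (by norm_num)
    (by norm_num)
  have o2 := risingProd_outer_le ht (c := 1 / 3) (d := 2 / 3) (by norm_num) (by norm_num)
    (by norm_num)
  have o3 := risingProd_outer_le ht (c := 2 / 3) (d := 1 / 3) (by norm_num) (by norm_num)
    (by norm_num)
  have i1 := prod_inner_le (by linarith : 0 < t) h
  rw [← hnh] at i1
  set U := ∏ i ∈ range (2 * n), ((t - i) * (t + n + i))
  have p : ∀ c : ℝ, 0 < c → 0 < risingProd (t - 2 * n + c) (2 * n) ∧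
      0 < risingProd (t + c) n ∧ 0 < risingProd (t + n + c) (2 * n) := fun c hc =>
    ⟨risingProd_pos (by linarith) _, risingProd_pos (by linarith) _,
      risingProd_pos (by linarith) _⟩
  obtain ⟨a1, a2, a3⟩ := p (1 / 2) (by norm_num)
  obtain ⟨b1, b2, b3⟩ := p (1 / 3) (by norm_num)
  obtain ⟨c1, c2, c3⟩ := p (2 / 3) (by norm_num)
  have hU : 0 ≤ U := le_trans (by positivity) o1
  have m := mul_le_mul (mul_le_mul o1 (mul_le_mul o2 o3 (by positivity) hU) (by positivity) hU) i1
    (by positivity) (by positivity)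
  simp only [fracProd]
  refine le_trans (le_of_eq ?_) (m.trans (le_of_eq ?_)) <;> ring

theorem normalized_bound {z : ℝ} (hz : 1 ≤ z) :
    ((6 * z - 4 / 5) * (6 * z - 19 / 5)) ^ 8 * (6 * z + 1 / 4) ^ 3 ≤
      (286 / 25) ^ 8 * (25 / 4) ^ 3 / 6 ^ 77 * (6 * z) ^ 77 := by
  have h1 : 6 * z - 4 / 5 ≤ 26 / 5 * z ^ 2 := by nlinarith
  have h2 : 6 * z - 19 / 5 ≤ 11 / 5 * z ^ 3 := by
    nlinarith [mul_nonneg (sub_nonneg.2 hz) (sq_nonneg (z - 1)), sq_nonneg (z - 1)]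
  have h3 : 6 * z + 1 / 4 ≤ 25 / 4 * z := by linarith
  have n1 : 0 ≤ 6 * z - 4 / 5 := by linarith
  have n2 : 0 ≤ 6 * z - 19 / 5 := by linarith
  calc _ ≤ (26 / 5 * z ^ 2 * (11 / 5 * z ^ 3)) ^ 8 * (25 / 4 * z) ^ 3 := by gcongr
    _ = (286 / 25) ^ 8 * (25 / 4) ^ 3 * z ^ 43 := by ring
    _ ≤ (286 / 25) ^ 8 * (25 / 4) ^ 3 * z ^ 77 := by
      gcongr
      norm_num
    _ = _ := by ring

/-- The geometric rate in the upper bound for the rational function. -/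
noncomputable def ratFunRate : ℝ :=
  108 ^ 10 * ((286 / 25) ^ 8 * (25 / 4) ^ 3 / 6 ^ 77) / (27 / 10) ^ 116

theorem ratFun_cast_le {h : ℕ} (hn : 60 ≤ 2 * h) {t : ℚ} (ht : 2 * (2 * h : ℕ) ≤ t) :
    (ratFun (2 * h) t : ℝ) ≤
      (27 / 10) ^ 58 * (2 * h : ℕ) ^ 60 * ratFunRate ^ h / ((t : ℝ) + 1) ^ 2 := by
  have hn0 : 0 < 2 * h := by omega
  rw [ratFun_cast_eq (even_two_mul h) hn0]
  have htR : 2 * ((2 * h : ℕ) : ℝ) ≤ (t : ℝ) := by exact_mod_cast ht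
  generalize (t : ℝ) = t at htR
  have hn' : (60 : ℝ) ≤ (2 * h : ℕ) := by exact_mod_cast hn
  have ht0 : 1 < t := by linarith
  set Y := t * (t + (2 * h : ℕ)) with hY
  have hY6 : 6 * ((2 * h : ℕ) : ℝ) ^ 2 ≤ Y := by nlinarith
  have hY1 : (t + 1) ^ 2 ≤ Y := by nlinarith
  have hY0 : 0 < Y := by positivity
  have hYh : (t + h) ^ 2 = Y + 1 / 4 * ((2 * h : ℕ) : ℝ) ^ 2 := by rw [hY]; push_cast; ring
  have b1 := mul_intProd_le hn0 htR
  have b2 := prod_outer_le hn htR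
  have b3 := fracProd_prod_le hn htR
  have b4 := mul_pow_le_risingProd (zero_lt_one.trans ht0) h
  have b5 := factorial_mul_pow_le hn0
  have q1 := intProd_pos htR
  have q2 := fracProd_pos htR (by norm_num : (0 : ℝ) < 1 / 2)
  have q3 := fracProd_pos htR (by norm_num : (0 : ℝ) < 1 / 3)
  have q4 := fracProd_pos htR (by norm_num : (0 : ℝ) < 2 / 3)
  rw [← hY] at b1 b2 b4
  rw [hYh] at b3
  set U := ∏ i ∈ range (2 * (2 * h)), ((t - i) * (t + (2 * h : ℕ) + i))
  set F := fracProd (2 * h) t (1 / 2) * fracProd (2 * h) t (1 / 3) * fracProd (2 * h) t (2 / 3)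
  set D := risingProd t (2 * h + 1)
  have hU0 : 0 ≤ U := le_trans (by positivity) b1
  have hF0 : 0 < F := by positivity
  set ν : ℝ := ((2 * h : ℕ) : ℝ) with hν
  have hν0 : 0 < ν := by linarith
  set A := (Y - 4 / 5 * ν ^ 2) * (Y - 19 / 5 * ν ^ 2) with hA
  have hA0 : 0 ≤ A := by
    refine mul_nonneg ?_ ?_ <;> nlinarith
  set κ : ℝ := (286 / 25) ^ 8 * (25 / 4) ^ 3 / 6 ^ 77 with hκ
  have hκ0 : 0 < κ := by positivity
  have c1 : A ^ 8 * (Y + 1 / 4 * ν ^ 2) ^ 3 ≤ κ * Y ^ 77 / ν ^ 116 := by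
    have := normalized_bound (z := Y / (6 * ν ^ 2)) (by
      rw [le_div_iff₀ (by positivity)]; linarith)
    rw [show 6 * (Y / (6 * ν ^ 2)) = Y / ν ^ 2 by field_simp] at this
    calc A ^ 8 * (Y + 1 / 4 * ν ^ 2) ^ 3 = ν ^ 38 * (((Y / ν ^ 2 - 4 / 5) *
          (Y / ν ^ 2 - 19 / 5)) ^ 8 * (Y / ν ^ 2 + 1 / 4) ^ 3) := by
          rw [hA]; field_simp
      _ ≤ ν ^ 38 * (κ * (Y / ν ^ 2) ^ 77) := by gcongr
      _ = _ := by field_simp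
  clear_value A κ
  have c2 : intProd (2 * h) t * F ≤ (κ * Y ^ 77 / ν ^ 116) ^ h / Y := by
    rw [le_div_iff₀ hY0]
    calc intProd (2 * h) t * F * Y = (Y * intProd (2 * h) t) * F := by ring
      _ ≤ U * (U ^ 3 * (Y + 1 / 4 * ν ^ 2) ^ (3 * h)) := by gcongr
      _ = U ^ 4 * (Y + 1 / 4 * ν ^ 2) ^ (3 * h) := by ring
      _ ≤ (A ^ (2 * h)) ^ 4 * (Y + 1 / 4 * ν ^ 2) ^ (3 * h) := by gcongr
      _ = (A ^ 8 * (Y + 1 / 4 * ν ^ 2) ^ 3) ^ h := by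
        rw [mul_pow, ← pow_mul, ← pow_mul, ← pow_mul]
        congr 2
        ring
      _ ≤ _ := by gcongr
  have c3 : ((2 * h).factorial : ℝ) ^ 58 ≤
      (27 / 10) ^ 58 * ν ^ 58 * (ν ^ 116 / (27 / 10) ^ 116) ^ h := by
    have : ((2 * h).factorial : ℝ) ≤ 27 / 10 * ν ^ (2 * h + 1) / (27 / 10) ^ (2 * h) := by
      rw [le_div_iff₀ (by positivity)]
      exact b5
    refine (pow_le_pow_left₀ (by positivity) this 58).trans_eq ?_
    generalize (27 / 10 : ℝ) = e
    rw [div_pow, div_pow, mul_pow, ← pow_mul, ← pow_mul, ← pow_mul, ← pow_mul, ← mul_div_assoc,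
      show (2 * h + 1) * 58 = 58 + 116 * h by ring, show 2 * h * 58 = 116 * h by ring, pow_add,
      mul_assoc]
  have c4 : t ^ 77 * (Y ^ 77) ^ h ≤ D ^ 77 := by
    rw [← pow_mul, mul_comm 77 h, pow_mul, ← mul_pow]
    exact pow_le_pow_left₀ (by positivity) b4 _
  have hD0 : 0 < D ^ 77 := lt_of_lt_of_le (by positivity) c4
  have c5 : (1 : ℝ) ≤ t ^ 77 := one_le_pow₀ ht0.le
  calc _ ≤ ((27 / 10) ^ 58 * ν ^ 58 * (ν ^ 116 / (27 / 10) ^ 116) ^ h) * ν ^ 2 *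
        108 ^ (5 * (2 * h)) * ((κ * Y ^ 77 / ν ^ 116) ^ h / Y) / (t ^ 77 * (Y ^ 77) ^ h) := by
        gcongr
    _ = (27 / 10) ^ 58 * ν ^ 60 * ratFunRate ^ h / (Y * t ^ 77) := by
      rw [show 5 * (2 * h) = 10 * h by ring, pow_mul, ratFunRate, ← hκ]
      have e0 : (27 / 10 : ℝ) ≠ 0 := by norm_num
      generalize (27 / 10 : ℝ) = e at e0
      generalize (108 : ℝ) ^ 10 = g
      have : (g * κ / e ^ 116) ^ h =
          (ν ^ 116 / e ^ 116) ^ h * g ^ h * (κ * Y ^ 77 / ν ^ 116) ^ h / (Y ^ 77) ^ h := by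
        rw [← mul_pow, ← mul_pow, ← div_pow]
        congr 1
        field_simp
      rw [this]
      field_simp
    _ ≤ _ := by
      have : 0 ≤ ratFunRate := by rw [ratFunRate]; positivity
      refine div_le_div_of_nonneg_left (mul_nonneg ?_ (pow_nonneg this h)) (by positivity)
        (hY1.trans (le_mul_of_one_le_right hY0.le c5))
      clear this
      positivity

end UpperBound

section Positivity

open Finset Filter Topology

variable {n : ℕ}

theorem ratFun_zero (n : ℕ) : ratFun n 0 = 0 := by
  rw [ratFun, prod_eq_zero (mem_range.2 n.succ_pos) (by simp), div_zero]

theorem ratFun_natCast_nonneg (hn : Even n) (hn0 : 0 < n) (m : ℕ) : 0 ≤ ratFun n m := by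
  rcases m.eq_zero_or_pos with rfl | hm
  · simp [ratFun_zero]
  rcases lt_or_ge m (2 * n) with h | h
  · rw [ratFun_natCast_eq_zero hm h]
  · exact (ratFun_pos hn hn0 (by exact_mod_cast h)).le

theorem ratFun_natCast_add_eq_zero {c : ℚ} (hc : c ∈ fracParts) {m : ℕ} (h : m < 2 * n) :
    ratFun n (m + c) = 0 := by
  have := ratFun_frac_eq_zero hc (n := n) (j := m) (by omega) (by omega)
  simpa using this

theorem ratFun_natCast_add_nonneg (hn : Even n) (hn0 : 0 < n) {c : ℚ} (hc : c ∈ fracParts)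
    (m : ℕ) : 0 ≤ ratFun n (m + c) := by
  rcases lt_or_ge m (2 * n) with h | h
  · rw [ratFun_natCast_add_eq_zero hc h]
  · have h' : (2 * n : ℚ) ≤ m := by exact_mod_cast h
    have := pos_of_mem_fracParts hc
    exact (ratFun_pos hn hn0 (by linarith)).le

theorem sum_ratFun_half_le (hn : Even n) (hn0 : 42 ≤ n) (M : ℕ) :
    ∑ m ∈ range M, ratFun n (m + 1 / 2) + 3 / 2 * ratFun n M ≤
      3 * ∑ m ∈ range M, ratFun n (m + 1) := by
  induction M with
  | zero => simp [ratFun_zero]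
  | succ M ih =>
    have h : ratFun n (M + 1 / 2) ≤ 3 / 2 * (ratFun n M + ratFun n (M + 1)) := by
      rcases lt_or_ge M (2 * n) with h | h
      · have h1 := ratFun_natCast_nonneg hn (by omega) M
        have h2 := ratFun_natCast_nonneg hn (by omega) (M + 1)
        push_cast at h2
        rw [ratFun_natCast_add_eq_zero (by simp [fracParts]) h]
        positivity
      · exact ratFun_half_le hn hn0 (by exact_mod_cast h)
    rw [sum_range_succ, sum_range_succ]
    push_cast
    linarith

variable {w : ℤ × ℤ × ℤ}

theorem le_sum_weightedTerm (hn : Even n) (hn0 : 42 ≤ n) (hw₁ : w.2.1 ≤ 0)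
    (hw₀ : 0 ≤ w.1 + 3 * w.2.1) (hw₂ : 0 ≤ w.2.2) {M : ℕ} (hM : 2 * n < M) :
    w.2.2 * ratFun n ((2 * n : ℕ) + 1 / 3) ≤ ∑ m ∈ range M, weightedTerm n w m := by
  have hp : 0 < n := by omega
  have w₁ : (w.2.1 : ℚ) ≤ 0 := by exact_mod_cast hw₁
  have w₀ : (0 : ℚ) ≤ w.1 + 3 * w.2.1 := by exact_mod_cast hw₀
  have w₂ : (0 : ℚ) ≤ w.2.2 := by exact_mod_cast hw₂
  have h1 := sum_ratFun_half_le hn hn0 M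
  have h2 := ratFun_natCast_nonneg hn hp M
  have h3 : 0 ≤ ∑ m ∈ range M, ratFun n (m + 1) := sum_nonneg fun m _ => by
    simpa using ratFun_natCast_nonneg hn hp (m + 1)
  have h4 : ratFun n ((2 * n : ℕ) + 1 / 3) ≤ ∑ m ∈ range M, ratFun n (m + 1 / 3) :=
    single_le_sum (f := fun m : ℕ => ratFun n (m + 1 / 3))
      (fun m _ => ratFun_natCast_add_nonneg hn hp (by simp [fracParts]) m) (mem_range.2 hM)
  have h5 : 0 ≤ ∑ m ∈ range M, ratFun n (m + 2 / 3) := sum_nonneg fun m _ =>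
    ratFun_natCast_add_nonneg hn hp (by simp [fracParts]) m
  simp only [weightedTerm, sum_add_distrib, ← mul_sum]
  nlinarith [mul_nonneg w₀ h3, mul_nonneg w₂ h5, mul_le_mul_of_nonneg_left h4 w₂,
    mul_nonneg (neg_nonneg.2 w₁) (by linarith : 0 ≤ 3 * ∑ m ∈ range M, ratFun n (m + 1) -
      ∑ m ∈ range M, ratFun n (m + 1 / 2))]

theorem weightedTerm_le {h : ℕ} (hn : 60 ≤ 2 * h) (hw₀ : 0 ≤ w.1) (hw₁ : w.2.1 ≤ 0)
    (hw₂ : 0 ≤ w.2.2) (m : ℕ) : (weightedTerm (2 * h) w m : ℝ) ≤ (w.1 + 2 * w.2.2) *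
      ((27 / 10) ^ 58 * (2 * h : ℕ) ^ 60 * ratFunRate ^ h) * (1 / ((m : ℝ) + 1) ^ 2) := by
  have he := even_two_mul h
  have hp : 0 < 2 * h := by omega
  have w₀ : (0 : ℝ) ≤ w.1 := by exact_mod_cast hw₀
  have w₁ : (w.2.1 : ℝ) ≤ 0 := by exact_mod_cast hw₁
  have w₂ : (0 : ℝ) ≤ w.2.2 := by exact_mod_cast hw₂
  have hρ : 0 < ratFunRate := by rw [ratFunRate]; positivity
  set C : ℝ := (27 / 10) ^ 58 * (2 * h : ℕ) ^ 60 * ratFunRate ^ h with hC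
  have hC0 : 0 ≤ C := mul_nonneg (by positivity) (pow_nonneg hρ.le _)
  have bound : ∀ c : ℚ, 0 ≤ c → 2 * (2 * h : ℕ) ≤ m + c →
      (ratFun (2 * h) (m + c) : ℝ) ≤ C / ((m : ℝ) + 1) ^ 2 := fun c hc ht => by
    refine (ratFun_cast_le hn ht).trans ?_
    have : (0 : ℝ) ≤ c := by exact_mod_cast hc
    refine div_le_div_of_nonneg_left hC0 (by positivity) ?_
    push_cast
    gcongr
    linarith
  have frac : ∀ c ∈ fracParts, (ratFun (2 * h) (m + c) : ℝ) ≤ C / ((m : ℝ) + 1) ^ 2 := by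
    intro c hc
    rcases lt_or_ge m (2 * (2 * h)) with hm | hm
    · rw [ratFun_natCast_add_eq_zero hc hm, Rat.cast_zero]
      exact div_nonneg hC0 (by positivity)
    · have hm' : (2 * (2 * h : ℕ) : ℚ) ≤ m := by exact_mod_cast hm
      have := pos_of_mem_fracParts hc
      exact bound c this.le (by linarith)
  have int : (ratFun (2 * h) (m + 1) : ℝ) ≤ C / ((m : ℝ) + 1) ^ 2 := by
    rcases lt_or_ge (m + 1) (2 * (2 * h)) with hm | hm
    · have := ratFun_natCast_eq_zero m.succ_pos hm
      push_cast at this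
      rw [this, Rat.cast_zero]
      exact div_nonneg hC0 (by positivity)
    · exact bound 1 zero_le_one (by exact_mod_cast hm)
  have half : (0 : ℝ) ≤ (ratFun (2 * h) (m + 1 / 2) : ℝ) := by
    exact_mod_cast ratFun_natCast_add_nonneg he hp (by simp [fracParts]) m
  have f1 := frac (1 / 3) (by simp [fracParts])
  have f2 := frac (2 / 3) (by simp [fracParts])
  rw [weightedTerm]
  push_cast at *
  rw [mul_assoc, mul_one_div]
  nlinarith [mul_le_mul_of_nonneg_left int w₀, mul_le_mul_of_nonneg_left f1 w₂,
    mul_le_mul_of_nonneg_left f2 w₂, mul_nonneg (neg_nonneg.2 w₁) half]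

end Positivity

section Conclusion

open Finset Filter Topology

/-- The weights of the four residue classes eliminating `ζ(3)` and `ζ(i)`. -/
def elimWeight (i : ℕ) : ℤ × ℤ × ℤ :=
  (7 * (3 ^ i - 1) - 26 * (2 ^ i - 1), -(3 ^ i - 27), 2 ^ i - 8)

theorem zetaWeight_elimWeight_three (i : ℕ) : zetaWeight (elimWeight i) 3 = 0 := by
  simp only [zetaWeight, elimWeight]
  ring

theorem zetaWeight_elimWeight_self (i : ℕ) : zetaWeight (elimWeight i) i = 0 := by
  simp only [zetaWeight, elimWeight]
  ring

theorem elimWeight_bounds {i : ℕ} (hi : 5 ≤ i) : 0 ≤ (elimWeight i).1 ∧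
    (elimWeight i).2.1 ≤ 0 ∧ 0 ≤ (elimWeight i).1 + 3 * (elimWeight i).2.1 ∧
    0 < (elimWeight i).2.2 := by
  obtain ⟨k, rfl⟩ := Nat.exists_eq_add_of_le hi
  have h1 : (1 : ℤ) ≤ 2 ^ k := one_le_pow₀ (by norm_num)
  have h2 : (2 : ℤ) ^ k ≤ 3 ^ k := pow_le_pow_left₀ (by norm_num) (by norm_num) _
  simp only [elimWeight, pow_add]
  refine ⟨?_, ?_, ?_, ?_⟩ <;> linarith

theorem exists_common_denominator : ∃ f : ℕ → ℕ, (∀ i, 0 < f i) ∧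
    ∀ i, ¬ Irrational (zetaVal i) → ∃ z : ℤ, (f i : ℝ) * zetaVal i = z := by
  have h : ∀ i, ∃ d : ℕ, 0 < d ∧
      (¬ Irrational (zetaVal i) → ∃ z : ℤ, (d : ℝ) * zetaVal i = z) := by
    intro i
    by_cases hi : Irrational (zetaVal i)
    · exact ⟨1, one_pos, fun h => absurd hi h⟩
    · obtain ⟨r, hr⟩ := not_not.1 hi
      refine ⟨r.den, r.den_pos, fun _ => ⟨r.num, ?_⟩⟩
      rw [← hr]
      exact_mod_cast r.den_mul_eq_num
  choose f hf using h
  exact ⟨f, fun i => (hf i).1, fun i => (hf i).2⟩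

theorem ratFunRate_lt : (31 / 10 : ℝ) ^ 154 * ratFunRate < 1 := by
  rw [ratFunRate]
  norm_num

theorem not_forall_mul_zetaVal_mem_int {i₀ q : ℕ} (hi₀ : 5 ≤ i₀) (hq0 : 0 < q) :
    ¬ ∀ i, Odd i → 5 ≤ i → i ≤ 77 → i ≠ i₀ → ∃ z : ℤ, (q : ℝ) * zetaVal i = z := by
  intro hq
  obtain ⟨hw₀, hw₁, hw, hw₂⟩ := elimWeight_bounds hi₀
  have hS : Summable fun m : ℕ => 1 / ((m : ℝ) + 1) ^ 2 := by
    have := (summable_nat_add_iff 1).2 (Real.summable_one_div_nat_pow.2 one_lt_two)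
    simpa using this
  set S : ℝ := ∑' m : ℕ, 1 / ((m : ℝ) + 1) ^ 2 with hSdef
  set W : ℝ := (elimWeight i₀).1 + 2 * (elimWeight i₀).2.2 with hW
  have hρ : 0 < ratFunRate := by rw [ratFunRate]; positivity
  have hσ : 0 < (31 / 10 : ℝ) ^ 154 * ratFunRate := mul_pos (by positivity) hρ
  have hlim := (tendsto_pow_const_mul_const_pow_of_abs_lt_one 60
    (by rw [abs_of_pos hσ]; exact ratFunRate_lt)).const_mul
      (2 * q * W * S * (27 / 10) ^ 58 * 2 ^ 60)
  rw [mul_zero] at hlim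
  obtain ⟨H, hH⟩ := eventually_atTop.1 (hlim.eventually_lt_const one_pos)
  set h := 21 * 42 ^ (H + 1) with hh
  have hpow : H + 1 < 42 ^ (H + 1) := Nat.lt_pow_self (by norm_num)
  have hpow' : 42 ≤ 42 ^ (H + 1) := Nat.le_self_pow (by omega) 42
  have hn : 2 * h = 42 ^ (H + 2) := by rw [hh]; ring
  have hsmall := hH h (by omega)
  have hn60 : 60 ≤ 2 * h := by omega
  obtain ⟨L, hL, z, hz⟩ := exists_tendsto_sum_weightedTerm (even_two_mul h) (by omega)
    (zetaWeight_elimWeight_three i₀) (zetaWeight_elimWeight_self i₀) hq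
  have hd := lcmUpto_pow_le (H + 2)
  rw [← hn] at hd
  have hd0 : (0 : ℝ) < (2 * h).lcmUpto := by exact_mod_cast Nat.lcmUpto_pos _
  have hL0 : 0 < L := by
    have h1 : 0 < (elimWeight i₀).2.2 * ratFun (2 * h) ((2 * (2 * h) : ℕ) + 1 / 3) :=
      mul_pos (by exact_mod_cast hw₂)
        (ratFun_pos (even_two_mul h) (by omega) (by push_cast; linarith))
    refine lt_of_lt_of_le (Rat.cast_pos.2 h1 : (0 : ℝ) < _) (ge_of_tendsto hL ?_)
    filter_upwards [eventually_gt_atTop (2 * (2 * h))] with M hM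
    exact_mod_cast le_sum_weightedTerm (even_two_mul h) (by omega) hw₁ hw hw₂.le hM
  have hLu : L ≤ W * ((27 / 10) ^ 58 * (2 * h : ℕ) ^ 60 * ratFunRate ^ h) * S := by
    refine le_of_tendsto' hL fun M => ?_
    have hW0 : 0 ≤ W := by
      have e1 : (0 : ℝ) ≤ (elimWeight i₀).1 := by exact_mod_cast hw₀
      have e2 : (0 : ℝ) ≤ (elimWeight i₀).2.2 := by exact_mod_cast hw₂.le
      linarith
    refine (sum_le_sum fun m _ => weightedTerm_le hn60 hw₀ hw₁ hw₂.le m).trans ?_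
    rw [← mul_sum]
    refine mul_le_mul_of_nonneg_left (hS.sum_le_tsum _ fun _ _ => by positivity) ?_
    exact mul_nonneg hW0 (mul_nonneg (by positivity) (pow_nonneg hρ.le _))
  have hz1 : (1 : ℝ) ≤ z := by
    have : (0 : ℝ) < z := by
      rw [← hz]
      positivity
    exact_mod_cast this
  have hle : (z : ℝ) ≤ 2 * q * W * S * (27 / 10) ^ 58 * 2 ^ 60 *
      ((h : ℝ) ^ 60 * ((31 / 10 : ℝ) ^ 154 * ratFunRate) ^ h) := by
    rw [← hz]
    calc 2 * (q : ℝ) * ((2 * h).lcmUpto : ℝ) ^ 77 * L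
        ≤ 2 * q * ((31 / 10) ^ (2 * h)) ^ 77 *
          (W * ((27 / 10) ^ 58 * (2 * h : ℕ) ^ 60 * ratFunRate ^ h) * S) := by gcongr
      _ = _ := by
        have e : (((31 / 10 : ℝ)) ^ (2 * h)) ^ 77 = ((31 / 10 : ℝ) ^ 154) ^ h := by
          rw [← pow_mul, ← pow_mul]
          congr 1
          ring
        rw [e, mul_pow _ ratFunRate]
        push_cast
        rw [mul_pow 2 (h : ℝ)]
        generalize (31 / 10 : ℝ) ^ 154 = a
        generalize (27 / 10 : ℝ) ^ 58 = b
        generalize (2 : ℝ) ^ 60 = c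
        ring
  linarith

end Conclusion

theorem stmt17 : ∃ i j : ℕ, Odd i ∧ Odd j ∧ 5 ≤ i ∧ i < j ∧ j ≤ 77 ∧
    Irrational (zetaVal i) ∧ Irrational (zetaVal j) := by
  by_contra hcon
  obtain ⟨i₀, hi₀, hrat⟩ : ∃ i₀, 5 ≤ i₀ ∧ ∀ i, Odd i → 5 ≤ i → i ≤ 77 → i ≠ i₀ →
      ¬ Irrational (zetaVal i) := by
    by_cases h : ∃ i, Odd i ∧ 5 ≤ i ∧ i ≤ 77 ∧ Irrational (zetaVal i)
    · obtain ⟨i₀, ho, h5, h77, hirr⟩ := h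
      refine ⟨i₀, h5, fun i hio hi5 hi77 hne hi => hcon ?_⟩
      rcases hne.lt_or_gt with hlt | hlt
      · exact ⟨i, i₀, hio, ho, hi5, hlt, h77, hi, hirr⟩
      · exact ⟨i₀, i, ho, hio, h5, hlt, hi77, hirr, hi⟩
    · exact ⟨5, le_rfl, fun i hio hi5 hi77 _ hi => h ⟨i, hio, hi5, hi77, hi⟩⟩
  obtain ⟨f, hf0, hf⟩ := exists_common_denominator
  refine not_forall_mul_zetaVal_mem_int hi₀
    (Finset.prod_pos fun i _ => hf0 i : 0 < ∏ i ∈ Finset.Icc 5 77, f i)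
    fun i hio hi5 hi77 hne => ?_
  obtain ⟨z, hz⟩ := hf i (hrat i hio hi5 hi77 hne)
  rw [← Finset.mul_prod_erase _ f (Finset.mem_Icc.2 ⟨hi5, hi77⟩)]
  refine ⟨(∏ x ∈ (Finset.Icc 5 77).erase i, f x : ℕ) * z, ?_⟩
  push_cast
  rw [← hz]
  ring
end
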